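/- There exist absolute constants C ≥ 1 and c ≥ 1 such that for every odd prime p, every λ ∈ F_p with λ ≠ 0 and all finite sets A, B, C, D ⊆ F_p one has I_λ(A,B,C,D) − |A||B||C||D|/p ≤ C (log p)^c ( |A|^{1/4} |B||C| |D|^{1/2} + |A|^{3/4} (|B||C|)^{41/48} |D|^{1/2} ). -/

import Mathlib

open Finset

/-- The number of quadruples `(a,b,c,d) ∈ A×B×C×D` with `(a+b)(c+d) = λ` in `F_p`. -/
def hypCount (p : ℕ) (lam : ZMod p) (A B C D : Finset (ZMod p)) : ℕ :=
  (((A ×ˢ B) ×ˢ (C ×ˢ D)).filter fun x => (x.1.1 + x.1.2) * (x.2.1 + x.2.2) = lam).card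

section PolyPart
variable {K : Type*} [Field K]

noncomputable def resL (s a b : K) : MvPolynomial (Fin 3) K →ₐ[K] Polynomial K :=
  MvPolynomial.aeval ![Polynomial.C s, Polynomial.X, Polynomial.C a * Polynomial.X + Polynomial.C b]

lemma resL_X0 (s a b : K) : resL s a b (MvPolynomial.X 0) = Polynomial.C s := by simp [resL]
lemma resL_X1 (s a b : K) : resL s a b (MvPolynomial.X 1) = Polynomial.X := by simp [resL]
lemma resL_X2 (s a b : K) : resL s a b (MvPolynomial.X 2) =
    Polynomial.C a * Polynomial.X + Polynomial.C b := by simp [resL]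

lemma natDegree_resL (s a b : K) (F : MvPolynomial (Fin 3) K) :
    (resL s a b F).natDegree ≤ F.totalDegree := by
  have := MvPolynomial.aeval_natDegree_le (m := F.totalDegree) (n := 1) F le_rfl
    (![Polynomial.C s, Polynomial.X, Polynomial.C a * Polynomial.X + Polynomial.C b]) (by
      intro i
      fin_cases i
      · simp
      · simp
      · exact Polynomial.natDegree_linear_le)
  simpa [resL] using this

lemma derivative_resL (s a b : K) (F : MvPolynomial (Fin 3) K) :
    Polynomial.derivative (resL s a b F) =
      resL s a b (MvPolynomial.pderiv 1 F) +
        Polynomial.C a * resL s a b (MvPolynomial.pderiv 2 F) := by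
  induction F using MvPolynomial.induction_on with
  | C r => simp [resL]
  | add f g hf hg => simp only [map_add, hf, hg]; ring
  | mul_X f i hf =>
    simp only [map_mul, Polynomial.derivative_mul, hf, MvPolynomial.pderiv_mul, map_add]
    fin_cases i
    · simp [resL_X0]; ring
    · simp [resL_X1]; ring
    · simp [resL_X2]; ring

/-- flecnodal-type polynomial in direction `i` -/
noncomputable def flec (i : Fin 3) (F : MvPolynomial (Fin 3) K) : MvPolynomial (Fin 3) K :=
  MvPolynomial.pderiv i (MvPolynomial.pderiv i F) * (MvPolynomial.pderiv 2 F) ^ 2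
  - 2 * MvPolynomial.pderiv i F * MvPolynomial.pderiv 2 F *
      MvPolynomial.pderiv i (MvPolynomial.pderiv 2 F)
  + (MvPolynomial.pderiv i F) ^ 2 * MvPolynomial.pderiv 2 (MvPolynomial.pderiv 2 F)

lemma pderiv_comm' (i j : Fin 3) (F : MvPolynomial (Fin 3) K) :
    MvPolynomial.pderiv i (MvPolynomial.pderiv j F) =
      MvPolynomial.pderiv j (MvPolynomial.pderiv i F) := by
  ext m
  simp only [MvPolynomial.coeff_pderiv]
  by_cases h : i = j
  · subst h; rfl
  · simp [h, Ne.symm h]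
    rw [add_right_comm]; ring

lemma resL_flec (s a b : K) (F : MvPolynomial (Fin 3) K) (h : resL s a b F = 0) :
    resL s a b (flec 1 F) = 0 := by
  have h1 := derivative_resL s a b F
  rw [h, Polynomial.derivative_zero] at h1
  have h2 := congrArg Polynomial.derivative h1
  simp only [Polynomial.derivative_zero, Polynomial.derivative_add, Polynomial.derivative_mul,
    Polynomial.derivative_C, derivative_resL, zero_mul, zero_add] at h2
  rw [pderiv_comm' 2 1] at h2
  have h3 : resL s a b (MvPolynomial.pderiv 1 F) =
    - (Polynomial.C a * resL s a b (MvPolynomial.pderiv 2 F)) := by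
    linear_combination -h1
  simp only [flec, map_add, map_sub, map_mul, map_pow, h3, map_ofNat]
  linear_combination (-(resL s a b (MvPolynomial.pderiv 2 F))^2) * h2

lemma totalDegree_pderiv_add_one (i : Fin 3) (F : MvPolynomial (Fin 3) K) 
    (h : MvPolynomial.pderiv i F ≠ 0) :
    (MvPolynomial.pderiv i F).totalDegree + 1 ≤ F.totalDegree := by
  have h0 : (MvPolynomial.pderiv i F).support.Nonempty := by
    simpa [Finset.nonempty_iff_ne_empty] using h
  obtain ⟨m, hm, hd⟩ := Finset.exists_mem_eq_sup _ h0 (fun s => s.sum fun _ e => e)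
  have : (MvPolynomial.pderiv i F).totalDegree = m.sum fun _ e => e := hd
  rw [this]
  rw [MvPolynomial.mem_support_iff, MvPolynomial.coeff_pderiv] at hm
  have h2 : m + Finsupp.single i 1 ∈ F.support := by
    rw [MvPolynomial.mem_support_iff]; exact left_ne_zero_of_mul hm
  have := MvPolynomial.le_totalDegree h2
  rw [Finsupp.sum_add_index' (by simp) (by simp)] at this
  simpa using this

lemma totalDegree_pderiv_le' (i : Fin 3) (F : MvPolynomial (Fin 3) K) :
    (MvPolynomial.pderiv i F).totalDegree ≤ F.totalDegree := by
  by_cases h : MvPolynomial.pderiv i F = 0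
  · simp [h]
  · have := totalDegree_pderiv_add_one i F h; omega

lemma totalDegree_flec (i : Fin 3) (F : MvPolynomial (Fin 3) K) :
    (flec i F).totalDegree ≤ 3 * F.totalDegree := by
  have a1 := totalDegree_pderiv_le' i F
  have a2 := totalDegree_pderiv_le' 2 F
  have a3 := totalDegree_pderiv_le' i (MvPolynomial.pderiv i F)
  have a4 := totalDegree_pderiv_le' i (MvPolynomial.pderiv 2 F)
  have a5 := totalDegree_pderiv_le' 2 (MvPolynomial.pderiv 2 F)
  have c2 : ((2 : MvPolynomial (Fin 3) K)).totalDegree = 0 := by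
    exact MvPolynomial.totalDegree_C (σ := Fin 3) (2 : K)
  unfold flec
  refine (MvPolynomial.totalDegree_add _ _).trans (max_le ((MvPolynomial.totalDegree_sub _ _).trans (max_le ?_ ?_)) ?_)
  · refine (MvPolynomial.totalDegree_mul _ _).trans ?_
    have := MvPolynomial.totalDegree_pow (MvPolynomial.pderiv 2 F) 2
    omega
  · refine (MvPolynomial.totalDegree_mul _ _).trans ?_
    have b1 := MvPolynomial.totalDegree_mul (2 * MvPolynomial.pderiv i F) (MvPolynomial.pderiv 2 F)
    have b2 := MvPolynomial.totalDegree_mul 2 (MvPolynomial.pderiv i F)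
    omega
  · refine (MvPolynomial.totalDegree_mul _ _).trans ?_
    have := MvPolynomial.totalDegree_pow (MvPolynomial.pderiv i F) 2
    omega

/-- if `∂F/∂Z = 0` and degree `< p`, then `F` is free of `Z`. -/
lemma free_of_pderiv_zero (p : ℕ) [hp : Fact p.Prime] [CharP K p] (F : MvPolynomial (Fin 3) K)
    (hd : F.totalDegree < p) (h : MvPolynomial.pderiv 2 F = 0) :
    ∀ m ∈ F.support, m 2 = 0 := by
  intro m hm
  by_contra h2
  have h1 := MvPolynomial.coeff_pderiv (i := 2) F (m - Finsupp.single 2 1)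
  have h3 : m - Finsupp.single 2 1 + Finsupp.single 2 1 = m := by
    apply tsub_add_cancel_of_le
    simpa using Nat.one_le_iff_ne_zero.mpr h2
  rw [h3, h, MvPolynomial.coeff_zero] at h1
  have h4 : m 2 ≤ F.totalDegree :=
    (MvPolynomial.le_degreeOf_of_mem_support 2 hm).trans (MvPolynomial.degreeOf_le_totalDegree _ _)
  have h5 : ((m - Finsupp.single 2 1 : Fin 3 →₀ ℕ) 2 : K) + 1 = (m 2 : ℕ) := by
    have : (m - Finsupp.single 2 1 : Fin 3 →₀ ℕ) 2 + 1 = m 2 := by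
      simp; omega
    exact_mod_cast congrArg (Nat.cast : ℕ → K) this
  rw [h5] at h1
  have h6 := mul_eq_zero.mp h1.symm
  rcases h6 with h6 | h6
  · exact (MvPolynomial.mem_support_iff.mp hm) h6
  · rw [CharP.cast_eq_zero_iff K p] at h6
    exact absurd (Nat.le_of_dvd (by omega) h6) (by omega)

/-- a nonzero polynomial free of `Z` vanishes on few lines. -/
lemma free_card_le (R : MvPolynomial (Fin 3) K) (hR : R ≠ 0) (hf : ∀ m ∈ R.support, m 2 = 0)
    (S : Finset K) (hS : ∀ s ∈ S, ∃ a b, resL s a b R = 0) : S.card ≤ R.degreeOf 0 := by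
  classical
  obtain ⟨m, hm⟩ : R.support.Nonempty := by simpa [Finset.nonempty_iff_ne_empty] using hR
  set r : Polynomial K := ∑ m' ∈ R.support.filter (fun m' => m' 1 = m 1),
    Polynomial.monomial (m' 0) (R.coeff m') with hr
  have hr0 : r ≠ 0 := by
    intro h0
    have : r.coeff (m 0) = R.coeff m := by
      rw [hr, Polynomial.finsetSum_coeff, Finset.sum_eq_single m]
      · simp
      · intro m' hm' hne
        rw [Polynomial.coeff_monomial, if_neg]
        intro h00
        apply hne
        simp only [Finset.mem_filter] at hm'
        ext i
        fin_cases i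
        · exact h00
        · exact hm'.2
        · simp [hf m hm, hf m' hm'.1]
      · intro hh; simp at hh; simp [hh]
    rw [h0] at this
    simp at this
    exact (MvPolynomial.mem_support_iff.mp hm) this.symm
  have hev : ∀ s ∈ S, r.eval s = 0 := by
    intro s hs
    obtain ⟨a, b, hab⟩ := hS s hs
    have h1 : (resL s a b R).coeff (m 1) = r.eval s := by
      rw [hr, Polynomial.eval_finsetSum, resL, MvPolynomial.aeval_def, MvPolynomial.eval₂_eq',
        Polynomial.finsetSum_coeff, Finset.sum_filter]
      refine Finset.sum_congr rfl fun m' hm' => ?_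
      rw [Fin.prod_univ_three]
      simp only [Matrix.cons_val_zero, Matrix.cons_val_one, Matrix.cons_val, hf m' hm', pow_zero,
        mul_one, Polynomial.eval_monomial, ← Polynomial.C_pow, Polynomial.algebraMap_eq]
      rw [Polynomial.coeff_C_mul, Polynomial.coeff_C_mul, Polynomial.coeff_X_pow]
      by_cases hc : m' 1 = m 1
      · rw [if_pos hc, if_pos hc.symm, mul_one]
      · rw [if_neg hc, if_neg (Ne.symm hc), mul_zero, mul_zero]
    rw [← h1, hab]; simp
  have hcard : S.card ≤ r.natDegree := by
    refine Polynomial.card_le_degree_of_subset_roots (p := r) ?_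
    intro s hs
    rw [Polynomial.mem_roots hr0]
    exact hev s hs
  refine hcard.trans ?_
  rw [hr]
  refine Polynomial.natDegree_sum_le_of_forall_le _ _ ?_
  intro m' hm'
  refine (Polynomial.natDegree_monomial_le _).trans ?_
  exact MvPolynomial.le_degreeOf_of_mem_support 0 (Finset.mem_filter.mp hm').1

noncomputable def expo (i j k : ℕ) : Fin 3 →₀ ℕ := Finsupp.equivFunOnFinite.symm ![i, j, k]

lemma expo_self (m : Fin 3 →₀ ℕ) : expo (m 0) (m 1) (m 2) = m := by
  ext i; fin_cases i <;> simp [expo]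

noncomputable def boxPoly (a b n : ℕ) :
    (Fin a × Fin b × Fin n → K) →ₗ[K] MvPolynomial (Fin 3) K :=
  ∑ x : Fin a × Fin b × Fin n,
    (MvPolynomial.monomial (expo x.1 x.2.1 x.2.2)).comp (LinearMap.proj x)

lemma boxPoly_apply (a b n : ℕ) (c : Fin a × Fin b × Fin n → K) : boxPoly a b n c =
    ∑ x : Fin a × Fin b × Fin n, MvPolynomial.monomial (expo x.1 x.2.1 x.2.2) (c x) := by
  simp [boxPoly]

lemma expo_inj {i j k i' j' k' : ℕ} (h : expo i j k = expo i' j' k') :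
    i = i' ∧ j = j' ∧ k = k' := by
  have h0 := DFunLike.congr_fun h 0
  have h1 := DFunLike.congr_fun h 1
  have h2 := DFunLike.congr_fun h 2
  simp [expo] at h0 h1 h2
  exact ⟨h0, h1, h2⟩

lemma coeff_boxPoly (a b n : ℕ) (c : Fin a × Fin b × Fin n → K) (x : Fin a × Fin b × Fin n) :
    (boxPoly a b n c).coeff (expo x.1 x.2.1 x.2.2) = c x := by
  classical
  rw [boxPoly_apply, MvPolynomial.coeff_sum, Finset.sum_eq_single x]
  · simp
  · intro y _ hne
    rw [MvPolynomial.coeff_monomial, if_neg]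
    intro h
    obtain ⟨h1, h2, h3⟩ := expo_inj h
    apply hne
    ext <;> assumption
  · simp

lemma boxPoly_ne_zero (a b n : ℕ) (c : Fin a × Fin b × Fin n → K) (h : boxPoly a b n c = 0) :
    c = 0 := by
  ext x
  rw [← coeff_boxPoly a b n c x, h]; simp

lemma mem_support_boxPoly (a b n : ℕ) (c : Fin a × Fin b × Fin n → K) (m : Fin 3 →₀ ℕ)
    (hm : m ∈ (boxPoly a b n c).support) : m 0 < a ∧ m 1 < b ∧ m 2 < n := by
  classical
  rw [MvPolynomial.mem_support_iff, boxPoly_apply, MvPolynomial.coeff_sum] at hm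
  obtain ⟨x, _, hx⟩ := Finset.exists_ne_zero_of_sum_ne_zero hm
  rw [MvPolynomial.coeff_monomial] at hx
  have h : expo x.1 x.2.1 x.2.2 = m := by
    by_contra h; simp [h] at hx
  rw [← h]
  simp [expo]

lemma degreeOf_mul_lt (i : Fin 3) (U F : MvPolynomial (Fin 3) K) (u f : ℕ)
    (hu : ∀ m ∈ U.support, m i < u) (hf : F.degreeOf i ≤ f) :
    ∀ m ∈ (U * F).support, m i < u + f := by
  classical
  intro m hm
  have := MvPolynomial.support_mul U F hm
  obtain ⟨x, hx, y, hy, rfl⟩ := Finset.mem_add.mp this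
  have h1 := hu x hx
  have h2 := MvPolynomial.le_degreeOf_of_mem_support i hy
  simp; omega

/-- weak Bezout -/
lemma bezout_aux (F H : MvPolynomial (Fin 3) K) (hF : Prime F) (hFH : ¬ F ∣ H)
    (hz : 0 < F.degreeOf 2) (e : ℕ) (he : F.totalDegree ≤ e) (hh : H.totalDegree ≤ 3 * e)
    (S : Finset K) (hS : ∀ s ∈ S, ∃ a b, resL s a b F = 0 ∧ resL s a b H = 0) :
    S.card ≤ 27 * e ^ 2 := by
  classical
  set dF := F.degreeOf 2 with hdF
  set dH := H.degreeOf 2 with hdH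
  set n := dF + dH with hn
  have hdFe : dF ≤ e := (MvPolynomial.degreeOf_le_totalDegree F 2).trans he
  have hdHe : dH ≤ 3 * e := (MvPolynomial.degreeOf_le_totalDegree H 2).trans hh
  have he1 : 1 ≤ e := by omega
  set E := 3 * e with hE
  set a := 2 * n * E with ha
  let W := (Fin a × Fin a × Fin dH → K) × (Fin a × Fin a × Fin dF → K)
  let B := Fin (a + E) × Fin (a + E) × Fin (n - 1)
  let comb : W →ₗ[K] MvPolynomial (Fin 3) K :=
    (LinearMap.mulRight K F).comp ((boxPoly a a dH).comp (LinearMap.fst K _ _)) +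
    (LinearMap.mulRight K H).comp ((boxPoly a a dF).comp (LinearMap.snd K _ _))
  let Φ : W →ₗ[K] (B → K) := LinearMap.pi fun x =>
    (MvPolynomial.lcoeff K (expo x.1 x.2.1 (x.2.2 + 1))).comp comb
  have hcomb : ∀ w : W, comb w = boxPoly a a dH w.1 * F + boxPoly a a dF w.2 * H := fun w => rfl
  have hdim : Module.finrank K (B → K) < Module.finrank K W := by
    simp only [W, B, Module.finrank_prod, Module.finrank_fintype_fun_eq_card, Fintype.card_prod, Fintype.card_fin]
    obtain ⟨q, hq⟩ : ∃ q, n = q + 1 := ⟨n - 1, by omega⟩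
    have hEp : 0 < E := by omega
    have e1 : a * (a * dH) + a * (a * dF) = a * a * n := by rw [hn]; ring
    rw [e1, ha, hq]
    simp only [Nat.add_sub_cancel]
    have : (2 * (q + 1) * E * (2 * (q + 1) * E) * (q + 1)) =
      (2 * (q + 1) * E + E) * ((2 * (q + 1) * E + E) * q) + E * E * (3 * q + 4) := by ring
    rw [this]
    have : 0 < E * E * (3 * q + 4) := by positivity
    omega
  have hker := LinearMap.ker_ne_bot_of_finrank_lt (f := Φ) hdim
  obtain ⟨w, hw, hw0⟩ := (Submodule.ne_bot_iff _).mp hker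
  rw [LinearMap.mem_ker] at hw
  set U := boxPoly a a dH w.1 with hU
  set V := boxPoly a a dF w.2 with hV
  set R := U * F + V * H with hR
  have hsupp : ∀ m ∈ R.support, m 0 < a + E ∧ m 1 < a + E ∧ m 2 < n := by
    intro m hm
    have hF0 : ∀ i, F.degreeOf i ≤ E := fun i =>
      (MvPolynomial.degreeOf_le_totalDegree F i).trans (by omega)
    have hH0 : ∀ i, H.degreeOf i ≤ E := fun i =>
      (MvPolynomial.degreeOf_le_totalDegree H i).trans (by omega)
    rcases Finset.mem_union.mp (MvPolynomial.support_add hm) with h | h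
    · have hb := mem_support_boxPoly a a dH w.1
      refine ⟨degreeOf_mul_lt 0 U F a E (fun m hm => (hb m hm).1) (hF0 0) m h,
        degreeOf_mul_lt 1 U F a E (fun m hm => (hb m hm).2.1) (hF0 1) m h, ?_⟩
      have := degreeOf_mul_lt 2 U F dH dF (fun m hm => (hb m hm).2.2) le_rfl m h
      omega
    · have hb := mem_support_boxPoly a a dF w.2
      refine ⟨degreeOf_mul_lt 0 V H a E (fun m hm => (hb m hm).1) (hH0 0) m h,
        degreeOf_mul_lt 1 V H a E (fun m hm => (hb m hm).2.1) (hH0 1) m h, ?_⟩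
      have := degreeOf_mul_lt 2 V H dF dH (fun m hm => (hb m hm).2.2) le_rfl m h
      omega
  have hfree : ∀ m ∈ R.support, m 2 = 0 := by
    intro m hm
    by_contra h2
    obtain ⟨b0, b1, b2⟩ := hsupp m hm
    have := congrFun hw (⟨m 0, b0⟩, ⟨m 1, b1⟩, ⟨m 2 - 1, by omega⟩)
    simp only [Φ, LinearMap.pi_apply, LinearMap.comp_apply, MvPolynomial.lcoeff_apply, hcomb,
      Pi.zero_apply] at this
    rw [show m 2 - 1 + 1 = m 2 by omega, expo_self] at this
    exact MvPolynomial.mem_support_iff.mp hm this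
  have hR0 : R ≠ 0 := by
    intro h0
    have h1 : F ∣ V * H := by
      refine ⟨-U, ?_⟩
      rw [hR] at h0
      linear_combination h0
    have h2 : F ∣ V := (hF.dvd_or_dvd h1).resolve_right hFH
    have hV0 : V = 0 := by
      by_contra hV0
      obtain ⟨G, hG⟩ := h2
      have hG0 : G ≠ 0 := by rintro rfl; simp at hG; exact hV0 hG
      have := MvPolynomial.degreeOf_mul_eq (n := 2) hF.ne_zero hG0
      rw [← hG] at this
      have h3 : V.degreeOf 2 < dF := by
        rw [MvPolynomial.degreeOf_lt_iff hz]
        intro m hm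
        exact (mem_support_boxPoly a a dF w.2 m hm).2.2
      omega
    have hU0 : U = 0 := by
      rw [hR, hV0] at h0
      simp at h0
      exact h0.resolve_right hF.ne_zero
    apply hw0
    ext1
    · exact boxPoly_ne_zero _ _ _ _ hU0
    · exact boxPoly_ne_zero _ _ _ _ hV0
  have hcard := free_card_le R hR0 hfree S (by
    intro s hs
    obtain ⟨x, y, h1, h2⟩ := hS s hs
    exact ⟨x, y, by rw [hR, map_add, map_mul, map_mul, h1, h2]; simp⟩)
  have hdR : R.degreeOf 0 < a + E := by
    rw [MvPolynomial.degreeOf_lt_iff (by omega)]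
    intro m hm
    exact (hsupp m hm).1
  have hn4 : n ≤ 4 * e := by omega
  have : a + E ≤ 27 * e ^ 2 := by
    rw [ha, hE]
    nlinarith
  omega

end PolyPart

section QuadricPart
variable {K : Type*} [Field K]

lemma exists_coeffDer {A : Type*} [CommRing A] (d : A →+ A)
    (hl : ∀ x y, d (x * y) = x * d y + y * d x) :
    ∃ D : Polynomial A →+ Polynomial A,
      (∀ x y, D (x * y) = x * D y + y * D x) ∧
      ∀ P i, (D P).coeff i = d (P.coeff i) := by
  let f : Polynomial A → Polynomial A := fun P =>
    ∑ i ∈ Finset.range (P.natDegree + 1), Polynomial.monomial i (d (P.coeff i))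
  have hf : ∀ P i, (f P).coeff i = d (P.coeff i) := by
    intro P i
    simp only [f, Polynomial.finsetSum_coeff, Polynomial.coeff_monomial]
    rw [Finset.sum_ite_eq']
    split_ifs with h
    · rfl
    · rw [Finset.mem_range, not_lt] at h
      rw [Polynomial.coeff_eq_zero_of_natDegree_lt (by omega), map_zero]
  refine ⟨⟨⟨f, ?_⟩, ?_⟩, ?_, hf⟩
  · ext1 i; rw [hf]; simp
  · intro x y; ext1 i; simp [hf]
  · intro x y
    ext1 i
    change (f (x * y)).coeff i = (x * f y + y * f x).coeff i
    rw [mul_comm y (f x), hf, Polynomial.coeff_add, Polynomial.coeff_mul, Polynomial.coeff_mul,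
      Polynomial.coeff_mul, map_sum, ← Finset.sum_add_distrib]
    refine Finset.sum_congr rfl fun q _ => ?_
    rw [hl, hf, hf]; ring

lemma chain_rule {B : Type*} [CommRing B] [Algebra K B] (D : B →+ B)
    (hl : ∀ x y, D (x * y) = x * D y + y * D x)
    (hD : ∀ r : K, D (algebraMap K B r) = 0) (g : Fin 3 → B) (F : MvPolynomial (Fin 3) K) :
    D (MvPolynomial.aeval g F) =
      ∑ j, MvPolynomial.aeval g (MvPolynomial.pderiv j F) * D (g j) := by
  induction F using MvPolynomial.induction_on with
  | C r => simp [hD]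
  | add f g hf hg => simp only [map_add, hf, hg, add_mul, Finset.sum_add_distrib]
  | mul_X f i hf =>
    simp only [map_mul, Derivation.leibniz, hl, hf, MvPolynomial.aeval_X, smul_eq_mul, map_add,
      add_mul, Finset.sum_add_distrib, MvPolynomial.pderiv_X]
    congr 1
    · rw [Finset.sum_eq_single i]
      · simp
      · intro b _ hb; simp [Ne.symm hb]
      · simp
    · rw [Finset.mul_sum]; refine Finset.sum_congr rfl fun j _ => by ring

/-- moving point -/
noncomputable def mv (i : Fin 3) {B : Type*} [CommRing B] (P : Fin 3 → B) (u v t : B) : Fin 3 → B :=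
  fun j => if j = i then P j + t * u else if j = 2 then P j - t * v else P j

lemma ruling (p : ℕ) [CharP K p] (i : Fin 3) (hi : i ≠ 2) (F : MvPolynomial (Fin 3) K)
    (hF : Prime F) (hd : F.totalDegree < p) (hz : ¬ F ∣ MvPolynomial.pderiv 2 F)
    (hH : F ∣ flec i F) (k : ℕ) :
    F ∣ (MvPolynomial.aeval (mv i (fun j => Polynomial.C (MvPolynomial.X j))
      (Polynomial.C (MvPolynomial.pderiv 2 F)) (Polynomial.C (MvPolynomial.pderiv i F))
      Polynomial.X) F : Polynomial (MvPolynomial (Fin 3) K)).coeff k := by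
  set FZ := MvPolynomial.pderiv 2 F with hFZ
  set FI := MvPolynomial.pderiv i F with hFI
  set g : Fin 3 → Polynomial (MvPolynomial (Fin 3) K) :=
    mv i (fun j => Polynomial.C (MvPolynomial.X j)) (Polynomial.C FZ) (Polynomial.C FI)
      Polynomial.X with hg
  set d0 : Derivation K (MvPolynomial (Fin 3) K) (MvPolynomial (Fin 3) K) :=
    FZ • MvPolynomial.pderiv i - FI • MvPolynomial.pderiv 2 with hd0
  set d : MvPolynomial (Fin 3) K →+ MvPolynomial (Fin 3) K := d0.toLinearMap.toAddMonoidHom with hdd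
  have hdap : ∀ G, d G = FZ * MvPolynomial.pderiv i G - FI * MvPolynomial.pderiv 2 G := by
    intro G; simp [hdd, hd0]
  have hdl : ∀ x y, d (x * y) = x * d y + y * d x := by
    intro x y; simp only [hdap, Derivation.leibniz, smul_eq_mul]; ring
  obtain ⟨D, hDl, hD⟩ := exists_coeffDer d hdl
  have hDC : ∀ G, D (Polynomial.C G) = Polynomial.C (d G) := by
    intro G; ext1 n
    rw [hD, Polynomial.coeff_C, Polynomial.coeff_C]; split_ifs <;> simp
  have hDX : D Polynomial.X = 0 := by
    ext1 n
    rw [hD, Polynomial.coeff_X]; split_ifs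
    · rw [hdap]; simp
    · simp
  have hDK : ∀ r : K, D (algebraMap K _ r) = 0 := by
    intro r
    have : (algebraMap K (Polynomial (MvPolynomial (Fin 3) K)) r) =
      Polynomial.C (MvPolynomial.C r) := rfl
    rw [this, hDC, hdap]; simp
  set G := MvPolynomial.aeval g F with hG
  set aI := MvPolynomial.aeval g FI with haI
  set aZ := MvPolynomial.aeval g FZ with haZ
  have hii : g i = Polynomial.C (MvPolynomial.X i) + Polynomial.X * Polynomial.C FZ := by
    simp [hg, mv]
  have h22 : g 2 = Polynomial.C (MvPolynomial.X 2) - Polynomial.X * Polynomial.C FI := by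
    simp [hg, mv, Ne.symm hi]
  have hoo : ∀ j, j ≠ i → j ≠ 2 → g j = Polynomial.C (MvPolynomial.X j) := by
    intro j h1 h2; simp [hg, mv, h1, h2]
  have hsum : ∀ f : Fin 3 → Polynomial (MvPolynomial (Fin 3) K),
      (∀ j, j ≠ i → j ≠ 2 → f j = 0) → ∑ j, f j = f i + f 2 := by
    intro f hf
    rw [← Finset.sum_subset (Finset.subset_univ {i, 2}), Finset.sum_pair hi]
    intro x _ hx
    simp only [Finset.mem_insert, Finset.mem_singleton, not_or] at hx
    exact hf x hx.1 hx.2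
  have e1 : D G = aI * (Polynomial.C FZ + Polynomial.X * Polynomial.C (d FZ)) +
      aZ * (- Polynomial.C FI - Polynomial.X * Polynomial.C (d FI)) := by
    rw [hG, chain_rule D hDl hDK, hsum, hii, h22]
    · simp only [map_add, map_sub, hDl, hDC, hDX, smul_eq_mul, mul_zero, add_zero,
        hdap (MvPolynomial.X _), MvPolynomial.pderiv_X_self, MvPolynomial.pderiv_X_of_ne hi,
        MvPolynomial.pderiv_X_of_ne hi.symm, ← haI, ← haZ, ← hFI, ← hFZ]
      simp [sub_eq_add_neg]
    · intro j h1 h2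
      rw [hoo j h1 h2, hDC, hdap]
      simp [MvPolynomial.pderiv_X_of_ne h1, MvPolynomial.pderiv_X_of_ne h2]
  have e2 : Polynomial.derivative G = aI * Polynomial.C FZ - aZ * Polynomial.C FI := by
    set D' : Polynomial (MvPolynomial (Fin 3) K) →+ _ :=
      (Polynomial.derivative (R := MvPolynomial (Fin 3) K)).toAddMonoidHom with hD'
    have hD'a : ∀ P, D' P = Polynomial.derivative P := fun P => rfl
    rw [← hD'a, hG, chain_rule D' (by intro x y; simp only [hD'a, Polynomial.derivative_mul]; ring), hsum, hii, h22]
    · simp only [hD'a, Polynomial.derivative_add, Polynomial.derivative_sub, Polynomial.derivative_mul,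
        Polynomial.derivative_C, Polynomial.derivative_X, ← haI, ← haZ, ← hFI, ← hFZ]
      ring
    · intro j h1 h2
      rw [hoo j h1 h2, hD'a]; simp
    · intro r
      have : (algebraMap K (Polynomial (MvPolynomial (Fin 3) K)) r) =
        Polynomial.C (MvPolynomial.C r) := rfl
      rw [this, hD'a, Polynomial.derivative_C]
  have e3 : FZ * d FI = FI * d FZ + flec i F := by
    rw [hdap, hdap, flec, hFI, hFZ, pderiv_comm' 2 i]; ring
  have e4 : Polynomial.C FZ * D G = Polynomial.C FZ * Polynomial.derivative G +
      Polynomial.C (d FZ) * (Polynomial.derivative G * Polynomial.X) -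
      Polynomial.C (flec i F) * (aZ * Polynomial.X) := by
    have e3' := congrArg Polynomial.C e3
    simp only [map_mul, map_add] at e3'
    rw [e1, e2]
    linear_combination (-aZ * Polynomial.X) * e3'
  have hdF : ∀ A, F ∣ A → F ∣ d A := by
    rintro A ⟨A', rfl⟩
    have : d F = 0 := by rw [hdap]; ring
    rw [hdl, this]; simp
  have hdeg : G.natDegree ≤ F.totalDegree := by
    have h1 : G = MvPolynomial.aeval g (MvPolynomial.map
        (algebraMap K (MvPolynomial (Fin 3) K)) F) := by
      rw [MvPolynomial.aeval_map_algebraMap]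
    rw [h1]
    have := MvPolynomial.aeval_natDegree_le (m := F.totalDegree) (n := 1) (MvPolynomial.map
        (algebraMap K (MvPolynomial (Fin 3) K)) F) (by
          exact Finset.sup_mono (MvPolynomial.support_map_subset _ _)) g (by
      intro j
      have : ∀ A B : MvPolynomial (Fin 3) K, (Polynomial.C A + Polynomial.X * Polynomial.C B).natDegree ≤ 1 := by
        intro A B
        rw [mul_comm, add_comm]; exact Polynomial.natDegree_linear_le
      by_cases h1 : j = i
      · subst h1; rw [hii]; exact this _ _
      · by_cases h2 : j = 2
        · subst h2; rw [h22]
          have := this (MvPolynomial.X 2) (-FI)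
          have e : (Polynomial.C (MvPolynomial.X 2) - Polynomial.X * Polynomial.C FI) =
            Polynomial.C (MvPolynomial.X 2) + Polynomial.X * Polynomial.C (-FI) := by
            rw [Polynomial.C_neg]; ring
          rw [e]; exact this
        · rw [hoo j h1 h2]; simp)
    simpa using this
  induction k with
  | zero =>
    have : G.coeff 0 = F := by
      rw [Polynomial.coeff_zero_eq_eval_zero, hG]
      have h1 : Polynomial.eval 0 (MvPolynomial.aeval g F) =
        ((Polynomial.aeval (0 : MvPolynomial (Fin 3) K)).restrictScalars K) (MvPolynomial.aeval g F) := by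
        simp [Polynomial.aeval_def, Polynomial.eval₂_eq_eval_map]
      rw [h1, MvPolynomial.comp_aeval_apply]
      have h2 : (fun j => ((Polynomial.aeval (0 : MvPolynomial (Fin 3) K)).restrictScalars K) (g j)) =
        MvPolynomial.X := by
        funext j
        by_cases h1 : j = i
        · subst h1; rw [hii]; simp
        · by_cases h2 : j = 2
          · subst h2; rw [h22]; simp
          · rw [hoo j h1 h2]; simp
      rw [h2]; simp
    rw [this]
  | succ k ih =>
    by_cases hk : F.totalDegree < k + 1
    · rw [Polynomial.coeff_eq_zero_of_natDegree_lt (by omega)]; exact dvd_zero _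
    have e5 := congrArg (fun P => Polynomial.coeff P k) e4
    simp only [Polynomial.coeff_sub, Polynomial.coeff_add, Polynomial.coeff_C_mul, hD,
      Polynomial.coeff_derivative] at e5
    have hx : F ∣ (Polynomial.derivative G * Polynomial.X).coeff k := by
      cases k with
      | zero => simp
      | succ k =>
        rw [Polynomial.coeff_mul_X, Polynomial.coeff_derivative]
        exact ih.mul_right _
    have h6 : F ∣ FZ * (G.coeff (k+1) * ((k : MvPolynomial (Fin 3) K) + 1)) := by
      have : FZ * (G.coeff (k+1) * ((k : MvPolynomial (Fin 3) K) + 1)) =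
        FZ * d (G.coeff k) - d FZ * (Polynomial.derivative G * Polynomial.X).coeff k +
          flec i F * (aZ * Polynomial.X).coeff k := by linear_combination -e5
      rw [this]
      exact dvd_add (dvd_sub ((hdF _ ih).mul_left _) (hx.mul_left _)) (hH.mul_right _)
    have h7 := (hF.dvd_or_dvd h6).resolve_left hz
    have hunit : IsUnit ((k : MvPolynomial (Fin 3) K) + 1) := by
      have : ((k : MvPolynomial (Fin 3) K) + 1) = MvPolynomial.C ((k + 1 : ℕ) : K) := by simp
      rw [this]
      apply IsUnit.map
      rw [isUnit_iff_ne_zero]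
      intro h0
      rw [CharP.cast_eq_zero_iff K p] at h0
      exact absurd (Nat.le_of_dvd (by omega) h0) (by omega)
    exact (IsUnit.dvd_mul_right hunit).mp h7

lemma ruling_eval (p : ℕ) [CharP K p] (i : Fin 3) (hi : i ≠ 2) (F : MvPolynomial (Fin 3) K)
    (hF : Prime F) (hd : F.totalDegree < p) (hz : ¬ F ∣ MvPolynomial.pderiv 2 F)
    (hH : F ∣ flec i F) {B : Type*} [CommRing B] [Algebra K B] (P : Fin 3 → B)
    (hP : MvPolynomial.aeval P F = 0) (t : B) :
    MvPolynomial.aeval (mv i P (MvPolynomial.aeval P (MvPolynomial.pderiv 2 F))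
      (MvPolynomial.aeval P (MvPolynomial.pderiv i F)) t) F = 0 := by
  have h := ruling p i hi F hF hd hz hH
  set G := (MvPolynomial.aeval (mv i (fun j => Polynomial.C (MvPolynomial.X j))
      (Polynomial.C (MvPolynomial.pderiv 2 F)) (Polynomial.C (MvPolynomial.pderiv i F))
      Polynomial.X) F : Polynomial (MvPolynomial (Fin 3) K)) with hG
  set φ : MvPolynomial (Fin 3) K →ₐ[K] B := MvPolynomial.aeval P with hφ
  set ψ : Polynomial (MvPolynomial (Fin 3) K) →ₐ[K] B :=
    Polynomial.eval₂AlgHom φ t (fun _ => mul_comm _ _) with hψ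
  have hψC : ∀ A, ψ (Polynomial.C A) = φ A := by intro A; exact Polynomial.eval₂_C _ _
  have hψX : ψ Polynomial.X = t := Polynomial.eval₂_X _ _
  have h0 : ψ G = 0 := by
    have : ψ G = Polynomial.eval₂ (φ : MvPolynomial (Fin 3) K →+* B) t G := rfl
    rw [this, Polynomial.eval₂_eq_sum, Polynomial.sum]
    refine Finset.sum_eq_zero fun n _ => ?_
    obtain ⟨A, hA⟩ := h n
    rw [hA]
    simp [hP]
  rw [hG, MvPolynomial.comp_aeval_apply] at h0
  rw [← h0]
  congr 2
  funext j
  simp only [mv]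
  split_ifs <;> simp [hψC, hψX, hφ] <;> ring

lemma zroot_unique {B : Type*} [CommRing B] [Algebra K B] (F : MvPolynomial (Fin 3) K)
    (x y w1 w2 : B) (h1 : MvPolynomial.aeval ![x, y, w1] F = 0)
    (h2 : MvPolynomial.aeval ![x, y, w2] F = 0) :
    ∃ k, (w1 - w2) * (MvPolynomial.aeval ![x, y, w2] (MvPolynomial.pderiv 2 F) + k * (w1 - w2)) = 0 := by
  set f : Polynomial B := MvPolynomial.aeval ![Polynomial.C x, Polynomial.C y, Polynomial.X] F with hf
  have hev : ∀ (G : MvPolynomial (Fin 3) K) (w : B), (MvPolynomial.aeval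
      ![Polynomial.C x, Polynomial.C y, Polynomial.X] G : Polynomial B).eval w =
      MvPolynomial.aeval ![x, y, w] G := by
    intro G w
    have h1 : Polynomial.eval w (MvPolynomial.aeval ![Polynomial.C x, Polynomial.C y, Polynomial.X] G) =
      ((Polynomial.aeval w).restrictScalars K) (MvPolynomial.aeval ![Polynomial.C x, Polynomial.C y, Polynomial.X] G) := by
      simp [Polynomial.aeval_def, Polynomial.eval₂_eq_eval_map]
    rw [h1, MvPolynomial.comp_aeval_apply]
    congr 2
    funext j
    fin_cases j <;> simp
  have hder : Polynomial.derivative f = MvPolynomial.aeval ![Polynomial.C x, Polynomial.C y, Polynomial.X]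
      (MvPolynomial.pderiv 2 F) := by
    set D' : Polynomial B →+ _ :=
      (Polynomial.derivative (R := B)).toAddMonoidHom with hD'
    have hD'a : ∀ P, D' P = Polynomial.derivative P := fun P => rfl
    rw [← hD'a, hf, chain_rule D' (by intro x y; simp only [hD'a, Polynomial.derivative_mul]; ring), Fin.sum_univ_three]
    · simp [hD'a]
    · intro r
      have : (algebraMap K (Polynomial B) r) = Polynomial.C (algebraMap K B r) := rfl
      rw [this, hD'a, Polynomial.derivative_C]
  obtain ⟨k, hk⟩ := f.binomExpansion w2 (w1 - w2)
  refine ⟨k, ?_⟩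
  rw [hder, hf, add_sub_cancel, hev, hev, hev, h1, h2] at hk
  linear_combination -hk

lemma quadric [Infinite K] (p : ℕ) [CharP K p] (F : MvPolynomial (Fin 3) K)
    (hF : Prime F) (hd : F.totalDegree < p) (hz : ¬ F ∣ MvPolynomial.pderiv 2 F)
    (hH0 : F ∣ flec 0 F) (hH1 : F ∣ flec 1 F) (x0 y0 z0 : K)
    (hP : MvPolynomial.aeval ![x0, y0, z0] F = 0)
    (hPz : MvPolynomial.aeval ![x0, y0, z0] (MvPolynomial.pderiv 2 F) ≠ 0) :
    ∃ e f g h : K, ∀ s a b, resL s a b F = 0 → a = e + f * s ∧ b = g + h * s := by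
  set FZ := MvPolynomial.pderiv 2 F with hFZ
  have hmv0 : ∀ {B : Type _} [CommRing B] (x y z u v t : B),
      mv 0 ![x, y, z] u v t = ![x + t * u, y, z - t * v] := by
    intros; funext j; fin_cases j <;> simp [mv]
  have hmv1 : ∀ {B : Type _} [CommRing B] (x y z u v t : B),
      mv 1 ![x, y, z] u v t = ![x, y + t * u, z - t * v] := by
    intros; funext j; fin_cases j <;> simp [mv]
  have r0 : ∀ {B : Type _} [CommRing B] [Algebra K B] (x y z t : B),
      MvPolynomial.aeval ![x, y, z] F = 0 →
      MvPolynomial.aeval ![x + t * MvPolynomial.aeval ![x, y, z] FZ, y, z - t * MvPolynomial.aeval ![x, y, z] (MvPolynomial.pderiv 0 F)] F = 0 := by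
    intro B _ _ x y z t h
    have := ruling_eval p 0 (by decide) F hF hd hz hH0 _ h t
    rwa [hmv0] at this
  have r1 : ∀ {B : Type _} [CommRing B] [Algebra K B] (x y z t : B),
      MvPolynomial.aeval ![x, y, z] F = 0 →
      MvPolynomial.aeval ![x, y + t * MvPolynomial.aeval ![x, y, z] FZ, z - t * MvPolynomial.aeval ![x, y, z] (MvPolynomial.pderiv 1 F)] F = 0 := by
    intro B _ _ x y z t h
    have := ruling_eval p 1 (by decide) F hF hd hz hH1 _ h t
    rwa [hmv1] at this
  -- constants into power series
  have hC : ∀ (x y z : K) (G : MvPolynomial (Fin 3) K),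
      MvPolynomial.aeval ![(PowerSeries.C x : PowerSeries K), PowerSeries.C y, PowerSeries.C z] G =
      PowerSeries.C (MvPolynomial.aeval ![x, y, z] G) := by
    intro x y z G
    have : (PowerSeries.C (MvPolynomial.aeval ![x, y, z] G) : PowerSeries K) =
      (Algebra.ofId K (PowerSeries K)) (MvPolynomial.aeval ![x, y, z] G) := rfl
    rw [this, MvPolynomial.comp_aeval_apply]
    congr 2
    funext j; fin_cases j <;> rfl
  have hcc : ∀ (x y z : PowerSeries K) (G : MvPolynomial (Fin 3) K),
      PowerSeries.constantCoeff (MvPolynomial.aeval ![x, y, z] G) =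
      MvPolynomial.aeval ![PowerSeries.constantCoeff x, PowerSeries.constantCoeff y, PowerSeries.constantCoeff z] G := by
    intro x y z G
    let cA : PowerSeries K →ₐ[K] K := AlgHom.mk (PowerSeries.constantCoeff (R := K)) (by
      intro r; simp [PowerSeries.algebraMap_apply])
    have : ∀ w, PowerSeries.constantCoeff w = cA w := fun w => rfl
    rw [this, MvPolynomial.comp_aeval_apply]
    congr 2
    funext j; fin_cases j <;> rfl
  set S : PowerSeries K := PowerSeries.X with hS
  set fz := MvPolynomial.aeval ![x0, y0, z0] FZ with hfz
  set μ := - MvPolynomial.aeval ![x0, y0, z0] (MvPolynomial.pderiv 0 F) / fz with hμ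
  set ν0 := - MvPolynomial.aeval ![x0, y0, z0] (MvPolynomial.pderiv 1 F) / fz with hν0
  let c (x : K) : PowerSeries K := PowerSeries.C x
  have cadd : ∀ x y, c (x + y) = c x + c y := fun x y => map_add _ _ _
  have cmul : ∀ x y, c (x * y) = c x * c y := fun x y => map_mul _ _ _
  have ccc : ∀ x, PowerSeries.constantCoeff (c x) = x := fun x => PowerSeries.constantCoeff_C x
  have ccS : PowerSeries.constantCoeff S = 0 := PowerSeries.constantCoeff_X
  -- moving in the x direction from a K-point
  have mx : ∀ x y z : K, MvPolynomial.aeval ![x, y, z] F = 0 →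
      MvPolynomial.aeval ![x, y, z] FZ ≠ 0 →
      MvPolynomial.aeval ![c x + S, c y, c z + c (- MvPolynomial.aeval ![x, y, z] (MvPolynomial.pderiv 0 F) / MvPolynomial.aeval ![x, y, z] FZ) * S] F = 0 := by
    intro x y z h1 h2
    have h3 := r0 (c x) (c y) (c z) (c (MvPolynomial.aeval ![x, y, z] FZ)⁻¹ * S) (by
      rw [hC, h1]; exact map_zero _)
    rw [hC, hC] at h3
    set A := MvPolynomial.aeval ![x, y, z] FZ with hA
    set A0 := MvPolynomial.aeval ![x, y, z] (MvPolynomial.pderiv 0 F) with hA0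
    have c1 : c A⁻¹ * c A = 1 := by rw [← cmul, inv_mul_cancel₀ h2]; exact map_one _
    have c2 : c (-A0 / A) = - (c A⁻¹ * c A0) := by
      rw [← cmul, neg_div, div_eq_inv_mul]; exact map_neg _ _
    have e1 : c x + S = c x + c A⁻¹ * S * PowerSeries.C A := by
      change _ = c x + c A⁻¹ * S * c A
      linear_combination (-S) * c1
    have e2 : c z + c (-A0 / A) * S = c z - c A⁻¹ * S * PowerSeries.C A0 := by
      change _ = c z - c A⁻¹ * S * c A0
      rw [c2]; ring
    rw [e1, e2]; exact h3
  have h1 := mx x0 y0 z0 hP hPz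
  rw [← hfz, ← hμ] at h1
  set u := MvPolynomial.aeval ![c x0 + S, c y0, c z0 + c μ * S] FZ with hu
  have hccP : ∀ G : MvPolynomial (Fin 3) K, PowerSeries.constantCoeff (MvPolynomial.aeval ![c x0 + S, c y0, c z0 + c μ * S] G) =
      MvPolynomial.aeval ![x0, y0, z0] G := by
    intro G; rw [hcc]; simp [ccc, ccS]
  have hu0 : PowerSeries.constantCoeff u ≠ 0 := by rw [hu, hccP]; exact hPz
  set ν := - MvPolynomial.aeval ![c x0 + S, c y0, c z0 + c μ * S] (MvPolynomial.pderiv 1 F) * u⁻¹ with hν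
  have hνc : PowerSeries.constantCoeff ν = ν0 := by
    rw [hν, map_mul, map_neg, hccP, PowerSeries.constantCoeff_inv, hu, hccP, hν0, ← hfz, div_eq_mul_inv]
  have h2 : ∀ τ : PowerSeries K, MvPolynomial.aeval ![c x0 + S, c y0 + τ, c z0 + c μ * S + ν * τ] F = 0 := by
    intro τ
    have h := r1 _ _ _ (τ * u⁻¹) h1
    rw [← hu] at h
    have e1 : τ * u⁻¹ * u = τ := by rw [mul_assoc, PowerSeries.inv_mul_cancel _ hu0, mul_one]
    rw [e1] at h
    have e2 : c z0 + c μ * S + ν * τ = c z0 + c μ * S - τ * u⁻¹ * MvPolynomial.aeval ![c x0 + S, c y0, c z0 + c μ * S] (MvPolynomial.pderiv 1 F) := by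
      rw [hν]; ring
    rw [e2]; exact h
  have h3 : ∀ t : K, MvPolynomial.aeval ![x0, y0 + t, z0 + ν0 * t] F = 0 := by
    intro t
    have h := r1 x0 y0 z0 (t * fz⁻¹) hP
    rw [← hfz] at h
    have e1 : t * fz⁻¹ * fz = t := by rw [mul_assoc, inv_mul_cancel₀ hPz, mul_one]
    have e2 : z0 + ν0 * t = z0 - t * fz⁻¹ * MvPolynomial.aeval ![x0, y0, z0] (MvPolynomial.pderiv 1 F) := by
      rw [hν0]; ring
    rw [e1] at h
    rw [e2]; exact h
  obtain ⟨t, ht0, ht⟩ : ∃ t : K, t ≠ 0 ∧ MvPolynomial.aeval ![x0, y0 + t, z0 + ν0 * t] FZ ≠ 0 := by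
    set q : Polynomial K := MvPolynomial.aeval ![Polynomial.C x0, Polynomial.C y0 + Polynomial.X,
      Polynomial.C z0 + Polynomial.C ν0 * Polynomial.X] FZ with hq
    have hqe : ∀ t, q.eval t = MvPolynomial.aeval ![x0, y0 + t, z0 + ν0 * t] FZ := by
      intro t
      rw [hq, ← Polynomial.coe_aeval_eq_eval, MvPolynomial.comp_aeval_apply]
      congr 2
      funext j; fin_cases j <;> simp
    have hq0 : q * Polynomial.X ≠ 0 := by
      apply mul_ne_zero _ Polynomial.X_ne_zero
      intro h
      have := hqe 0
      rw [h] at this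
      simp at this
      exact hPz this.symm
    by_contra hcon
    push Not at hcon
    apply hq0
    apply Polynomial.funext
    intro t
    rw [Polynomial.eval_mul, hqe, Polynomial.eval_X, Polynomial.eval_zero]
    by_cases h : t = 0
    · rw [h, mul_zero]
    · rw [hcon t h, zero_mul]
  have h4 := mx x0 (y0 + t) (z0 + ν0 * t) (h3 t) ht
  set μt := - MvPolynomial.aeval ![x0, y0 + t, z0 + ν0 * t] (MvPolynomial.pderiv 0 F) /
    MvPolynomial.aeval ![x0, y0 + t, z0 + ν0 * t] FZ with hμt
  have h5 := h2 (c t)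
  rw [← cadd] at h5
  obtain ⟨k, hk⟩ := zroot_unique F _ _ _ _ h5 h4
  have hcdiff : PowerSeries.constantCoeff (c z0 + c μ * S + ν * c t - (c (z0 + ν0 * t) + c μt * S)) = 0 := by
    simp [ccc, ccS, hνc]
  have h6 : c z0 + c μ * S + ν * c t - (c (z0 + ν0 * t) + c μt * S) = 0 := by
    rcases mul_eq_zero.mp hk with h | h
    · exact h
    · exfalso
      have := congrArg PowerSeries.constantCoeff h
      rw [map_add, map_mul, hcdiff, hcc] at this
      simp [ccc, ccS] at this
      exact ht this
  set κ := (μt - μ) / t with hκ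
  have h7 : ν = c ν0 + c κ * S := by
    have hct : c t ≠ 0 := by
      intro h
      have := congrArg PowerSeries.constantCoeff h
      rw [ccc] at this; simp at this; exact ht0 this
    apply mul_right_cancel₀ hct
    have e1 : c (z0 + ν0 * t) = c z0 + c ν0 * c t := by rw [cadd, cmul]
    have e2 : c κ * c t = c μt - c μ := by
      rw [← cmul, hκ, div_mul_cancel₀ _ ht0]; exact map_sub _ _ _
    rw [e1] at h6
    linear_combination h6 - S * e2
  have h8 : ∀ x y : K, MvPolynomial.aeval ![x0 + x, y0 + y, z0 + μ * x + (ν0 + κ * x) * y] F = 0 := by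
    intro x y
    have h := h2 (c y)
    rw [h7] at h
    set q : Polynomial K := MvPolynomial.aeval ![Polynomial.C x0 + Polynomial.X, Polynomial.C y0 + Polynomial.C y,
      Polynomial.C z0 + Polynomial.C μ * Polynomial.X + (Polynomial.C ν0 + Polynomial.C κ * Polynomial.X) * Polynomial.C y] F with hq
    have hq0 : q = 0 := by
      apply Polynomial.coe_injective
      rw [Polynomial.coe_zero, ← h, hq]
      have : ∀ w : Polynomial K, (w : PowerSeries K) = (Polynomial.coeToPowerSeries.algHom K) w := by
        intro w; simp [Polynomial.coeToPowerSeries.algHom_apply]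
      rw [this, MvPolynomial.comp_aeval_apply]
      congr 2
      funext j; fin_cases j <;> simp [c, hS, Polynomial.coeToPowerSeries.algHom_apply]
    have hqe : q.eval x = MvPolynomial.aeval ![x0 + x, y0 + y, z0 + μ * x + (ν0 + κ * x) * y] F := by
      rw [hq, ← Polynomial.coe_aeval_eq_eval, MvPolynomial.comp_aeval_apply]
      congr 2
      funext j; fin_cases j <;> simp
    rw [← hqe, hq0, Polynomial.eval_zero]
  let X' (i : Fin 3) : MvPolynomial (Fin 3) K := MvPolynomial.X i
  let C' (x : K) : MvPolynomial (Fin 3) K := MvPolynomial.C x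
  set Q : MvPolynomial (Fin 3) K := C' z0 + C' μ * (X' 0 - C' x0) + (C' ν0 + C' κ * (X' 0 - C' x0)) * (X' 1 - C' y0) with hQ
  have h9 : MvPolynomial.aeval ![X' 0, X' 1, Q] F = 0 := by
    apply MvPolynomial.funext
    intro v
    rw [map_zero]
    have := h8 (v 0 - x0) (v 1 - y0)
    rw [← this]
    have : ∀ w : MvPolynomial (Fin 3) K, MvPolynomial.eval v w = MvPolynomial.aeval v w := by
      intro w; simp [MvPolynomial.aeval_eq_eval]
    rw [this, MvPolynomial.comp_aeval_apply]
    congr 2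
    funext j; fin_cases j <;> simp [X', C', hQ]
  have h10 : X' 2 - Q ∣ F := by
    rw [← Ideal.mem_span_singleton, ← Ideal.Quotient.eq_zero_iff_mem]
    set π := Ideal.Quotient.mkₐ K (Ideal.span {X' 2 - Q}) with hπ
    change π F = 0
    have e2 : π (X' 2) = π Q := by
      rw [← sub_eq_zero, ← map_sub]
      exact Ideal.Quotient.eq_zero_iff_mem.mpr (Ideal.mem_span_singleton_self _)
    have e1 : π (MvPolynomial.aeval ![X' 0, X' 1, Q] F) = π F := by
      rw [MvPolynomial.comp_aeval_apply]
      conv_rhs => rw [← MvPolynomial.aeval_X_left_apply (p := F), MvPolynomial.comp_aeval_apply]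
      congr 2
      funext j; fin_cases j
      · rfl
      · rfl
      · exact e2.symm
    rw [← e1, h9, map_zero]
  have hres : ∀ s a b, resL s a b (X' 2 - Q) = Polynomial.C (a - (ν0 + κ * (s - x0))) * Polynomial.X +
      Polynomial.C (b - (z0 + μ * (s - x0) - (ν0 + κ * (s - x0)) * y0)) := by
    intro s a b
    have hCC : ∀ r, resL s a b (C' r) = Polynomial.C r := by
      intro r; simp [C', resL]
    simp only [hQ, map_sub, map_add, map_mul, hCC, X', resL_X0, resL_X1, resL_X2]
    ring
  obtain ⟨W, hW⟩ := h10
  have hnu : ¬ IsUnit (X' 2 - Q) := by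
    intro h
    have := h.map (resL 0 (1 + (ν0 + κ * (0 - x0))) 0)
    rw [hres] at this
    have h2 := Polynomial.natDegree_eq_zero_of_isUnit this
    rw [Polynomial.natDegree_linear (by ring_nf; exact one_ne_zero)] at h2
    omega
  have hWu : IsUnit W := (hF.irreducible.isUnit_or_isUnit hW).resolve_left hnu
  refine ⟨ν0 - κ * x0, κ, z0 - μ * x0 - ν0 * y0 + κ * x0 * y0, μ - κ * y0, ?_⟩
  intro s a b h
  rw [hW, map_mul] at h
  have hWs : resL s a b W ≠ 0 := (hWu.map (resL s a b)).ne_zero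
  have h11 := (mul_eq_zero.mp h).resolve_right hWs
  rw [hres] at h11
  have k1 := congrArg (fun P => Polynomial.coeff P 1) h11
  have k0 := congrArg (fun P => Polynomial.coeff P 0) h11
  simp only [Polynomial.coeff_add, Polynomial.coeff_C_mul, Polynomial.coeff_X_one, mul_one,
    Polynomial.coeff_C_succ, Polynomial.coeff_zero, add_zero, Polynomial.coeff_X_zero, mul_zero,
    Polynomial.coeff_C_zero, zero_add] at k0 k1
  constructor
  · linear_combination k1
  · linear_combination k0

end QuadricPart

section TheoremA
variable {K : Type*} [Field K]

noncomputable def swp : MvPolynomial (Fin 3) K ≃ₐ[K] MvPolynomial (Fin 3) K :=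
  MvPolynomial.renameEquiv K (Equiv.swap 0 1)

lemma swp_apply (F : MvPolynomial (Fin 3) K) :
    swp F = MvPolynomial.rename (Equiv.swap (0 : Fin 3) 1) F := rfl

lemma swp_swp (F : MvPolynomial (Fin 3) K) : swp (swp F) = F := by
  rw [swp_apply, swp_apply, MvPolynomial.rename_rename]
  have : (⇑(Equiv.swap (0 : Fin 3) 1) ∘ ⇑(Equiv.swap (0 : Fin 3) 1)) = id := by
    funext x; simp
  rw [this]; simp

lemma totalDegree_swp (F : MvPolynomial (Fin 3) K) : (swp F).totalDegree = F.totalDegree :=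
  MvPolynomial.totalDegree_renameEquiv _ _

lemma swp_pderiv0 (F : MvPolynomial (Fin 3) K) :
    MvPolynomial.pderiv 1 (swp F) = swp (MvPolynomial.pderiv 0 F) :=
  MvPolynomial.pderiv_rename (Equiv.swap (0 : Fin 3) 1).injective 0 F

lemma swp_pderiv2 (F : MvPolynomial (Fin 3) K) :
    MvPolynomial.pderiv 2 (swp F) = swp (MvPolynomial.pderiv 2 F) :=
  MvPolynomial.pderiv_rename (Equiv.swap (0 : Fin 3) 1).injective 2 F

lemma swp_flec (F : MvPolynomial (Fin 3) K) : flec 1 (swp F) = swp (flec 0 F) := by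
  simp only [flec, swp_pderiv0, swp_pderiv2, map_add, map_sub, map_mul, map_pow, map_ofNat]

lemma degreeOf_swp (F : MvPolynomial (Fin 3) K) : (swp F).degreeOf 2 = F.degreeOf 2 :=
  MvPolynomial.degreeOf_rename_of_injective (Equiv.swap (0 : Fin 3) 1).injective 2

lemma eval_resL (s a b t : K) (F : MvPolynomial (Fin 3) K) :
    (resL s a b F).eval t = MvPolynomial.aeval ![s, t, a * t + b] F := by
  rw [resL, ← Polynomial.coe_aeval_eq_eval, MvPolynomial.comp_aeval_apply]
  congr 2
  funext j; fin_cases j <;> simp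

lemma aeval_swp (x y z : K) (F : MvPolynomial (Fin 3) K) :
    MvPolynomial.aeval ![x, y, z] (swp F) = MvPolynomial.aeval ![y, x, z] F := by
  rw [swp_apply, MvPolynomial.aeval_rename]
  congr 2
  funext j; fin_cases j <;> simp [Equiv.swap_apply_def]

/-- incidence count -/
noncomputable def inc (α β γ δ : K → K) (S T : Finset K) : ℕ := by
  classical
  exact ((S ×ˢ T).filter fun x => α x.1 * x.2 + β x.1 = γ x.2 * x.1 + δ x.2).card

lemma inc_swap (α β γ δ : K → K) (S T : Finset K) : inc α β γ δ S T = inc γ δ α β T S := by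
  classical
  unfold inc
  refine Finset.card_bij (fun x _ => (x.2, x.1)) ?_ ?_ ?_
  · intro x hx
    simp only [mem_filter, mem_product] at hx ⊢
    exact ⟨⟨hx.1.2, hx.1.1⟩, hx.2.symm⟩
  · rintro ⟨a, b⟩ _ ⟨c, d⟩ _ h; simp at h; simp [h.1, h.2]
  · rintro ⟨a, b⟩ hx
    simp only [mem_filter, mem_product] at hx
    exact ⟨(b, a), by simp only [mem_filter, mem_product]; exact ⟨⟨hx.1.2, hx.1.1⟩, hx.2.symm⟩, rfl⟩

lemma inc_le_mul (α β γ δ : K → K) (S T : Finset K) : inc α β γ δ S T ≤ S.card * T.card := by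
  classical
  unfold inc
  exact (Finset.card_filter_le _ _).trans (by rw [Finset.card_product])

lemma inc_eq_sum [DecidableEq K] (α β γ δ : K → K) (S T : Finset K) : inc α β γ δ S T =
    ∑ s ∈ S, (T.filter fun t => α s * t + β s = γ t * s + δ t).card := by
  unfold inc
  simp only [Finset.card_filter, Finset.sum_product]
  refine Finset.sum_congr rfl fun s _ => Finset.sum_congr rfl fun t _ => ?_
  congr

lemma inc_split (α β γ δ : K → K) (S T : Finset K) (P : K → Prop) [DecidablePred P] :
    inc α β γ δ S T = inc α β γ δ (S.filter P) T + inc α β γ δ (S.filter (fun s => ¬ P s)) T := by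
  classical
  simp only [inc_eq_sum]
  rw [Finset.sum_filter_add_sum_filter_not]

lemma inc_split' (α β γ δ : K → K) (S T : Finset K) (P : K → Prop) [DecidablePred P] :
    inc α β γ δ S T = inc α β γ δ S (T.filter P) + inc α β γ δ S (T.filter (fun s => ¬ P s)) := by
  rw [inc_swap, inc_split _ _ _ _ _ _ P, inc_swap, inc_swap α β γ δ S (T.filter (fun s => ¬ P s))]

lemma inc_mono_right (α β γ δ : K → K) (S : Finset K) {T T' : Finset K} (h : T ⊆ T') :
    inc α β γ δ S T ≤ inc α β γ δ S T' := by
  classical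
  unfold inc
  exact Finset.card_le_card (Finset.filter_subset_filter _ (Finset.product_subset_product_right h))

lemma incL (α β γ δ : K → K) (S T : Finset K) (F : MvPolynomial (Fin 3) K) (e : ℕ)
    (he : F.totalDegree ≤ e)
    (hS : ∀ s ∈ S, resL s (α s) (β s) F ≠ 0) (hT : ∀ t ∈ T, resL t (γ t) (δ t) (swp F) = 0) :
    inc α β γ δ S T ≤ e * S.card := by
  classical
  rw [inc_eq_sum, mul_comm, ← smul_eq_mul]
  refine Finset.sum_le_card_nsmul _ _ _ fun s hs => ?_
  refine le_trans ?_ ((natDegree_resL s (α s) (β s) F).trans he)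
  refine le_trans ?_ ((Multiset.toFinset_card_le _).trans (Polynomial.card_roots' _))
  refine Finset.card_le_card fun t ht => ?_
  rw [Finset.mem_filter] at ht
  rw [Multiset.mem_toFinset, Polynomial.mem_roots (hS s hs), Polynomial.IsRoot, eval_resL, ht.2,
    ← aeval_swp, ← eval_resL, hT t ht.1, Polynomial.eval_zero]

lemma incM (α β γ δ : K → K) (S T : Finset K) (F : MvPolynomial (Fin 3) K) (e : ℕ)
    (he : F.totalDegree ≤ e)
    (hS : ∀ s ∈ S, resL s (α s) (β s) F = 0) (hT : ∀ t ∈ T, resL t (γ t) (δ t) (swp F) ≠ 0) :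
    inc α β γ δ S T ≤ e * T.card := by
  rw [inc_swap]
  exact incL γ δ α β T S (swp F) e (by rwa [totalDegree_swp]) hT (by simpa [swp_swp] using hS)

lemma degreeOf_pos (F : MvPolynomial (Fin 3) K) (h : MvPolynomial.pderiv 2 F ≠ 0) :
    0 < F.degreeOf 2 := by
  rw [Nat.pos_iff_ne_zero]
  intro h0
  apply h
  apply MvPolynomial.pderiv_eq_zero_of_notMem_vars
  intro hv
  rw [MvPolynomial.mem_vars] at hv
  obtain ⟨d, hd, hi⟩ := hv
  have := MvPolynomial.degreeOf_le_iff.mp h0.le d hd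
  simp at hi; omega

lemma irr_case1 (α β γ δ : K → K) (S T : Finset K) (F : MvPolynomial (Fin 3) K)
    (hF : Prime F) (hz : MvPolynomial.pderiv 2 F ≠ 0) (hH : ¬ F ∣ flec 0 F) (e : ℕ)
    (he : F.totalDegree ≤ e)
    (hS : ∀ s ∈ S, resL s (α s) (β s) F = 0) (hT : ∀ t ∈ T, resL t (γ t) (δ t) (swp F) = 0) :
    T.card ≤ 27 * e ^ 2 ∧ ∃ S' ⊆ S, S'.card ≤ 27 * e ^ 2 ∧
      inc α β γ δ S T ≤ inc α β γ δ S' T + 3 * e * S.card := by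
  classical
  have hdp := degreeOf_pos F hz
  have hfd := totalDegree_flec 0 F
  have hTf : ∀ t ∈ T, resL t (γ t) (δ t) (swp (flec 0 F)) = 0 := by
    intro t ht; rw [← swp_flec]; exact resL_flec _ _ _ _ (hT t ht)
  refine ⟨?_, S.filter (fun s => resL s (α s) (β s) (flec 0 F) = 0), Finset.filter_subset _ _, ?_, ?_⟩
  · refine bezout_aux (swp F) (swp (flec 0 F)) ((MulEquiv.prime_iff swp.toMulEquiv).mpr hF)
      (fun h => hH ((map_dvd_iff swp).mp h)) (by rwa [degreeOf_swp]) e (by rwa [totalDegree_swp])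
      (by rw [totalDegree_swp]; omega) T fun t ht => ⟨_, _, hT t ht, hTf t ht⟩
  · refine bezout_aux F (flec 0 F) hF hH hdp e he (by omega) _ fun s hs => ?_
    rw [Finset.mem_filter] at hs
    exact ⟨_, _, hS s hs.1, hs.2⟩
  · rw [inc_split _ _ _ _ S T (fun s => resL s (α s) (β s) (flec 0 F) = 0)]
    gcongr
    refine (incL α β γ δ _ T (flec 0 F) (3 * e) (by omega) (fun s hs => (Finset.mem_filter.mp hs).2) hTf).trans ?_
    gcongr
    exact Finset.filter_subset _ _

lemma exists_pt [IsAlgClosed K] (F H : MvPolynomial (Fin 3) K) (hF : Prime F) (hH : ¬ F ∣ H) :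
    ∃ x y z : K, MvPolynomial.aeval ![x, y, z] F = 0 ∧ MvPolynomial.aeval ![x, y, z] H ≠ 0 := by
  by_contra hcon
  push Not at hcon
  apply hH
  have h1 : H ∈ MvPolynomial.vanishingIdeal K (MvPolynomial.zeroLocus K (Ideal.span {F})) := by
    rw [MvPolynomial.mem_vanishingIdeal_iff]
    intro x hx
    rw [MvPolynomial.mem_zeroLocus_iff] at hx
    have h2 : x = ![x 0, x 1, x 2] := by funext j; fin_cases j <;> rfl
    rw [h2]; apply hcon; rw [← h2]
    exact hx F (Ideal.mem_span_singleton_self F)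
  rw [MvPolynomial.vanishingIdeal_zeroLocus_eq_radical] at h1
  obtain ⟨n, hn⟩ := h1
  rw [Ideal.mem_span_singleton] at hn
  exact hF.dvd_of_dvd_pow hn

lemma irr_bound [IsAlgClosed K] (p : ℕ) [Fact p.Prime] [CharP K p] (α β γ δ : K → K) (S T : Finset K) (F : MvPolynomial (Fin 3) K)
    (hF : Prime F) (e : ℕ) (he : F.totalDegree ≤ e) (hep : e < p)
    (hS : ∀ s ∈ S, resL s (α s) (β s) F = 0) (hT : ∀ t ∈ T, resL t (γ t) (δ t) (swp F) = 0)
    (k : ℕ) (hcol : ∀ e f g h : K, ∀ S' ⊆ S, (∀ s ∈ S', α s = e + f * s ∧ β s = g + h * s) → S'.card ≤ k)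
    (G : ℝ) (hG0 : 0 ≤ G) (hG : ∀ S' ⊆ S, ∀ T' ⊆ T, S'.card ≤ 27 * e ^ 2 → T'.card ≤ 27 * e ^ 2 →
      (inc α β γ δ S' T' : ℝ) ≤ G) :
    (inc α β γ δ S T : ℝ) ≤ 3 * e * (S.card + T.card) + k * T.card + G := by
  have n1 : (0 : ℝ) ≤ e * S.card := by positivity
  have n2 : (0 : ℝ) ≤ e * T.card := by positivity
  have n3 : (0 : ℝ) ≤ k * T.card := by positivity
  by_cases hz : MvPolynomial.pderiv 2 F = 0
  · have h1 := free_card_le F hF.ne_zero (free_of_pderiv_zero p F (by omega) hz) S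
      (fun s hs => ⟨_, _, hS s hs⟩)
    have h2 := MvPolynomial.degreeOf_le_totalDegree F 0
    have h3 : inc α β γ δ S T ≤ e * T.card :=
      (inc_le_mul _ _ _ _ _ _).trans (Nat.mul_le_mul_right _ (by omega))
    have h4 : (inc α β γ δ S T : ℝ) ≤ e * T.card := by exact_mod_cast h3
    nlinarith
  by_cases hH0 : F ∣ flec 0 F
  swap
  · obtain ⟨h1, S', hS', h2, h3⟩ := irr_case1 α β γ δ S T F hF hz hH0 e he hS hT
    have h4 := hG S' hS' T subset_rfl h2 h1
    have h5 : (inc α β γ δ S T : ℝ) ≤ inc α β γ δ S' T + 3 * e * S.card := by exact_mod_cast h3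
    nlinarith
  by_cases hH1 : F ∣ flec 1 F
  swap
  · have hz' : MvPolynomial.pderiv 2 (swp F) ≠ 0 := by
      rw [swp_pderiv2]; simpa using hz
    have hf' : flec 0 (swp F) = swp (flec 1 F) := by
      have := swp_flec (swp F)
      rw [swp_swp] at this
      rw [this, swp_swp]
    obtain ⟨h1, T', hT', h2, h3⟩ := irr_case1 γ δ α β T S (swp F)
      ((MulEquiv.prime_iff swp.toMulEquiv).mpr hF) hz'
      (by rw [hf']; exact fun h => hH1 ((map_dvd_iff swp).mp h)) e (by rwa [totalDegree_swp]) hT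
      (by simpa [swp_swp] using hS)
    have h4 := hG S subset_rfl T' hT' h1 h2
    rw [inc_swap, inc_swap γ δ] at h3
    have h5 : (inc α β γ δ S T : ℝ) ≤ inc α β γ δ S T' + 3 * e * T.card := by
      rw [inc_swap α β γ δ S T, inc_swap α β γ δ S T']
      rw [inc_swap α β γ δ S T, inc_swap α β γ δ S T'] at h3
      exact_mod_cast h3
    nlinarith
  have hzd : ¬ F ∣ MvPolynomial.pderiv 2 F := by
    rintro ⟨W, hW⟩
    have h1 := totalDegree_pderiv_add_one 2 F hz
    have hW0 : W ≠ 0 := by rintro rfl; simp at hW; exact hz hW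
    rw [hW, MvPolynomial.totalDegree_mul_of_isDomain hF.ne_zero hW0] at h1
    omega
  obtain ⟨x, y, z, hP, hPz⟩ := exists_pt F _ hF hzd
  haveI : Infinite K := IsAlgClosed.instInfinite
  obtain ⟨e', f, g, h, hq⟩ := quadric p F hF (by omega) hzd hH0 hH1 x y z hP hPz
  have h1 := hcol e' f g h S subset_rfl fun s hs => hq s _ _ (hS s hs)
  have h3 : inc α β γ δ S T ≤ k * T.card :=
      (inc_le_mul _ _ _ _ _ _).trans (Nat.mul_le_mul_right _ h1)
  have h4 : (inc α β γ δ S T : ℝ) ≤ k * T.card := by exact_mod_cast h3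
  nlinarith

set_option maxHeartbeats 1000000 in
lemma factor_bound [IsAlgClosed K] (p : ℕ) [Fact p.Prime] [CharP K p] (α β γ δ : K → K) (S0 : Finset K)
    (k : ℕ) (hcol : ∀ e f g h : K, ∀ S' ⊆ S0, (∀ s ∈ S', α s = e + f * s ∧ β s = g + h * s) → S'.card ≤ k)
    (Δ : ℕ) (hΔ : Δ < p)
    (G : ℕ → ℝ) (hG0 : ∀ e, 0 ≤ G e) (hGa : ∀ x y, G x + G y ≤ G (x + y))
    (hG : ∀ e ≤ Δ, ∀ S' ⊆ S0, ∀ T' : Finset K, S'.card ≤ 27 * e ^ 2 → T'.card ≤ 27 * e ^ 2 →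
      (inc α β γ δ S' T' : ℝ) ≤ G e) (F : MvPolynomial (Fin 3) K) :
    F ≠ 0 → F.totalDegree ≤ Δ → ∀ S ⊆ S0, ∀ T : Finset K, (∀ s ∈ S, resL s (α s) (β s) F = 0) →
    (∀ t ∈ T, resL t (γ t) (δ t) (swp F) = 0) →
    (inc α β γ δ S T : ℝ) ≤ 4 * F.totalDegree * (S.card + T.card) + k * T.card + G F.totalDegree := by
  classical
  induction F using UniqueFactorizationMonoid.induction_on_prime with
  | h₁ => intro h; exact absurd rfl h
  | h₂ F hu =>
    intro h0 hd S hS T hSF hTF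
    have : S = ∅ := by
      rw [Finset.eq_empty_iff_forall_notMem]
      intro s hs
      exact (hu.map (resL s (α s) (β s))).ne_zero (hSF s hs)
    have h1 : inc α β γ δ S T = 0 := by
      have := inc_le_mul α β γ δ S T
      rw [‹S = ∅›] at this ⊢
      simpa using this
    rw [h1]
    have := hG0 F.totalDegree
    push_cast
    positivity
  | h₃ F π hF0 hπ ih =>
    intro h0 hd S hS T hSF hTF
    have hdeg := MvPolynomial.totalDegree_mul_of_isDomain hπ.ne_zero hF0
    set d1 := π.totalDegree with hd1
    set d2 := F.totalDegree with hd2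
    rw [hdeg] at hd ⊢
    set S1 := S.filter (fun s => resL s (α s) (β s) π = 0) with hS1
    set S2 := S.filter (fun s => ¬ resL s (α s) (β s) π = 0) with hS2
    set T1 := T.filter (fun s => resL s (γ s) (δ s) (swp π) = 0) with hT1
    set T2 := T.filter (fun s => ¬ resL s (γ s) (δ s) (swp π) = 0) with hT2
    have hsplit : inc α β γ δ S T = inc α β γ δ S1 T1 + inc α β γ δ S1 T2 + (inc α β γ δ S2 T1 + inc α β γ δ S2 T2) := by
      rw [inc_split α β γ δ S T (fun s => resL s (α s) (β s) π = 0),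
        inc_split' α β γ δ S1 T (fun s => resL s (γ s) (δ s) (swp π) = 0),
        inc_split' α β γ δ S2 T (fun s => resL s (γ s) (δ s) (swp π) = 0)]
    have cS : S1.card + S2.card = S.card := Finset.card_filter_add_card_filter_not _
    have cT : T1.card + T2.card = T.card := Finset.card_filter_add_card_filter_not _
    have b1 := irr_bound p α β γ δ S1 T1 π hπ d1 le_rfl (by omega)
      (fun s hs => (Finset.mem_filter.mp hs).2) (fun s hs => (Finset.mem_filter.mp hs).2) k
      (fun e f g h S' hS' => hcol e f g h S' (hS'.trans ((Finset.filter_subset _ _).trans hS)))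
      (G d1) (hG0 d1) (fun S' hS' T' _ => hG d1 (by omega) S' (hS'.trans ((Finset.filter_subset _ _).trans hS)) T')
    have b2 := incM α β γ δ S1 T2 π d1 le_rfl (fun s hs => (Finset.mem_filter.mp hs).2)
      (fun s hs => (Finset.mem_filter.mp hs).2)
    have b3 := incL α β γ δ S2 T1 π d1 le_rfl (fun s hs => (Finset.mem_filter.mp hs).2)
      (fun s hs => (Finset.mem_filter.mp hs).2)
    have b4 := ih hF0 (by omega) S2 ((Finset.filter_subset _ _).trans hS) T2
      (fun s hs => by
        have h1 := Finset.mem_filter.mp hs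
        have h2 := hSF s h1.1
        rw [map_mul] at h2
        exact (mul_eq_zero.mp h2).resolve_left h1.2)
      (fun s hs => by
        have h1 := Finset.mem_filter.mp hs
        have h2 := hTF s h1.1
        rw [map_mul, map_mul] at h2
        exact (mul_eq_zero.mp h2).resolve_left h1.2)
    have b2' : (inc α β γ δ S1 T2 : ℝ) ≤ d1 * T2.card := by exact_mod_cast b2
    have b3' : (inc α β γ δ S2 T1 : ℝ) ≤ d1 * S2.card := by exact_mod_cast b3
    have hGs := hGa d1 d2
    rw [hsplit, ← cS, ← cT]
    push_cast
    clear_value d1 d2 S1 S2 T1 T2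
    have hnn : ∀ m n : ℕ, (0 : ℝ) ≤ (m : ℝ) * n := fun _ _ => by positivity
    have p1 := hnn d1 S1.card
    have p2 := hnn d1 T1.card
    have p3 := hnn d1 S2.card
    have p4 := hnn d1 T2.card
    have p5 := hnn d2 S1.card
    have p6 := hnn d2 T1.card
    generalize (inc α β γ δ S1 T1 : ℝ) = i1 at *
    generalize (inc α β γ δ S1 T2 : ℝ) = i2 at *
    generalize (inc α β γ δ S2 T1 : ℝ) = i3 at *
    generalize (inc α β γ δ S2 T2 : ℝ) = i4 at *
    linarith

end TheoremA

section TheoremA2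
variable {K : Type*} [Field K]

lemma exists_vanish (α β : K → K) (S : Finset K) (D0 : ℕ)
    (h : S.card * (2 * D0 + 1) < (D0 + 1) ^ 3) :
    ∃ F : MvPolynomial (Fin 3) K, F ≠ 0 ∧ F.totalDegree ≤ 3 * D0 ∧
      ∀ s ∈ S, resL s (α s) (β s) F = 0 := by
  classical
  set D := D0 + 1 with hD
  let W := (Fin D × Fin D × Fin D → K)
  let B := S × Fin (2 * D0 + 1)
  let Φ : W →ₗ[K] (B → K) := LinearMap.pi fun x =>
    (Polynomial.lcoeff K x.2).comp ((resL (x.1 : K) (α x.1) (β x.1)).toLinearMap.comp (boxPoly D D D))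
  have hdim : Module.finrank K (B → K) < Module.finrank K W := by
    simp only [W, B, Module.finrank_fintype_fun_eq_card, Fintype.card_prod, Fintype.card_fin,
      Fintype.card_coe]
    calc _ < _ := h
      _ = _ := by ring
  have hker := LinearMap.ker_ne_bot_of_finrank_lt (f := Φ) hdim
  obtain ⟨w, hw, hw0⟩ := (Submodule.ne_bot_iff _).mp hker
  rw [LinearMap.mem_ker] at hw
  refine ⟨boxPoly D D D w, fun h0 => hw0 (boxPoly_ne_zero _ _ _ _ h0), ?_, ?_⟩
  · refine Finset.sup_le fun m hm => ?_
    have := mem_support_boxPoly D D D w m hm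
    rw [Finsupp.sum_fintype _ _ (by simp), Fin.sum_univ_three]
    omega
  · intro s hs
    ext n
    rw [Polynomial.coeff_zero]
    by_cases hn : n < 2 * D0 + 1
    · have := congrFun hw (⟨s, hs⟩, ⟨n, hn⟩)
      simpa [Φ] using this
    · apply Polynomial.coeff_eq_zero_of_natDegree_lt
      refine lt_of_le_of_lt (b := 2 * D0) ?_ (by omega)
      rw [boxPoly_apply, map_sum]
      refine Polynomial.natDegree_sum_le_of_forall_le _ _ fun x _ => ?_
      have e1 : MvPolynomial.monomial (expo x.1 x.2.1 x.2.2) (w x) =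
        MvPolynomial.C (w x) * (MvPolynomial.X 0 ^ (x.1 : ℕ) * MvPolynomial.X 1 ^ (x.2.1 : ℕ) *
          MvPolynomial.X 2 ^ (x.2.2 : ℕ)) := by
        rw [MvPolynomial.monomial_eq, Finsupp.prod_fintype _ _ (by simp), Fin.prod_univ_three]
        simp [expo]
      have e2 : resL s (α s) (β s) (MvPolynomial.C (w x)) = Polynomial.C (w x) := by
        simp [resL]
      rw [e1]
      simp only [map_mul, map_pow, resL_X0, resL_X1, resL_X2, e2]
      refine (Polynomial.natDegree_C_mul_le _ _).trans ?_
      rw [← Polynomial.C_pow, mul_assoc]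
      refine (Polynomial.natDegree_C_mul_le _ _).trans ?_
      refine Polynomial.natDegree_mul_le.trans ?_
      have h1 : (Polynomial.X ^ (x.2.1 : ℕ) : Polynomial K).natDegree ≤ D0 := by
        rw [Polynomial.natDegree_X_pow]; have := x.2.1.2; omega
      have h2 : ((Polynomial.C (α s) * Polynomial.X + Polynomial.C (β s)) ^ (x.2.2 : ℕ)).natDegree ≤ D0 := by
        refine Polynomial.natDegree_pow_le.trans ?_
        have h3 : (Polynomial.C (α s) * Polynomial.X + Polynomial.C (β s)).natDegree ≤ 1 :=
          Polynomial.natDegree_linear_le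
        have := x.2.2.2
        nlinarith
      omega

lemma inc_parts (α β γ δ : K → K) (T : Finset K) (ν : ℕ) (hν : 0 < ν) (W : ℝ)
    (S0 : Finset K) (h : ∀ S' ⊆ S0, S'.card ≤ ν → (inc α β γ δ S' T : ℝ) ≤ W) :
    ∀ m : ℕ, ∀ S ⊆ S0, S.card ≤ m → (inc α β γ δ S T : ℝ) ≤ (S.card / ν + 1) * W := by
  classical
  have hW : 0 ≤ W := le_trans (Nat.cast_nonneg _) (h ∅ (Finset.empty_subset _) (by simp))
  intro m
  induction m with
  | zero =>
    intro S hS hm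
    refine (h S hS (by omega)).trans ?_
    have : (0 : ℝ) ≤ S.card / ν * W := by positivity
    linarith
  | succ m ih =>
    intro S hS hm
    by_cases hc : S.card ≤ ν
    · refine (h S hS hc).trans ?_
      have : (0 : ℝ) ≤ S.card / ν * W := by positivity
      linarith
    · obtain ⟨S', hS', hS'c⟩ := Finset.exists_subset_card_eq (show ν ≤ S.card by omega)
      have h1 := inc_split α β γ δ S T (fun s => s ∈ S')
      have e1 : S.filter (fun s => s ∈ S') = S' := by
        rw [Finset.filter_mem_eq_inter, Finset.inter_eq_right]; exact hS'
      have e2 : S.filter (fun s => ¬ s ∈ S') = S \ S' := by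
        ext; simp
      rw [e1, e2] at h1
      have hcard : (S \ S').card + ν = S.card := by
        rw [← hS'c]; exact Finset.card_sdiff_add_card_eq_card hS'
      have h2 := h S' (hS'.trans hS) hS'c.le
      have h3 := ih (S \ S') (Finset.sdiff_subset.trans hS) (by omega)
      rw [h1]
      push_cast
      have hc' : (S.card : ℝ) = (S \ S').card + ν := by exact_mod_cast hcard.symm
      have hν' : (ν : ℝ) ≠ 0 := by positivity
      rw [hc', add_div, div_self hν']
      linarith

noncomputable def Qc : ℝ := 10 * 5000 ^ 12

lemma rp1 (e : ℕ) : (((27 * e ^ 2 : ℕ) : ℝ)) ^ ((3 : ℝ) / 2) ≤ 141 * (e : ℝ) ^ 3 := by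
  have he : (0 : ℝ) ≤ e := Nat.cast_nonneg e
  have h1 : (27 : ℝ) ^ ((3 : ℝ) / 2) ≤ 141 := by
    rw [show (3 : ℝ) / 2 = (3 : ℕ) * (1 / 2) by norm_num, Real.rpow_mul (by norm_num), Real.rpow_natCast,
      ← Real.sqrt_eq_rpow]
    rw [Real.sqrt_le_left (by norm_num)]; norm_num
  push_cast
  rw [Real.mul_rpow (by norm_num) (by positivity), ← Real.rpow_natCast (e : ℝ) 2, ← Real.rpow_mul he,
    ← Real.rpow_natCast (e : ℝ) 3]
  rw [show ((2 : ℕ) : ℝ) * (3 / 2) = (3 : ℕ) by norm_num]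
  gcongr

lemma rp2 (e : ℕ) : (((27 * e ^ 2 : ℕ) : ℝ)) ^ ((7 : ℝ) / 6) ≤ 47 * (e : ℝ) ^ ((7 : ℝ) / 3) := by
  have he : (0 : ℝ) ≤ e := Nat.cast_nonneg e
  have h1 : (27 : ℝ) ^ ((7 : ℝ) / 6) ≤ 47 := by
    rw [show (7 : ℝ) / 6 = (7 : ℕ) * (1 / (6 : ℕ)) by norm_num, Real.rpow_mul (by norm_num), Real.rpow_natCast]
    calc ((27 : ℝ) ^ 7) ^ (1 / ((6 : ℕ) : ℝ)) ≤ ((47 : ℝ) ^ 6) ^ (1 / ((6 : ℕ) : ℝ)) := by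
          apply Real.rpow_le_rpow (by norm_num) (by norm_num) (by norm_num)
      _ = 47 := by rw [one_div]; exact Real.pow_rpow_inv_natCast (by norm_num) (by norm_num)
  push_cast
  rw [Real.mul_rpow (by norm_num) (by positivity), ← Real.rpow_natCast (e : ℝ) 2, ← Real.rpow_mul he]
  rw [show ((2 : ℕ) : ℝ) * (7 / 6) = 7 / 3 by norm_num]
  gcongr

lemma rp3 (w : ℝ) (hw : 0 ≤ w) (e : ℝ) (he0 : 0 ≤ e) (he : e ≤ 3 * w ^ 3) : e ^ ((7 : ℝ) / 3) ≤ 13 * w ^ 7 := by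
  have h1 : (3 : ℝ) ^ ((7 : ℝ) / 3) ≤ 13 := by
    rw [show (7 : ℝ) / 3 = (7 : ℕ) * (1 / (3 : ℕ)) by norm_num, Real.rpow_mul (by norm_num), Real.rpow_natCast]
    calc ((3 : ℝ) ^ 7) ^ (1 / ((3 : ℕ) : ℝ)) ≤ ((13 : ℝ) ^ 3) ^ (1 / ((3 : ℕ) : ℝ)) := by
          apply Real.rpow_le_rpow (by norm_num) (by norm_num) (by norm_num)
      _ = 13 := by rw [one_div]; exact Real.pow_rpow_inv_natCast (by norm_num) (by norm_num)
  calc e ^ ((7 : ℝ) / 3) ≤ (3 * w ^ 3) ^ ((7 : ℝ) / 3) := by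
        apply Real.rpow_le_rpow he0 he (by norm_num)
    _ = 3 ^ ((7 : ℝ) / 3) * w ^ 7 := by
        rw [Real.mul_rpow (by norm_num) (by positivity), ← Real.rpow_natCast w 3, ← Real.rpow_mul hw,
          ← Real.rpow_natCast w 7]
        norm_num
    _ ≤ _ := by gcongr

set_option maxHeartbeats 1000000 in
theorem thmA [IsAlgClosed K] (p : ℕ) [Fact p.Prime] [CharP K p] (α β γ δ : K → K) (S0 : Finset K)
    (k : ℕ) (hcol : ∀ e f g h : K, ∀ S' ⊆ S0, (∀ s ∈ S', α s = e + f * s ∧ β s = g + h * s) → S'.card ≤ k) :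
    ∀ n : ℕ, n ≤ p ^ 2 → ∀ S ⊆ S0, ∀ T : Finset K, S.card ≤ n → T.card ≤ n →
      (inc α β γ δ S T : ℝ) ≤ Qc * ((n : ℝ) ^ ((3 : ℝ) / 2) + k * (n : ℝ) ^ ((7 : ℝ) / 6)) := by
  classical
  intro n
  induction n using Nat.strong_induction_on with
  | _ n ih =>
  intro hnp S hS T hSn hTn
  have hn0 : (0 : ℝ) ≤ n := Nat.cast_nonneg n
  obtain ⟨w, hw0, hw6, hw9, hw7⟩ : ∃ w : ℝ, 0 ≤ w ∧ (n : ℝ) = (5000 * w) ^ 6 ∧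
      (n : ℝ) ^ ((3 : ℝ) / 2) = (5000 * w) ^ 9 ∧ (n : ℝ) ^ ((7 : ℝ) / 6) = (5000 * w) ^ 7 := by
    refine ⟨(n : ℝ) ^ ((1 : ℝ) / 6) / 5000, by positivity, ?_, ?_, ?_⟩ <;>
    · rw [mul_div_cancel₀ _ (by norm_num), ← Real.rpow_natCast, ← Real.rpow_mul hn0]
      norm_num
  rw [hw9, hw7]
  have hk0 : (0 : ℝ) ≤ k := Nat.cast_nonneg k
  have hSn' : (S.card : ℝ) ≤ n := by exact_mod_cast hSn
  have hTn' : (T.card : ℝ) ≤ n := by exact_mod_cast hTn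
  by_cases hw1 : w < 1
  · have h1 : (inc α β γ δ S T : ℝ) ≤ S.card * T.card := by exact_mod_cast inc_le_mul α β γ δ S T
    have h2 : (S.card : ℝ) * T.card ≤ n * n := by gcongr
    have h3 : (n : ℝ) * n ≤ Qc * (5000 * w) ^ 9 := by
      rw [hw6, Qc]
      have : w ^ 3 ≤ 1 := pow_le_one₀ hw0 hw1.le
      have h9 : 0 ≤ w ^ 9 := by positivity
      have e : (5000 * w) ^ 6 * (5000 * w) ^ 6 = 5000 ^ 12 * w ^ 9 * w ^ 3 := by ring
      rw [e]
      nlinarith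
    have h4 : 0 ≤ Qc * (k * (5000 * w) ^ 7) := by unfold Qc; positivity
    linarith
  push Not at hw1
  set D0 := ⌊w ^ 3⌋₊ with hD0
  have hD0w : (D0 : ℝ) ≤ w ^ 3 := Nat.floor_le (by positivity)
  have hD0w' : w ^ 3 < D0 + 1 := Nat.lt_floor_add_one _
  have hD01 : 1 ≤ D0 := by
    rw [hD0, Nat.one_le_floor_iff]; exact one_le_pow₀ hw1
  set Δ := 3 * D0 with hΔ
  have hΔw : (Δ : ℝ) ≤ 3 * w ^ 3 := by rw [hΔ]; push_cast; linarith
  have hw3 : 1 ≤ w ^ 3 := one_le_pow₀ hw1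
  have hpw : (5000 : ℝ) ^ 3 * w ^ 3 ≤ p := by
    have h1 : ((n : ℕ) : ℝ) ≤ (p : ℝ) ^ 2 := by exact_mod_cast hnp
    rw [hw6] at h1
    refine le_of_sq_le_sq ?_ (Nat.cast_nonneg p)
    calc _ = (5000 * w) ^ 6 := by ring
      _ ≤ _ := h1
  have hΔp : Δ < p := by
    have : (Δ : ℝ) < p := by nlinarith
    exact_mod_cast this
  have hΔn : 27 * Δ ^ 2 < n := by
    have : (27 * (Δ : ℝ) ^ 2) < n := by
      rw [hw6]
      have : (Δ : ℝ) ^ 2 ≤ (3 * w ^ 3) ^ 2 := by gcongr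
      have e : (5000 * w) ^ 6 = 5000 ^ 6 * (w ^ 3) ^ 2 := by ring
      rw [e]
      nlinarith
    exact_mod_cast this
  have hQ0 : 0 ≤ Qc := by unfold Qc; positivity
  set G : ℕ → ℝ := fun e => Qc * (141 * (e : ℝ) ^ 3 + 47 * k * (e : ℝ) ^ ((7 : ℝ) / 3)) with hG
  have hG0 : ∀ e, 0 ≤ G e := fun e => by simp only [hG]; positivity
  have hGa : ∀ x y, G x + G y ≤ G (x + y) := by
    intro x y
    have h1 : (x : ℝ) ^ ((7 : ℝ) / 3) + (y : ℝ) ^ ((7 : ℝ) / 3) ≤ ((x : ℝ) + y) ^ ((7 : ℝ) / 3) :=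
      Real.add_rpow_le_rpow_add (Nat.cast_nonneg x) (Nat.cast_nonneg y) (by norm_num)
    have h2 : (x : ℝ) ^ 3 + (y : ℝ) ^ 3 ≤ ((x : ℝ) + y) ^ 3 := by
      have : (0 : ℝ) ≤ 3 * x ^ 2 * y + 3 * x * y ^ 2 := by positivity
      nlinarith
    simp only [hG]
    push_cast
    rw [← mul_add]
    refine mul_le_mul_of_nonneg_left ?_ hQ0
    have h3 := mul_le_mul_of_nonneg_left h1 (show (0 : ℝ) ≤ 47 * k by positivity)
    linarith
  have hGI : ∀ e ≤ Δ, ∀ S' ⊆ S0, ∀ T' : Finset K, S'.card ≤ 27 * e ^ 2 → T'.card ≤ 27 * e ^ 2 →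
      (inc α β γ δ S' T' : ℝ) ≤ G e := by
    intro e he S' hS' T' h1 h2
    have h3 : 27 * e ^ 2 < n := lt_of_le_of_lt (by gcongr) hΔn
    refine (ih (27 * e ^ 2) h3 (by omega) S' hS' T' h1 h2).trans ?_
    simp only [hG]
    refine mul_le_mul_of_nonneg_left ?_ hQ0
    have := mul_le_mul_of_nonneg_left (rp2 e) hk0
    have := rp1 e
    linarith
  set ν := (D0 + 1) ^ 2 / 2 with hν
  set W : ℝ := 27 * w ^ 3 * n + k * n + Qc * (3807 * w ^ 9 + 611 * k * w ^ 7) with hW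
  have hpart : ∀ S' ⊆ S0 , S'.card ≤ n → S'.card ≤ ν → (inc α β γ δ S' T : ℝ) ≤ W := by
    intro S' hS' hSn hSν
    obtain ⟨F, hF0, hFd, hFS⟩ := exists_vanish α β S' D0 (by
      have h1 : 2 * ν ≤ (D0 + 1) ^ 2 := Nat.mul_div_le _ _
      have h2 : 2 * (S'.card * (2 * D0 + 1)) ≤ (D0 + 1) ^ 2 * (2 * D0 + 1) := by
        calc _ = 2 * S'.card * (2 * D0 + 1) := by ring
          _ ≤ _ := Nat.mul_le_mul_right _ (by omega)
      have h3 : (D0 + 1) ^ 2 * (2 * D0 + 1) < 2 * (D0 + 1) ^ 3 := by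
        have : 2 * (D0 + 1) ^ 3 = (D0 + 1) ^ 2 * (2 * D0 + 1) + (D0 + 1) ^ 2 := by ring
        have : 0 < (D0 + 1) ^ 2 := by positivity
        omega
      omega)
    set T1 := T.filter (fun s => resL s (γ s) (δ s) (swp F) = 0) with hT1
    set T2 := T.filter (fun s => ¬ resL s (γ s) (δ s) (swp F) = 0) with hT2
    have cT : T1.card + T2.card = T.card := Finset.card_filter_add_card_filter_not _
    have b1 := factor_bound p α β γ δ S0 k hcol Δ hΔp G hG0 hGa hGI F hF0 hFd S' hS' T1 hFS
      (fun s hs => (Finset.mem_filter.mp hs).2)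
    have b2 := incM α β γ δ S' T2 F Δ hFd hFS (fun s hs => (Finset.mem_filter.mp hs).2)
    have b2' : (inc α β γ δ S' T2 : ℝ) ≤ Δ * T2.card := by exact_mod_cast b2
    have hs := inc_split' α β γ δ S' T (fun s => resL s (γ s) (δ s) (swp F) = 0)
    rw [← hT1, ← hT2] at hs
    have hs' : (inc α β γ δ S' T : ℝ) = inc α β γ δ S' T1 + inc α β γ δ S' T2 := by exact_mod_cast hs
    have hdF : (F.totalDegree : ℝ) ≤ Δ := by exact_mod_cast hFd
    have c1 : (S'.card : ℝ) ≤ n := by exact_mod_cast hSn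
    have c2 : (T1.card : ℝ) ≤ n := le_trans (by exact_mod_cast (by omega : T1.card ≤ T.card)) hTn'
    have c3 : (T2.card : ℝ) ≤ n := le_trans (by exact_mod_cast (by omega : T2.card ≤ T.card)) hTn'
    have hGm : G F.totalDegree ≤ Qc * (3807 * w ^ 9 + 611 * k * w ^ 7) := by
      simp only [hG]
      refine mul_le_mul_of_nonneg_left ?_ hQ0
      have h3 : (F.totalDegree : ℝ) ≤ 3 * w ^ 3 := hdF.trans hΔw
      have h4 := rp3 w hw0 _ (Nat.cast_nonneg _) h3
      have h5 : (F.totalDegree : ℝ) ^ 3 ≤ (3 * w ^ 3) ^ 3 := by gcongr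
      have h6 := mul_le_mul_of_nonneg_left h4 (show (0 : ℝ) ≤ 47 * k by positivity)
      have e5 : (3 * w ^ 3) ^ 3 = 27 * w ^ 9 := by ring
      linarith
    have m1 : 4 * (F.totalDegree : ℝ) * (S'.card + T1.card) ≤ 4 * (3 * w ^ 3) * (n + n) := by
      gcongr; linarith
    have m2 : (Δ : ℝ) * T2.card ≤ 3 * w ^ 3 * n := by gcongr
    have m3 : (k : ℝ) * T1.card ≤ k * n := by gcongr
    rw [hs', hW]
    linarith
  have hνpos : 0 < ν := by
    have : 2 ^ 2 ≤ (D0 + 1) ^ 2 := by gcongr; omega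
    omega
  have hνw : 3 * w ^ 6 ≤ 8 * (ν : ℝ) := by
    have h1 : (D0 + 1) ^ 2 ≤ 2 * ν + 1 := by omega
    have h2 : ((D0 : ℝ) + 1) ^ 2 ≤ 2 * ν + 1 := by exact_mod_cast h1
    have h3 : (w ^ 3) ^ 2 ≤ ((D0 : ℝ) + 1) ^ 2 := by gcongr
    have h4 : (2 : ℝ) ≤ D0 + 1 := by
      have : (1 : ℝ) ≤ D0 := by exact_mod_cast hD01
      linarith
    have e : w ^ 6 = (w ^ 3) ^ 2 := by ring
    rw [e]
    nlinarith
  have hfin := inc_parts α β γ δ T ν hνpos W S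
    (fun S' hS' hc => hpart S' (hS'.trans hS) ((Finset.card_le_card hS').trans hSn) hc) S.card S subset_rfl le_rfl
  have hW0 : 0 ≤ W := by rw [hW]; positivity
  have hratio : (S.card : ℝ) / ν + 1 ≤ 4 * 5000 ^ 6 := by
    have hν0 : (0 : ℝ) < ν := by exact_mod_cast hνpos
    have : (S.card : ℝ) / ν ≤ 8 / 3 * 5000 ^ 6 := by
      rw [div_le_iff₀ hν0]
      refine hSn'.trans ?_
      rw [hw6]
      have e : (5000 * w) ^ 6 = 5000 ^ 6 * w ^ 6 := by ring
      rw [e]; linarith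
    linarith
  refine hfin.trans ((mul_le_mul_of_nonneg_right hratio hW0).trans ?_)
  have hw67 : w ^ 6 ≤ w ^ 7 := pow_le_pow_right₀ hw1 (by norm_num)
  have k67 : (k : ℝ) * w ^ 6 ≤ k * w ^ 7 := by gcongr
  have q9 : 0 ≤ w ^ 9 := by positivity
  have q7 : 0 ≤ k * w ^ 7 := by positivity
  rw [hW, hw6, Qc]
  have e1 : w ^ 3 * (5000 * w) ^ 6 = 5000 ^ 6 * w ^ 9 := by ring
  have e2 : (k : ℝ) * (5000 * w) ^ 6 = 5000 ^ 6 * (k * w ^ 6) := by ring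
  have e3 : (5000 * w) ^ 9 = 5000 ^ 9 * w ^ 9 := by ring
  have e4 : (k : ℝ) * (5000 * w) ^ 7 = 5000 ^ 7 * (k * w ^ 7) := by ring
  rw [mul_assoc 27, e1, e2, e3, e4, mul_assoc 611]
  generalize (k : ℝ) * w ^ 7 = z7 at *
  generalize (k : ℝ) * w ^ 6 = z6 at *
  generalize w ^ 9 = z9 at *
  clear * - k67 q9 q7
  linarith

end TheoremA2

section JBound

lemma exists_avoid {K : Type*} [Field K] [Infinite K] {ι : Type*} (I : Finset ι)
    (P : ι → Polynomial K) (hP : ∀ i ∈ I, P i ≠ 0) : ∃ θ : K, ∀ i ∈ I, (P i).eval θ ≠ 0 := by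
  have h1 : ∏ i ∈ I, P i ≠ 0 := Finset.prod_ne_zero_iff.mpr hP
  by_contra hcon
  push Not at hcon
  apply h1
  apply Polynomial.funext
  intro θ
  obtain ⟨i, hi, h⟩ := hcon θ
  rw [Polynomial.eval_prod, Polynomial.eval_zero]
  exact Finset.prod_eq_zero hi h

lemma exists_theta {K : Type*} [Field K] [Infinite K] {ι κ : Type*} [Finite ι] [Finite κ]
    (X1 X2 X3 : ι → K) (Y1 Y2 Y3 : κ → K)
    (hX : ∀ i j, X1 i = X1 j → X2 i = X2 j → X3 i = X3 j → i = j)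
    (hY : ∀ i j, Y1 i = Y1 j → Y2 i = Y2 j → Y3 i = Y3 j → i = j) :
    ∃ θ : K, (∀ i, X2 i - θ ^ 3 * X3 i - θ ^ 2 ≠ 0) ∧ (∀ j, θ ^ 3 * Y2 j + 1 ≠ 0) ∧
      (∀ i j, (X1 i - θ) * (X2 j - θ ^ 3 * X3 j - θ ^ 2) = (X1 j - θ) * (X2 i - θ ^ 3 * X3 i - θ ^ 2) → i = j) ∧
      (∀ i j, (θ * Y1 i + θ ^ 2 * Y2 i + Y3 i) * (θ ^ 3 * Y2 j + 1) =
        (θ * Y1 j + θ ^ 2 * Y2 j + Y3 j) * (θ ^ 3 * Y2 i + 1) → i = j) := by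
  classical
  haveI := Fintype.ofFinite ι
  haveI := Fintype.ofFinite κ
  let C : K → Polynomial K := fun x => Polynomial.C x
  let X : Polynomial K := Polynomial.X
  let P1 : ι → Polynomial K := fun i => C (X2 i) - X ^ 3 * C (X3 i) - X ^ 2
  let P2 : κ → Polynomial K := fun j => X ^ 3 * C (Y2 j) + 1
  let P3 : ι × ι → Polynomial K := fun q => (C (X1 q.1) - X) * P1 q.2 - (C (X1 q.2) - X) * P1 q.1
  let P4 : κ × κ → Polynomial K := fun q => (X * C (Y1 q.1) + X ^ 2 * C (Y2 q.1) + C (Y3 q.1)) * P2 q.2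
    - (X * C (Y1 q.2) + X ^ 2 * C (Y2 q.2) + C (Y3 q.2)) * P2 q.1
  let M (n : ℕ) (c : K) : Polynomial K := Polynomial.monomial n c
  have hM : ∀ n c, X ^ n * C c = M n c := fun n c => by
    simp only [X, C, M]; rw [mul_comm, Polynomial.C_mul_X_pow_eq_monomial]
  have e1 : ∀ i, P1 i ≠ 0 := by
    intro i h
    have : P1 i = M 0 (X2 i) + M 3 (-X3 i) + M 2 (-1) := by
      simp only [P1, ← hM, C, map_neg, map_one]; ring
    have h2 := congrArg (fun q => Polynomial.coeff q 2) (this.symm.trans h)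
    simp [M, Polynomial.coeff_monomial] at h2
  have e2 : ∀ i, P2 i ≠ 0 := by
    intro i h
    have : P2 i = M 0 1 + M 3 (Y2 i) := by
      simp only [P2, ← hM, C, map_one]; ring
    have h2 := congrArg (fun q => Polynomial.coeff q 0) (this.symm.trans h)
    simp [M, Polynomial.coeff_monomial] at h2
  have e3 : ∀ q : ι × ι, q.1 ≠ q.2 → P3 q ≠ 0 := by
    intro q hq h
    have : P3 q = M 0 (X1 q.1 * X2 q.2 - X1 q.2 * X2 q.1) + M 1 (X2 q.1 - X2 q.2) + M 2 (X1 q.2 - X1 q.1)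
        + M 3 (X1 q.2 * X3 q.1 - X1 q.1 * X3 q.2) + M 4 (X3 q.2 - X3 q.1) := by
      simp only [P3, P1, ← hM, C, map_sub, map_mul]; ring
    have h1 := congrArg (fun q => Polynomial.coeff q 1) (this.symm.trans h)
    have h2 := congrArg (fun q => Polynomial.coeff q 2) (this.symm.trans h)
    have h4 := congrArg (fun q => Polynomial.coeff q 4) (this.symm.trans h)
    simp [M, Polynomial.coeff_monomial, sub_eq_zero] at h1 h2 h4
    exact hq (hX _ _ h2.symm h1 h4.symm)
  have e4 : ∀ q : κ × κ, q.1 ≠ q.2 → P4 q ≠ 0 := by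
    intro q hq h
    have : P4 q = M 0 (Y3 q.1 - Y3 q.2) + M 1 (Y1 q.1 - Y1 q.2) + M 2 (Y2 q.1 - Y2 q.2)
        + M 3 (Y3 q.1 * Y2 q.2 - Y3 q.2 * Y2 q.1) + M 4 (Y1 q.1 * Y2 q.2 - Y1 q.2 * Y2 q.1) := by
      simp only [P4, P2, ← hM, C, map_sub, map_mul]; ring
    have h1 := congrArg (fun q => Polynomial.coeff q 0) (this.symm.trans h)
    have h2 := congrArg (fun q => Polynomial.coeff q 1) (this.symm.trans h)
    have h4 := congrArg (fun q => Polynomial.coeff q 2) (this.symm.trans h)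
    simp [M, Polynomial.coeff_monomial, sub_eq_zero] at h1 h2 h4
    exact hq (hY _ _ h2 h4 h1)
  obtain ⟨θ, hθ⟩ := exists_avoid (Finset.univ : Finset ((ι ⊕ κ) ⊕ ({q : ι × ι // q.1 ≠ q.2} ⊕ {q : κ × κ // q.1 ≠ q.2})))
    (Sum.elim (Sum.elim P1 P2) (Sum.elim (fun q => P3 q.1) (fun q => P4 q.1))) (by
      rintro ((i | j) | (q | q)) _
      · exact e1 i
      · exact e2 j
      · exact e3 q.1 q.2
      · exact e4 q.1 q.2)
  refine ⟨θ, ?_, ?_, ?_, ?_⟩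
  · intro i
    have := hθ (Sum.inl (Sum.inl i)) (Finset.mem_univ _)
    intro h
    apply this
    simp [P1, C, X]
    linear_combination h
  · intro i
    have := hθ (Sum.inl (Sum.inr i)) (Finset.mem_univ _)
    intro h
    apply this
    simp [P2, C, X]
    linear_combination h
  · intro i j h
    by_contra hij
    have := hθ (Sum.inr (Sum.inl ⟨(i, j), hij⟩)) (Finset.mem_univ _)
    apply this
    simp [P3, P1, C, X]
    linear_combination h
  · intro i j h
    by_contra hij
    have := hθ (Sum.inr (Sum.inr ⟨(i, j), hij⟩)) (Finset.mem_univ _)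
    apply this
    simp [P4, P2, C, X]
    linear_combination h

lemma div_helper1 {K : Type*} [Field K] (P Q e f : K) (hP : P ≠ 0) (h : 1 / P = e + f * (Q / P)) :
    e * P + f * Q = 1 := by
  field_simp at h
  linear_combination -h

lemma div_helper2 {K : Type*} [Field K] (P Q R e f : K) (hP : P ≠ 0) (h : R / P = e + f * (Q / P)) :
    R = e * P + f * Q := by
  field_simp at h
  linear_combination h

lemma div_helper3 {K : Type*} [Field K] (X1 X2 X3 Y1 Y2 Y3 θ P Q : K) (hP : P ≠ 0) (hQ : Q ≠ 0)
    (h1 : P = X2 - θ ^ 3 * X3 - θ ^ 2) (h2 : Q = θ ^ 3 * Y2 + 1)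
    (h : X1 * Y1 + X2 * Y2 + X3 + Y3 = 0) :
    1 / P * ((θ * Y1 + θ ^ 2 * Y2 + Y3) / Q) + X3 / P = - Y1 / Q * ((X1 - θ) / P) + - Y2 / Q := by
  have : (θ * Y1 + θ ^ 2 * Y2 + Y3) + X3 * Q = - Y1 * (X1 - θ) - Y2 * P := by
    rw [h1, h2]; linear_combination h
  field_simp
  linear_combination this

lemma Jbound (p : ℕ) [Fact p.Prime] (B : Finset (ZMod p)) (hb : B.card ^ 3 ≤ p ^ 2)
    (d b g k : ZMod p) (hd : d ≠ 0) :
    ((((B ×ˢ B) ×ˢ (B ×ˢ B) ×ˢ (B ×ˢ B)).filter fun x =>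
      d * (x.1.1 - x.1.2) * (x.2.1.1 - x.2.1.2) + b * (x.1.1 - x.1.2) + g * (x.2.1.1 - x.2.1.2)
        + (x.2.2.1 - x.2.2.2) + k = 0).card : ℝ) ≤ 2 * Qc * (B.card : ℝ) ^ ((9 : ℝ) / 2) := by
  classical
  let K := AlgebraicClosure (ZMod p)
  haveI : CharP K p := charP_of_injective_algebraMap (algebraMap (ZMod p) K).injective p
  haveI : Infinite K := IsAlgClosed.instInfinite
  let ι : ZMod p →+* K := algebraMap (ZMod p) K
  have hι : Function.Injective ι := (algebraMap (ZMod p) K).injective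
  let Tr := ZMod p × ZMod p × ZMod p
  -- points (b1, b3', b4)
  let X1 : Tr → K := fun x => ι x.1
  let X2 : Tr → K := fun x => ι x.2.1
  let X3 : Tr → K := fun x => ι (-d * x.1 * x.2.1 + b * x.1 - g * x.2.1 + x.2.2)
  -- planes (b3, b1', b4')
  let Y1 : Tr → K := fun x => ι (d * x.1)
  let Y2 : Tr → K := fun x => ι (d * x.2.1)
  let Y3 : Tr → K := fun x => ι (-d * x.2.1 * x.1 - b * x.2.1 + g * x.1 - x.2.2 + k)
  obtain ⟨θ, h1, h2, h3, h4⟩ := exists_theta X1 X2 X3 Y1 Y2 Y3 (by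
      rintro ⟨x, y, z⟩ ⟨x', y', z'⟩ e1 e2 e3
      have e1' : x = x' := hι e1
      have e2' : y = y' := hι e2
      have e3' := hι e3
      clear e1 e2 e3
      simp only at e3'
      subst e1' e2'
      obtain rfl : z = z' := by simpa using e3'
      rfl) (by
      rintro ⟨x, y, z⟩ ⟨x', y', z'⟩ e1 e2 e3
      have e1' : x = x' := mul_left_cancel₀ hd (hι e1)
      have e2' : y = y' := mul_left_cancel₀ hd (hι e2)
      have e3' := hι e3
      clear e1 e2 e3
      simp only at e3'
      subst e1' e2'
      obtain rfl : z = z' := by simpa using e3'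
      rfl)
  let p1 : Tr → K := fun x => X1 x - θ
  let p4 : Tr → K := fun x => X2 x - θ ^ 3 * X3 x - θ ^ 2
  let y2 : Tr → K := fun x => θ ^ 3 * Y2 x + 1
  let y3 : Tr → K := fun x => θ * Y1 x + θ ^ 2 * Y2 x + Y3 x
  have h1 : ∀ i, p4 i ≠ 0 := h1
  have h2 : ∀ i, y2 i ≠ 0 := h2
  let s : Tr → K := fun x => p1 x / p4 x
  let t : Tr → K := fun x => y3 x / y2 x
  have hs : Function.Injective s := by
    intro i j h
    apply h3 i j
    exact (div_eq_div_iff (h1 i) (h1 j)).mp h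
  have ht : Function.Injective t := by
    intro i j h
    apply h4 i j
    exact (div_eq_div_iff (h2 i) (h2 j)).mp h
  let α : K → K := Function.extend s (fun x => 1 / p4 x) 0
  let β : K → K := Function.extend s (fun x => X3 x / p4 x) 0
  let γ : K → K := Function.extend t (fun x => - Y1 x / y2 x) 0
  let δ : K → K := Function.extend t (fun x => - Y2 x / y2 x) 0
  have hα : ∀ x, α (s x) = 1 / p4 x := fun x => hs.extend_apply _ _ _
  have hβ : ∀ x, β (s x) = X3 x / p4 x := fun x => hs.extend_apply _ _ _
  have hγ : ∀ x, γ (t x) = - Y1 x / y2 x := fun x => ht.extend_apply _ _ _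
  have hδ : ∀ x, δ (t x) = - Y2 x / y2 x := fun x => ht.extend_apply _ _ _
  set B3 : Finset Tr := B ×ˢ B ×ˢ B with hB3
  have hB3c : B3.card = B.card ^ 3 := by
    rw [hB3, Finset.card_product, Finset.card_product]; ring
  have hcol : ∀ e f g h : K, ∀ S' ⊆ B3.image s,
      (∀ s ∈ S', α s = e + f * s ∧ β s = g + h * s) → S'.card ≤ B.card := by
    intro e f g' h S' hS' hh
    set P := B3.filter (fun x => s x ∈ S') with hP
    have hPS : S'.card ≤ P.card := by
      have : S' ⊆ P.image s := by
        intro z hz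
        obtain ⟨x, hx, rfl⟩ := Finset.mem_image.mp (hS' hz)
        exact Finset.mem_image_of_mem _ (Finset.mem_filter.mpr ⟨hx, hz⟩)
      exact (Finset.card_le_card this).trans Finset.card_image_le
    refine hPS.trans ?_
    have hB : ∀ x ∈ P, x.1 ∈ B ∧ x.2.1 ∈ B ∧ x.2.2 ∈ B := by
      intro x hx
      have := (Finset.mem_filter.mp hx).1
      rw [hB3, Finset.mem_product, Finset.mem_product] at this
      exact this
    have eq1 : ∀ x ∈ P, e * p4 x + f * p1 x = 1 := by
      intro x hx
      have := (hh _ (Finset.mem_filter.mp hx).2).1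
      rw [hα] at this
      have hne := h1 x
      have e2 : s x = p1 x / p4 x := rfl
      rw [e2] at this
      exact div_helper1 _ _ _ _ hne this
    have eq2 : ∀ x ∈ P, X3 x = g' * p4 x + h * p1 x := by
      intro x hx
      have := (hh _ (Finset.mem_filter.mp hx).2).2
      rw [hβ] at this
      have hne := h1 x
      have e2 : s x = p1 x / p4 x := rfl
      rw [e2] at this
      exact div_helper2 _ _ _ _ _ hne this
    have key : ∀ x y : Tr, p1 x = p1 y → p4 x = p4 y → X3 x = X3 y → x = y := by
      intro x y a1 a2 a3
      apply hs
      change p1 x / p4 x = p1 y / p4 y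
      rw [a1, a2]
    rcases P.eq_empty_or_nonempty with h0 | ⟨x0, hx0⟩
    · rw [h0]; simp
    by_cases he : e = 0
    · have hf : f ≠ 0 := by
        rintro rfl
        have := eq1 x0 hx0
        rw [he] at this; simp at this
      have hp1 : ∀ x ∈ P, ∀ y ∈ P, p1 x = p1 y := by
        intro x hx y hy
        apply mul_left_cancel₀ hf
        linear_combination eq1 x hx - eq1 y hy - (p4 x - p4 y) * he
      by_cases hg : 1 + g' * θ ^ 3 = 0
      · have hg0 : g' ≠ 0 := by
          rintro rfl; simp at hg
        refine Finset.card_le_card_of_injOn (fun x => x.2.2) (fun x hx => (hB x hx).2.2) ?_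
        intro x hx y hy hxy
        have q1 := hp1 x hx y hy
        have q2 : X2 x = X2 y := by
          apply mul_left_cancel₀ hg0
          have a1 := eq2 x hx
          have a2 := eq2 y hy
          simp only [p4] at a1 a2
          linear_combination (X3 x - X3 y) * hg - a1 + a2 - h * q1
        have r1 : x.1 = y.1 := by
          apply hι
          have : X1 x - θ = X1 y - θ := q1
          linear_combination this
        have r2 : x.2.1 = y.2.1 := hι q2
        exact Prod.ext r1 (Prod.ext r2 hxy)
      · refine Finset.card_le_card_of_injOn (fun x => x.2.1) (fun x hx => (hB x hx).2.1) ?_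
        intro x hx y hy hxy
        have q1 := hp1 x hx y hy
        have q2 : X2 x = X2 y := by
          change ι x.2.1 = ι y.2.1
          rw [show x.2.1 = y.2.1 from hxy]
        have q3 : X3 x = X3 y := by
          apply mul_left_cancel₀ hg
          have a1 := eq2 x hx
          have a2 := eq2 y hy
          simp only [p4] at a1 a2
          linear_combination g' * q2 + a1 - a2 + h * q1
        refine key x y q1 ?_ q3
        simp only [p4]
        rw [q2, q3]
    · refine Finset.card_le_card_of_injOn (fun x => x.1) (fun x hx => (hB x hx).1) ?_
      intro x hx y hy hxy
      have q1 : p1 x = p1 y := by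
        change ι x.1 - θ = ι y.1 - θ
        have : x.1 = y.1 := hxy
        rw [this]
      have q4 : p4 x = p4 y := by
        apply mul_left_cancel₀ he
        have := eq1 x hx
        have := eq1 y hy
        linear_combination eq1 x hx - eq1 y hy - f * q1
      refine key x y q1 q4 ?_
      rw [eq2 x hx, eq2 y hy, q1, q4]
  have hmain := thmA p α β γ δ (B3.image s) B.card hcol (B.card ^ 3) hb (B3.image s) (Finset.Subset.refl _)
    (B3.image t) (Finset.card_image_le.trans hB3c.le) (Finset.card_image_le.trans hB3c.le)
  have hcard : (((B ×ˢ B) ×ˢ (B ×ˢ B) ×ˢ (B ×ˢ B)).filter fun x =>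
      d * (x.1.1 - x.1.2) * (x.2.1.1 - x.2.1.2) + b * (x.1.1 - x.1.2) + g * (x.2.1.1 - x.2.1.2)
        + (x.2.2.1 - x.2.2.2) + k = 0).card ≤ inc α β γ δ (B3.image s) (B3.image t) := by
    unfold inc
    refine Finset.card_le_card_of_injOn
      (fun x => (s (x.1.1, x.2.1.2, x.2.2.1), t (x.2.1.1, x.1.2, x.2.2.2))) ?_ ?_
    · rintro ⟨⟨b1, b1'⟩, ⟨b3, b3'⟩, ⟨b4, b4'⟩⟩ hx
      have hx := Finset.mem_filter.mp hx
      obtain ⟨hx1, hx2⟩ := hx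
      simp only [Finset.mem_product] at hx1
      obtain ⟨⟨m1, m1'⟩, ⟨m3, m3'⟩, m4, m4'⟩ := hx1
      refine Finset.mem_coe.mpr (Finset.mem_filter.mpr ⟨Finset.mem_product.mpr
        ⟨Finset.mem_image_of_mem _ ?_, Finset.mem_image_of_mem _ ?_⟩, ?_⟩)
      · exact Finset.mem_product.mpr ⟨m1, Finset.mem_product.mpr ⟨m3', m4⟩⟩
      · exact Finset.mem_product.mpr ⟨m3, Finset.mem_product.mpr ⟨m1', m4'⟩⟩
      · simp only at hx2
        change α (s (b1, b3', b4)) * t (b3, b1', b4') + β (s (b1, b3', b4))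
          = γ (t (b3, b1', b4')) * s (b1, b3', b4) + δ (t (b3, b1', b4'))
        rw [hα, hβ, hγ, hδ]
        refine div_helper3 _ (X2 (b1, b3', b4)) _ _ _ _ _ _ _ (h1 _) (h2 _) rfl rfl ?_
        have := congrArg ι hx2
        simp only [X1, X2, X3, Y1, Y2, Y3, ← map_mul, ← map_add]
        rw [← map_zero ι]
        congr 1
        linear_combination hx2
    · rintro ⟨⟨b1, b1'⟩, ⟨b3, b3'⟩, ⟨b4, b4'⟩⟩ - ⟨⟨c1, c1'⟩, ⟨c3, c3'⟩, ⟨c4, c4'⟩⟩ - hxy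
      have hxy := Prod.ext_iff.mp hxy
      have u1 : ((b1, b3', b4) : ZMod p × ZMod p × ZMod p) = (c1, c3', c4) := hs hxy.1
      have u2 : ((b3, b1', b4') : ZMod p × ZMod p × ZMod p) = (c3, c1', c4') := ht hxy.2
      simp only [Prod.mk.injEq] at u1 u2 ⊢
      tauto
  have hcard' : ((((B ×ˢ B) ×ˢ (B ×ˢ B) ×ˢ (B ×ˢ B)).filter fun x =>
      d * (x.1.1 - x.1.2) * (x.2.1.1 - x.2.1.2) + b * (x.1.1 - x.1.2) + g * (x.2.1.1 - x.2.1.2)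
        + (x.2.2.1 - x.2.2.2) + k = 0).card : ℝ) ≤ inc α β γ δ (B3.image s) (B3.image t) := by
    exact_mod_cast hcard
  refine hcard'.trans (hmain.trans ?_)
  have hb0 : (0:ℝ) ≤ B.card := Nat.cast_nonneg _
  have z1 : ((B.card ^ 3 : ℕ) : ℝ) ^ ((3:ℝ)/2) = (B.card : ℝ) ^ ((9:ℝ)/2) := by
    push_cast
    rw [← Real.rpow_natCast, ← Real.rpow_mul hb0]; norm_num
  have z2 : (B.card : ℝ) * ((B.card ^ 3 : ℕ) : ℝ) ^ ((7:ℝ)/6) = (B.card : ℝ) ^ ((9:ℝ)/2) := by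
    push_cast
    rw [← Real.rpow_natCast, ← Real.rpow_mul hb0]
    nth_rewrite 1 [← Real.rpow_one (B.card : ℝ)]
    rw [← Real.rpow_add_of_nonneg hb0 (by norm_num) (by norm_num)]; norm_num
  rw [z1, z2]
  linarith
end JBound

section TBound

variable {F : Type*} [Field F] [DecidableEq F]

def Um (y : F) : Matrix (Fin 2) (Fin 2) F := !![1, y; 0, 1]
def Vm (x : F) : Matrix (Fin 2) (Fin 2) F := !![1, 0; x, 1]

lemma Um_mul (x y : F) : Um x * Um y = Um (x + y) := by
  ext i j; fin_cases i <;> fin_cases j <;> simp [Um, Matrix.mul_apply, Fin.sum_univ_two, add_comm]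
lemma Vm_mul (x y : F) : Vm x * Vm y = Vm (x + y) := by
  ext i j; fin_cases i <;> fin_cases j <;> simp [Vm, Matrix.mul_apply, Fin.sum_univ_two, add_comm]
lemma Um_zero : Um (0 : F) = 1 := by
  ext i j; fin_cases i <;> fin_cases j <;> simp [Um]
lemma Vm_zero : Vm (0 : F) = 1 := by
  ext i j; fin_cases i <;> fin_cases j <;> simp [Vm]
lemma Um_tr (y : F) : (Um y).transpose = Vm y := by
  ext i j; fin_cases i <;> fin_cases j <;> simp [Um, Vm]
lemma Vm_tr (y : F) : (Vm y).transpose = Um y := by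
  ext i j; fin_cases i <;> fin_cases j <;> simp [Um, Vm]

def Wd (y1 x1 y2 x2 y3 x3 y4 x4 : F) : Prop :=
  Um y1 * Vm x1 * Um y2 * Vm x2 * Um y3 * Vm x3 * Um y4 * Vm x4 = 1

lemma Wd_rev {y1 x1 y2 x2 y3 x3 y4 x4 : F} (h : Wd y1 x1 y2 x2 y3 x3 y4 x4) :
    Wd x4 y4 x3 y3 x2 y2 x1 y1 := by
  have := congrArg Matrix.transpose h
  simp only [Matrix.transpose_mul, Um_tr, Vm_tr, Matrix.transpose_one] at this
  unfold Wd
  simpa only [mul_assoc] using this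

lemma Wd_scalar {y1 x1 y2 x2 y3 x3 y4 x4 : F} (h : Wd y1 x1 y2 x2 y3 x3 y4 x4) :
    let δ := x1 + x2 + x1 * x2 * y2
    let γ := 1 + x2 * y2
    let β := 1 + x1 * y2
    γ + y1 * δ = 1 + x3 * y4 ∧ δ * y1 * y3 + β * y1 + γ * y3 + y4 + y2 = 0 ∧
      δ * y3 + β = 1 + x4 * y4 ∧ δ = -x4 - x3 - x3 * x4 * y4 := by
  have h2 : Um y1 * Vm x1 * Um y2 * Vm x2 * Um y3 = Vm (-x4) * Um (-y4) * Vm (-x3) := by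
    unfold Wd at h
    have a1 : Um y1 * Vm x1 * Um y2 * Vm x2 * Um y3 =
      Um y1 * Vm x1 * Um y2 * Vm x2 * Um y3 * (Vm x3 * (Um y4 * (Vm x4 * Vm (-x4)) * Um (-y4)) * Vm (-x3)) := by
      rw [Vm_mul, add_neg_cancel, Vm_zero, mul_one, Um_mul, add_neg_cancel, Um_zero, mul_one,
        Vm_mul, add_neg_cancel, Vm_zero, mul_one]
    rw [a1]
    have a2 : Um y1 * Vm x1 * Um y2 * Vm x2 * Um y3 * (Vm x3 * (Um y4 * (Vm x4 * Vm (-x4)) * Um (-y4)) * Vm (-x3)) = (Um y1 * Vm x1 * Um y2 * Vm x2 * Um y3 * Vm x3 * Um y4 * Vm x4) * (Vm (-x4) * Um (-y4) * Vm (-x3)) := by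
      simp only [mul_assoc]
    rw [a2, h, one_mul]
  have e00 := congrFun (congrFun h2 0) 0
  have e01 := congrFun (congrFun h2 0) 1
  have e10 := congrFun (congrFun h2 1) 0
  have e11 := congrFun (congrFun h2 1) 1
  simp [Um, Vm, Matrix.mul_apply, Fin.sum_univ_two] at e00 e01 e10 e11
  refine ⟨?_, ?_, ?_, ?_⟩
  · linear_combination e00
  · linear_combination e01
  · linear_combination e11
  · linear_combination e10

/-- indicator -/
noncomputable def ind (P : Prop) : ℝ := by classical exact if P then 1 else 0

lemma ind_true {P : Prop} (h : P) : ind P = 1 := by simp [ind, h]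
lemma ind_false {P : Prop} (h : ¬ P) : ind P = 0 := by simp [ind, h]
lemma ind_nonneg (P : Prop) : 0 ≤ ind P := by
  by_cases h : P
  · rw [ind_true h]; norm_num
  · rw [ind_false h]
lemma ind_le_one (P : Prop) : ind P ≤ 1 := by
  by_cases h : P
  · rw [ind_true h]
  · rw [ind_false h]; norm_num
lemma ind_le_of {P : Prop} {r : ℝ} (h0 : 0 ≤ r) (h : P → 1 ≤ r) : ind P ≤ r := by
  by_cases hP : P
  · rw [ind_true hP]; exact h hP
  · rw [ind_false hP]; exact h0
lemma ind_mono {P Q : Prop} (h : P → Q) : ind P ≤ ind Q :=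
  ind_le_of (ind_nonneg _) (fun hp => by rw [ind_true (h hp)])

lemma ind_congr {P Q : Prop} (h : P ↔ Q) : ind P = ind Q := by rw [propext h]

lemma sum_ind {ι : Type*} (s : Finset ι) (P : ι → Prop) [DecidablePred P] :
    ∑ i ∈ s, ind (P i) = ((s.filter P).card : ℝ) := by
  rw [Finset.card_filter]; push_cast
  refine Finset.sum_congr rfl (fun i _ => ?_)
  by_cases h : P i <;> simp [ind, h]

lemma sum_le_const {ι : Type*} (s : Finset ι) (f : ι → ℝ) (c : ℝ) (h : ∀ i ∈ s, f i ≤ c) :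
    ∑ i ∈ s, f i ≤ s.card * c := by
  have := Finset.sum_le_card_nsmul s f c h
  simpa using this

def dd (i : F × F) : F := i.1 - i.2

lemma sum_dd (B : Finset F) (z : F) : ∑ i ∈ B ×ˢ B, ind (dd i = z) ≤ B.card := by
  rw [sum_ind]
  norm_cast
  refine Finset.card_le_card_of_injOn (fun i => i.1) ?_ ?_
  · intro i hi
    exact (Finset.mem_product.mp (Finset.mem_filter.mp hi).1).1
  · intro i hi j hj h
    have h1 := (Finset.mem_filter.mp hi).2
    have h2 := (Finset.mem_filter.mp hj).2
    have h : i.1 = j.1 := h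
    unfold dd at h1 h2
    refine Prod.ext h ?_
    linear_combination h + h2 - h1

lemma card_sq (B : Finset F) : ((B ×ˢ B).card : ℝ) = (B.card : ℝ) ^ 2 := by
  rw [Finset.card_product]; push_cast; ring

noncomputable def Tq (B C : Finset F) : ℝ :=
  ∑ i1 ∈ C ×ˢ C, ∑ j2 ∈ B ×ˢ B, ∑ i2 ∈ C ×ˢ C, ∑ j1 ∈ B ×ˢ B, ∑ j3 ∈ B ×ˢ B, ∑ j4 ∈ B ×ˢ B,
    ∑ i3 ∈ C ×ˢ C, ∑ i4 ∈ C ×ˢ C,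
      ind (Wd (dd j1) (dd i1) (dd j2) (dd i2) (dd j3) (dd i3) (dd j4) (dd i4))

lemma pt_bound (y1 x1 y2 x2 y3 x3 y4 x4 : F) :
    ind (Wd y1 x1 y2 x2 y3 x3 y4 x4) ≤
      (ind (x1 + x2 + x1 * x2 * y2 ≠ 0) + ind (x1 + x2 + x1 * x2 * y2 = 0)) *
      ind ((x1 + x2 + x1 * x2 * y2) * y1 * y3 + (1 + x1 * y2) * y1 + (1 + x2 * y2) * y3 + y4 + y2 = 0)
        * ind (x3 = ((1 + x2 * y2) + y1 * (x1 + x2 + x1 * x2 * y2) - 1) / y4)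
        * ind (x4 = ((x1 + x2 + x1 * x2 * y2) * y3 + (1 + x1 * y2) - 1) / y4)
      + ind (x2 * (y2 + y1 + x1 * y1 * y2) = - (y1 * x1)) * ind (y3 = - (1 + x1 * y2) * y1 - y2)
        * ind (y4 = 0) * ind (x4 = - (x1 + x2 + x1 * x2 * y2) - x3) := by
  refine ind_le_of ?_ ?_
  · have := ind_nonneg
    refine add_nonneg ?_ ?_
    · exact mul_nonneg (mul_nonneg (mul_nonneg (add_nonneg (this _) (this _)) (this _)) (this _)) (this _)
    · exact mul_nonneg (mul_nonneg (mul_nonneg (this _) (this _)) (this _)) (this _)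
  · intro h
    obtain ⟨e1, e2, e3, e4⟩ := Wd_scalar h
    by_cases hy : y4 = 0
    · have a1 := ind_true (show x2 * (y2 + y1 + x1 * y1 * y2) = - (y1 * x1) by
        linear_combination e1 + x3 * hy)
      have a2 := ind_true (show y3 = - (1 + x1 * y2) * y1 - y2 by
        linear_combination e2 - y3 * e1 - hy * (1 + x3 * y3))
      have a3 := ind_true hy
      have a4 := ind_true (show x4 = - (x1 + x2 + x1 * x2 * y2) - x3 by
        linear_combination e4 - x3 * x4 * hy)
      rw [a1, a2, a3, a4]
      have := ind_nonneg
      have t : ∀ r : ℝ, 0 ≤ r → 1 ≤ r + 1 * 1 * 1 * 1 := fun r hr => by linarith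
      apply t
      exact mul_nonneg (mul_nonneg (mul_nonneg (add_nonneg (this _) (this _)) (this _)) (this _)) (this _)
    · have a1 := ind_true (show x3 = ((1 + x2 * y2) + y1 * (x1 + x2 + x1 * x2 * y2) - 1) / y4 by
        rw [eq_div_iff hy]; linear_combination -e1)
      have a2 := ind_true (show x4 = ((x1 + x2 + x1 * x2 * y2) * y3 + (1 + x1 * y2) - 1) / y4 by
        rw [eq_div_iff hy]; linear_combination -e3)
      have a3 := ind_true e2
      have a4 : ind (x1 + x2 + x1 * x2 * y2 ≠ 0) + ind (x1 + x2 + x1 * x2 * y2 = 0) = 1 := by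
        by_cases h0 : x1 + x2 + x1 * x2 * y2 = 0 <;> simp [ind, h0]
      rw [a1, a2, a3, a4]
      have := ind_nonneg
      have t : ∀ r : ℝ, 0 ≤ r → 1 ≤ 1 * 1 * 1 * 1 + r := fun r hr => by linarith
      apply t
      exact mul_nonneg (mul_nonneg (mul_nonneg (this _) (this _)) (this _)) (this _)

/-- inner double sum -/
lemma inner_bound (B C : Finset F) (y1 x1 y2 x2 y3 y4 : F) :
    ∑ i3 ∈ C ×ˢ C, ∑ i4 ∈ C ×ˢ C, ind (Wd y1 x1 y2 x2 y3 (dd i3) y4 (dd i4)) ≤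
      (C.card : ℝ) ^ 2 * ((ind (x1 + x2 + x1 * x2 * y2 ≠ 0) + ind (x1 + x2 + x1 * x2 * y2 = 0)) *
      ind ((x1 + x2 + x1 * x2 * y2) * y1 * y3 + (1 + x1 * y2) * y1 + (1 + x2 * y2) * y3 + y4 + y2 = 0))
      + (C.card : ℝ) ^ 3 * (ind (x2 * (y2 + y1 + x1 * y1 * y2) = - (y1 * x1)) * ind (y3 = - (1 + x1 * y2) * y1 - y2)
        * ind (y4 = 0)) := by
  have h0 := ind_nonneg
  set c : ℝ := (C.card : ℝ) with hc
  have hc0 : 0 ≤ c := Nat.cast_nonneg _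
  set P := (ind (x1 + x2 + x1 * x2 * y2 ≠ 0) + ind (x1 + x2 + x1 * x2 * y2 = 0)) *
      ind ((x1 + x2 + x1 * x2 * y2) * y1 * y3 + (1 + x1 * y2) * y1 + (1 + x2 * y2) * y3 + y4 + y2 = 0) with hP
  set Q := ind (x2 * (y2 + y1 + x1 * y1 * y2) = - (y1 * x1)) * ind (y3 = - (1 + x1 * y2) * y1 - y2)
        * ind (y4 = 0) with hQ
  have hP0 : 0 ≤ P := mul_nonneg (add_nonneg (h0 _) (h0 _)) (h0 _)
  have hQ0 : 0 ≤ Q := mul_nonneg (mul_nonneg (h0 _) (h0 _)) (h0 _)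
  set z1 := ((1 + x2 * y2) + y1 * (x1 + x2 + x1 * x2 * y2) - 1) / y4 with hz1
  set z2 := ((x1 + x2 + x1 * x2 * y2) * y3 + (1 + x1 * y2) - 1) / y4 with hz2
  have step : ∀ i3 ∈ C ×ˢ C, ∑ i4 ∈ C ×ˢ C, ind (Wd y1 x1 y2 x2 y3 (dd i3) y4 (dd i4)) ≤
      P * ind (dd i3 = z1) * c + Q * c := by
    intro i3 _
    calc _ ≤ ∑ i4 ∈ C ×ˢ C, (P * ind (dd i3 = z1) * ind (dd i4 = z2)
          + Q * ind (dd i4 = - (x1 + x2 + x1 * x2 * y2) - dd i3)) :=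
          Finset.sum_le_sum (fun i4 _ => pt_bound y1 x1 y2 x2 y3 (dd i3) y4 (dd i4))
      _ = P * ind (dd i3 = z1) * ∑ i4 ∈ C ×ˢ C, ind (dd i4 = z2)
          + Q * ∑ i4 ∈ C ×ˢ C, ind (dd i4 = - (x1 + x2 + x1 * x2 * y2) - dd i3) := by
          rw [Finset.sum_add_distrib, Finset.mul_sum, Finset.mul_sum]
      _ ≤ _ := add_le_add (mul_le_mul_of_nonneg_left (sum_dd C _) (mul_nonneg hP0 (h0 _)))
          (mul_le_mul_of_nonneg_left (sum_dd C _) hQ0)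
  calc _ ≤ ∑ i3 ∈ C ×ˢ C, (P * ind (dd i3 = z1) * c + Q * c) := Finset.sum_le_sum step
    _ = P * c * ∑ i3 ∈ C ×ˢ C, ind (dd i3 = z1) + c ^ 2 * (Q * c) := by
        rw [Finset.sum_add_distrib, Finset.mul_sum, Finset.sum_const, nsmul_eq_mul, card_sq]
        congr 1
        refine Finset.sum_congr rfl (fun i _ => by ring)
    _ ≤ P * c * c + c ^ 2 * (Q * c) := by
        have := mul_le_mul_of_nonneg_left (sum_dd C z1) (mul_nonneg hP0 hc0)
        linarith
    _ = _ := by ring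

lemma mid_bound (B C : Finset F) (J : ℝ) (x1 y2 x2 : F)
    (hJ : ∀ d b g k : F, d ≠ 0 → ∑ j1 ∈ B ×ˢ B, ∑ j3 ∈ B ×ˢ B, ∑ j4 ∈ B ×ˢ B,
      ind (d * dd j1 * dd j3 + b * dd j1 + g * dd j3 + dd j4 + k = 0) ≤ J) :
    ∑ j1 ∈ B ×ˢ B, ∑ j3 ∈ B ×ˢ B, ∑ j4 ∈ B ×ˢ B, ∑ i3 ∈ C ×ˢ C, ∑ i4 ∈ C ×ˢ C,
      ind (Wd (dd j1) x1 y2 x2 (dd j3) (dd i3) (dd j4) (dd i4)) ≤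
    (C.card : ℝ) ^ 2 * J * 1 + (C.card : ℝ) ^ 2 * (B.card : ℝ) ^ 5 * ind (x1 + x2 + x1 * x2 * y2 = 0)
      + (C.card : ℝ) ^ 3 * (B.card : ℝ) ^ 2 *
        ∑ j1 ∈ B ×ˢ B, ind (x2 * (y2 + dd j1 + x1 * dd j1 * y2) = - (dd j1 * x1)) := by
  have h0 := ind_nonneg
  set c : ℝ := (C.card : ℝ) with hc
  set b : ℝ := (B.card : ℝ) with hb
  have hc0 : 0 ≤ c := Nat.cast_nonneg _
  have hb0 : 0 ≤ b := Nat.cast_nonneg _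
  set δ := x1 + x2 + x1 * x2 * y2 with hδ
  have hJ0 : 0 ≤ J := by
    refine le_trans ?_ (hJ 1 0 0 0 one_ne_zero)
    exact Finset.sum_nonneg fun _ _ => Finset.sum_nonneg fun _ _ => Finset.sum_nonneg fun _ _ => h0 _
  set E : F × F → F × F → F × F → ℝ := fun j1 j3 j4 => ind (δ * dd j1 * dd j3 + (1 + x1 * y2) * dd j1 + (1 + x2 * y2) * dd j3 + dd j4 + y2 = 0) with hE
  have hE1 : (ind (δ ≠ 0) + ind (δ = 0)) * ∑ j1 ∈ B ×ˢ B, ∑ j3 ∈ B ×ˢ B, ∑ j4 ∈ B ×ˢ B, E j1 j3 j4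
      ≤ J + b ^ 5 * ind (δ = 0) := by
    by_cases hd : δ = 0
    · rw [ind_true hd, ind_false (not_not.mpr hd)]
      have : ∑ j1 ∈ B ×ˢ B, ∑ j3 ∈ B ×ˢ B, ∑ j4 ∈ B ×ˢ B, E j1 j3 j4 ≤ b ^ 2 * (b ^ 2 * b) := by
        rw [← card_sq]
        refine sum_le_const _ _ _ (fun j1 _ => sum_le_const _ _ _ (fun j3 _ => ?_))
        refine le_trans (Finset.sum_le_sum (fun j4 _ => ?_)) (sum_dd B (-(δ * dd j1 * dd j3 + (1 + x1 * y2) * dd j1 + (1 + x2 * y2) * dd j3 + y2)))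
        apply ind_mono
        intro h
        linear_combination h
      nlinarith
    · rw [ind_false hd, ind_true hd]
      have := hJ δ (1 + x1 * y2) (1 + x2 * y2) y2 hd
      simp only [hE]
      linarith
  calc _ ≤ ∑ j1 ∈ B ×ˢ B, ∑ j3 ∈ B ×ˢ B, ∑ j4 ∈ B ×ˢ B, (c ^ 2 * ((ind (δ ≠ 0) + ind (δ = 0)) * E j1 j3 j4)
      + c ^ 3 * (ind (x2 * (y2 + dd j1 + x1 * dd j1 * y2) = - (dd j1 * x1)) * ind (dd j3 = - (1 + x1 * y2) * dd j1 - y2)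
        * ind (dd j4 = 0))) :=
        Finset.sum_le_sum fun j1 _ => Finset.sum_le_sum fun j3 _ => Finset.sum_le_sum fun j4 _ =>
          inner_bound B C _ _ _ _ _ _
    _ = c ^ 2 * ((ind (δ ≠ 0) + ind (δ = 0)) * ∑ j1 ∈ B ×ˢ B, ∑ j3 ∈ B ×ˢ B, ∑ j4 ∈ B ×ˢ B, E j1 j3 j4)
      + c ^ 3 * ∑ j1 ∈ B ×ˢ B, ind (x2 * (y2 + dd j1 + x1 * dd j1 * y2) = - (dd j1 * x1)) *
        ((∑ j3 ∈ B ×ˢ B, ind (dd j3 = - (1 + x1 * y2) * dd j1 - y2)) * ∑ j4 ∈ B ×ˢ B, ind (dd j4 = 0)) := by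
        simp only [Finset.sum_add_distrib, Finset.mul_sum, Finset.sum_mul, mul_assoc]
        congr 1
        refine Finset.sum_congr rfl fun j1 _ => ?_
        rw [Finset.sum_comm]
    _ ≤ c ^ 2 * (J + b ^ 5 * ind (δ = 0)) + c ^ 3 * ∑ j1 ∈ B ×ˢ B, ind (x2 * (y2 + dd j1 + x1 * dd j1 * y2) = - (dd j1 * x1)) * (b * b) := by
        gcongr
        · exact ind_nonneg _
        · exact Finset.sum_nonneg fun _ _ => ind_nonneg _
        · exact sum_dd B _
        · exact sum_dd B _
    _ = _ := by
        rw [← Finset.sum_mul]; ring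

lemma T_bound (B C : Finset F) (J : ℝ)
    (hJ : ∀ d b g k : F, d ≠ 0 → ∑ j1 ∈ B ×ˢ B, ∑ j3 ∈ B ×ˢ B, ∑ j4 ∈ B ×ˢ B,
      ind (d * dd j1 * dd j3 + b * dd j1 + g * dd j3 + dd j4 + k = 0) ≤ J) :
    Tq B C ≤ (C.card : ℝ) ^ 6 * (B.card : ℝ) ^ 2 * J + (C.card : ℝ) ^ 5 * (B.card : ℝ) ^ 7
      + (C.card : ℝ) ^ 6 * (B.card : ℝ) ^ 6 + (C.card : ℝ) ^ 7 * (B.card : ℝ) ^ 4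
      + (C.card : ℝ) ^ 6 * (B.card : ℝ) ^ 5 := by
  have h0 := ind_nonneg
  set c : ℝ := (C.card : ℝ) with hc
  set b : ℝ := (B.card : ℝ) with hb
  have hc0 : 0 ≤ c := Nat.cast_nonneg _
  have hb0 : 0 ≤ b := Nat.cast_nonneg _
  have s1 : ∑ i1 ∈ C ×ˢ C, ∑ j2 ∈ B ×ˢ B, ∑ i2 ∈ C ×ˢ C,
      ind (dd i1 + dd i2 + dd i1 * dd i2 * dd j2 = 0) ≤ c ^ 2 * (b ^ 2 * c) := by
    rw [← card_sq, ← card_sq]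
    refine sum_le_const _ _ _ (fun i1 _ => sum_le_const _ _ _ (fun j2 _ => ?_))
    refine le_trans (Finset.sum_le_sum (fun i2 _ => ?_)) (sum_dd C (- dd i1 / (1 + dd i1 * dd j2)))
    apply ind_mono
    intro h
    by_cases hz : 1 + dd i1 * dd j2 = 0
    · exfalso
      have : dd i1 = 0 := by linear_combination h - dd i2 * hz
      rw [this] at hz; simp at hz
    · rw [eq_div_iff hz]; linear_combination h
  have s2 : ∑ i1 ∈ C ×ˢ C, ∑ j2 ∈ B ×ˢ B, ∑ i2 ∈ C ×ˢ C, ∑ j1 ∈ B ×ˢ B,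
      ind (dd i2 * (dd j2 + dd j1 + dd i1 * dd j1 * dd j2) = - (dd j1 * dd i1)) ≤
        c ^ 3 * b ^ 4 + c ^ 4 * b ^ 2 + c ^ 3 * b ^ 3 := by
    have pt : ∀ i1 j2 i2 j1 : F × F, ind (dd i2 * (dd j2 + dd j1 + dd i1 * dd j1 * dd j2) = - (dd j1 * dd i1)) ≤
        ind (dd i2 = - (dd j1 * dd i1) / (dd j2 + dd j1 + dd i1 * dd j1 * dd j2))
        + ind (dd j2 = 0) * ind (dd j1 = 0) + ind (dd i1 = 0) * ind (dd j1 = - dd j2) := by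
      intro i1 j2 i2 j1
      have g1 := h0 (dd i2 = - (dd j1 * dd i1) / (dd j2 + dd j1 + dd i1 * dd j1 * dd j2))
      have g2 := mul_nonneg (h0 (dd j2 = 0)) (h0 (dd j1 = 0))
      have g3 := mul_nonneg (h0 (dd i1 = 0)) (h0 (dd j1 = - dd j2))
      refine ind_le_of (by linarith) ?_
      intro h
      by_cases hz : dd j2 + dd j1 + dd i1 * dd j1 * dd j2 = 0
      · rw [hz, mul_zero] at h
        have h := h.symm
        rw [neg_eq_zero, mul_eq_zero] at h
        rcases h with h | h
        · have h2 : dd j2 = 0 := by rw [h] at hz; simpa using hz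
          rw [ind_true h2, ind_true h]; linarith
        · have h2 : dd j1 = - dd j2 := by rw [h] at hz; linear_combination hz
          rw [ind_true h, ind_true h2]; linarith
      · have := ind_true (show dd i2 = - (dd j1 * dd i1) / (dd j2 + dd j1 + dd i1 * dd j1 * dd j2) by
          rw [eq_div_iff hz]; exact h)
        rw [this]; linarith
    refine le_trans (Finset.sum_le_sum fun i1 _ => Finset.sum_le_sum fun j2 _ => Finset.sum_le_sum fun i2 _ =>
      Finset.sum_le_sum fun j1 _ => pt i1 j2 i2 j1) ?_
    simp only [Finset.sum_add_distrib]
    have u1 : ∑ i1 ∈ C ×ˢ C, ∑ j2 ∈ B ×ˢ B, ∑ i2 ∈ C ×ˢ C, ∑ j1 ∈ B ×ˢ B,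
        ind (dd i2 = - (dd j1 * dd i1) / (dd j2 + dd j1 + dd i1 * dd j1 * dd j2)) ≤ c ^ 2 * (b ^ 2 * (b ^ 2 * c)) := by
      rw [← card_sq, ← card_sq]
      refine sum_le_const _ _ _ (fun i1 _ => sum_le_const _ _ _ (fun j2 _ => ?_))
      rw [Finset.sum_comm]
      exact sum_le_const _ _ _ (fun j1 _ => sum_dd C _)
    have u2 : ∑ i1 ∈ C ×ˢ C, ∑ j2 ∈ B ×ˢ B, ∑ i2 ∈ C ×ˢ C, ∑ j1 ∈ B ×ˢ B,
        ind (dd j2 = 0) * ind (dd j1 = 0) ≤ c ^ 2 * (b * (c ^ 2 * b)) := by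
      rw [← card_sq]
      refine sum_le_const _ _ _ (fun i1 _ => ?_)
      calc _ ≤ ∑ j2 ∈ B ×ˢ B, ind (dd j2 = 0) * (((C ×ˢ C).card : ℝ) * b) := by
            refine Finset.sum_le_sum fun j2 _ => ?_
            simp only [← Finset.mul_sum]
            refine mul_le_mul_of_nonneg_left ?_ (h0 _)
            exact sum_le_const _ _ _ (fun i2 _ => sum_dd B _)
        _ = (∑ j2 ∈ B ×ˢ B, ind (dd j2 = 0)) * (((C ×ˢ C).card : ℝ) * b) := by rw [Finset.sum_mul]
        _ ≤ _ := mul_le_mul_of_nonneg_right (sum_dd B _) (by positivity)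
    have u3 : ∑ i1 ∈ C ×ˢ C, ∑ j2 ∈ B ×ˢ B, ∑ i2 ∈ C ×ˢ C, ∑ j1 ∈ B ×ˢ B,
        ind (dd i1 = 0) * ind (dd j1 = - dd j2) ≤ c * (b ^ 2 * (c ^ 2 * b)) := by
      rw [← card_sq, ← card_sq]
      calc _ ≤ ∑ i1 ∈ C ×ˢ C, ind (dd i1 = 0) * (((B ×ˢ B).card : ℝ) * (((C ×ˢ C).card : ℝ) * b)) := by
            refine Finset.sum_le_sum fun i1 _ => ?_
            simp only [← Finset.mul_sum]
            refine mul_le_mul_of_nonneg_left ?_ (h0 _)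
            exact sum_le_const _ _ _ (fun j2 _ => sum_le_const _ _ _ (fun i2 _ => sum_dd B _))
        _ = (∑ i1 ∈ C ×ˢ C, ind (dd i1 = 0)) * (((B ×ˢ B).card : ℝ) * (((C ×ˢ C).card : ℝ) * b)) := by rw [Finset.sum_mul]
        _ ≤ _ := mul_le_mul_of_nonneg_right (sum_dd C _) (by positivity)
    linarith
  unfold Tq
  calc _ ≤ ∑ i1 ∈ C ×ˢ C, ∑ j2 ∈ B ×ˢ B, ∑ i2 ∈ C ×ˢ C, (c ^ 2 * J * 1 + c ^ 2 * b ^ 5 * ind (dd i1 + dd i2 + dd i1 * dd i2 * dd j2 = 0)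
      + c ^ 3 * b ^ 2 *
        ∑ j1 ∈ B ×ˢ B, ind (dd i2 * (dd j2 + dd j1 + dd i1 * dd j1 * dd j2) = - (dd j1 * dd i1))) :=
        Finset.sum_le_sum fun i1 _ => Finset.sum_le_sum fun j2 _ => Finset.sum_le_sum fun i2 _ =>
          mid_bound B C J _ _ _ hJ
    _ = c ^ 6 * b ^ 2 * J + c ^ 2 * b ^ 5 * (∑ i1 ∈ C ×ˢ C, ∑ j2 ∈ B ×ˢ B, ∑ i2 ∈ C ×ˢ C,
          ind (dd i1 + dd i2 + dd i1 * dd i2 * dd j2 = 0))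
        + c ^ 3 * b ^ 2 * ∑ i1 ∈ C ×ˢ C, ∑ j2 ∈ B ×ˢ B, ∑ i2 ∈ C ×ˢ C, ∑ j1 ∈ B ×ˢ B,
      ind (dd i2 * (dd j2 + dd j1 + dd i1 * dd j1 * dd j2) = - (dd j1 * dd i1)) := by
        simp only [Finset.sum_add_distrib, ← Finset.mul_sum, Finset.sum_const, nsmul_eq_mul, card_sq]
        ring
    _ ≤ c ^ 6 * b ^ 2 * J + c ^ 2 * b ^ 5 * (c ^ 2 * (b ^ 2 * c)) + c ^ 3 * b ^ 2 * (c ^ 3 * b ^ 4 + c ^ 4 * b ^ 2 + c ^ 3 * b ^ 3) := by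
        gcongr
    _ = _ := by ring

lemma sum8 {E : Type*} (S1 S2 S3 S4 S5 S6 S7 S8 : Finset E) (f : E → E → E → E → E → E → E → E → ℝ) :
    ∑ i1 ∈ S1, ∑ i2 ∈ S2, ∑ i3 ∈ S3, ∑ i4 ∈ S4, ∑ i5 ∈ S5, ∑ i6 ∈ S6, ∑ i7 ∈ S7, ∑ i8 ∈ S8, f i1 i2 i3 i4 i5 i6 i7 i8
    = ∑ q ∈ S1 ×ˢ S2 ×ˢ S3 ×ˢ S4 ×ˢ S5 ×ˢ S6 ×ˢ S7 ×ˢ S8,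
      f q.1 q.2.1 q.2.2.1 q.2.2.2.1 q.2.2.2.2.1 q.2.2.2.2.2.1 q.2.2.2.2.2.2.1 q.2.2.2.2.2.2.2 := by
  simp only [Finset.sum_product]

lemma sum8_swap {E : Type*} (S R : Finset E) (f g : E → E → E → E → E → E → E → E → ℝ)
    (hfg : ∀ i1 j2 i2 j1 j3 j4 i3 i4, f i1 j2 i2 j1 j3 j4 i3 i4 = g j4 i3 j3 i4 i2 i1 j2 j1) :
    ∑ i1 ∈ S, ∑ j2 ∈ R, ∑ i2 ∈ S, ∑ j1 ∈ R, ∑ j3 ∈ R, ∑ j4 ∈ R, ∑ i3 ∈ S, ∑ i4 ∈ S, f i1 j2 i2 j1 j3 j4 i3 i4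
    = ∑ i1 ∈ R, ∑ j2 ∈ S, ∑ i2 ∈ R, ∑ j1 ∈ S, ∑ j3 ∈ S, ∑ j4 ∈ S, ∑ i3 ∈ R, ∑ i4 ∈ R, g i1 j2 i2 j1 j3 j4 i3 i4 := by
  rw [sum8, sum8]
  refine Finset.sum_nbij' (fun q => (q.2.2.2.2.2.1, q.2.2.2.2.2.2.1, q.2.2.2.2.1, q.2.2.2.2.2.2.2, q.2.2.1, q.1, q.2.1, q.2.2.2.1))
    (fun q => (q.2.2.2.2.2.1, q.2.2.2.2.2.2.1, q.2.2.2.2.1, q.2.2.2.2.2.2.2, q.2.2.1, q.1, q.2.1, q.2.2.2.1)) ?_ ?_ ?_ ?_ ?_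
  · rintro ⟨i1, j2, i2, j1, j3, j4, i3, i4⟩ h
    simp only [Finset.mem_product] at h ⊢
    tauto
  · rintro ⟨i1, j2, i2, j1, j3, j4, i3, i4⟩ h
    simp only [Finset.mem_product] at h ⊢
    tauto
  · intro _ _; rfl
  · intro _ _; rfl
  · intro q _
    exact hfg _ _ _ _ _ _ _ _

lemma Tq_symm (B C : Finset F) : Tq B C = Tq C B := by
  unfold Tq
  apply sum8_swap
  intros
  exact ind_congr ⟨Wd_rev, Wd_rev⟩
end TBound

section Reg1

lemma holder3 {ι : Type*} (s : Finset ι) (r t : ι → ℝ) (hr : ∀ i ∈ s, 0 ≤ r i) (ht : ∀ i ∈ s, 0 ≤ t i) :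
    (∑ i ∈ s, r i * t i) ^ 3 ≤ (∑ i ∈ s, r i) * (∑ i ∈ s, r i ^ 2) * ∑ i ∈ s, t i ^ 3 := by
  have hc : (3 / 2 : ℝ).HolderConjugate 3 := by
    rw [Real.holderConjugate_iff]; norm_num
  have h1 := Real.inner_le_Lp_mul_Lq_of_nonneg s hc hr ht
  have h2 : ∑ i ∈ s, r i ^ (3 / 2 : ℝ) ≤ Real.sqrt ((∑ i ∈ s, r i) * (∑ i ∈ s, r i ^ 2)) := by
    apply Real.le_sqrt_of_sq_le
    have e : ∀ i ∈ s, r i ^ (3 / 2 : ℝ) = Real.sqrt (r i) * r i := by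
      intro i hi
      rw [Real.sqrt_eq_rpow]
      nth_rewrite 3 [← Real.rpow_one (r i)]
      rw [← Real.rpow_add_of_nonneg (hr i hi) (by norm_num) (by norm_num)]; norm_num
    rw [Finset.sum_congr rfl e]
    have := Finset.sum_mul_sq_le_sq_mul_sq s (fun i => Real.sqrt (r i)) r
    refine this.trans_eq ?_
    congr 1
    exact Finset.sum_congr rfl fun i hi => Real.sq_sqrt (hr i hi)
  have R0 : 0 ≤ ∑ i ∈ s, r i := Finset.sum_nonneg hr
  have R2 : 0 ≤ ∑ i ∈ s, r i ^ 2 := Finset.sum_nonneg fun i _ => sq_nonneg _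
  have T0 : 0 ≤ ∑ i ∈ s, t i ^ 3 := Finset.sum_nonneg fun i hi => pow_nonneg (ht i hi) 3
  have S0 : 0 ≤ ∑ i ∈ s, r i ^ (3 / 2 : ℝ) := Finset.sum_nonneg fun i hi => Real.rpow_nonneg (hr i hi) _
  have I0 : 0 ≤ ∑ i ∈ s, r i * t i := Finset.sum_nonneg fun i hi => mul_nonneg (hr i hi) (ht i hi)
  have e3 : ∑ i ∈ s, t i ^ (3 : ℝ) = ∑ i ∈ s, t i ^ 3 := by
    refine Finset.sum_congr rfl fun i _ => ?_
    exact_mod_cast Real.rpow_natCast (t i) 3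
  rw [e3] at h1
  calc (∑ i ∈ s, r i * t i) ^ 3 ≤ ((∑ i ∈ s, r i ^ (3 / 2 : ℝ)) ^ (1 / (3 / 2) : ℝ) * (∑ i ∈ s, t i ^ 3) ^ (1 / 3 : ℝ)) ^ 3 :=
        pow_le_pow_left₀ I0 h1 3
    _ = (∑ i ∈ s, r i ^ (3 / 2 : ℝ)) ^ 2 * ∑ i ∈ s, t i ^ 3 := by
        rw [mul_pow]
        congr 1
        · rw [← Real.rpow_natCast, ← Real.rpow_mul S0, ← Real.rpow_natCast]; norm_num
        · rw [← Real.rpow_natCast, ← Real.rpow_mul T0]; norm_num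
    _ ≤ (Real.sqrt ((∑ i ∈ s, r i) * (∑ i ∈ s, r i ^ 2))) ^ 2 * ∑ i ∈ s, t i ^ 3 := by
        gcongr
    _ = _ := by rw [Real.sq_sqrt (mul_nonneg R0 R2)]

lemma holder_fib {ι Γ : Type*} [DecidableEq Γ] (W : Finset ι) (G : ι → Γ) (s : Γ → ℝ) (hs : ∀ g, 0 ≤ s g) :
    (∑ w ∈ W, s (G w)) ^ 3 ≤ W.card * (∑ w ∈ W, ∑ w' ∈ W, ind (G w = G w')) * ∑ g ∈ W.image G, s g ^ 3 := by
  have hm : ∀ w ∈ W, G w ∈ W.image G := fun w hw => Finset.mem_image_of_mem _ hw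
  set r : Γ → ℝ := fun g => ((W.filter fun w => G w = g).card : ℝ) with hr
  have key : ∀ t : Γ → ℝ, ∑ w ∈ W, t (G w) = ∑ g ∈ W.image G, r g * t g := by
    intro t
    rw [← Finset.sum_fiberwise_of_maps_to hm]
    refine Finset.sum_congr rfl fun g _ => ?_
    rw [Finset.sum_congr rfl (g := fun _ => t g) (fun w hw => by rw [(Finset.mem_filter.mp hw).2])]
    rw [Finset.sum_const, nsmul_eq_mul]
  have h := holder3 (W.image G) r s (fun _ _ => Nat.cast_nonneg _) (fun g _ => hs g)
  rw [key]
  refine h.trans_eq ?_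
  have k1 := key (fun _ => 1)
  simp only [Finset.sum_const, nsmul_eq_mul, mul_one] at k1
  have k2 : ∑ w ∈ W, ∑ w' ∈ W, ind (G w = G w') = ∑ g ∈ W.image G, r g ^ 2 := by
    have := key r
    simp only [sq]
    rw [← this]
    refine Finset.sum_congr rfl fun w _ => ?_
    rw [sum_ind]
    simp only [hr, eq_comm]
  rw [k1, k2]

variable {F : Type*} [Field F] [DecidableEq F]

def passes (M : Matrix (Fin 2) (Fin 2) F) (q : F × F) : Prop :=
  M 0 0 * q.1 + M 0 1 = q.2 * (M 1 0 * q.1 + M 1 1)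

lemma quad3 (a b c u1 u2 u3 : F) (h12 : u1 ≠ u2) (h13 : u1 ≠ u3) (h23 : u2 ≠ u3)
    (e1 : a * u1 ^ 2 + b * u1 + c = 0) (e2 : a * u2 ^ 2 + b * u2 + c = 0) (e3 : a * u3 ^ 2 + b * u3 + c = 0) :
    a = 0 ∧ b = 0 ∧ c = 0 := by
  have f1 : a * (u1 + u2) + b = 0 := by
    apply mul_left_cancel₀ (sub_ne_zero.mpr h12); linear_combination e1 - e2
  have f2 : a * (u1 + u3) + b = 0 := by
    apply mul_left_cancel₀ (sub_ne_zero.mpr h13); linear_combination e1 - e3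
  have ha : a = 0 := by
    apply mul_left_cancel₀ (sub_ne_zero.mpr h23); linear_combination f1 - f2
  have hb : b = 0 := by rw [ha] at f1; simpa using f1
  refine ⟨ha, hb, ?_⟩
  rw [ha, hb] at e1; simpa using e1

lemma passes_inj {M : Matrix (Fin 2) (Fin 2) F} (hM : M 0 0 * M 1 1 - M 0 1 * M 1 0 = 1) {q q' : F × F}
    (h : passes M q) (h' : passes M q') (hq : q ≠ q') : q.1 ≠ q'.1 := by
  intro e
  apply hq
  refine Prod.ext e ?_
  unfold passes at h h'
  rw [← e] at h'
  by_cases hz : M 1 0 * q.1 + M 1 1 = 0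
  · exfalso
    rw [hz, mul_zero] at h
    have : (1 : F) = 0 := by linear_combination -hM + M 0 0 * hz - M 1 0 * h
    exact one_ne_zero this
  · apply mul_right_cancel₀ hz
    rw [← h, ← h']

lemma passes_unique {M N : Matrix (Fin 2) (Fin 2) F} (hM : M 0 0 * M 1 1 - M 0 1 * M 1 0 = 1)
    (hN : N 0 0 * N 1 1 - N 0 1 * N 1 0 = 1) (q1 q2 q3 : F × F) (h12 : q1 ≠ q2) (h13 : q1 ≠ q3) (h23 : q2 ≠ q3)
    (m1 : passes M q1) (m2 : passes M q2) (m3 : passes M q3)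
    (n1 : passes N q1) (n2 : passes N q2) (n3 : passes N q3) : N = M ∨ N = -M := by
  have g12 := passes_inj hM m1 m2 h12
  have g13 := passes_inj hM m1 m3 h13
  have g23 := passes_inj hM m2 m3 h23
  unfold passes at *
  generalize hα : M 0 0 = α at *
  generalize hβ : M 0 1 = β at *
  generalize hγ : M 1 0 = γ at *
  generalize hδ : M 1 1 = δ at *
  generalize hα' : N 0 0 = α' at *
  generalize hβ' : N 0 1 = β' at *
  generalize hγ' : N 1 0 = γ' at *
  generalize hδ' : N 1 1 = δ' at *
  obtain ⟨a1, a2, a3⟩ := quad3 (α * γ' - α' * γ) (α * δ' + β * γ' - α' * δ - β' * γ) (β * δ' - β' * δ)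
    q1.1 q2.1 q3.1 g12 g13 g23
    (by linear_combination (γ' * q1.1 + δ') * m1 - (γ * q1.1 + δ) * n1)
    (by linear_combination (γ' * q2.1 + δ') * m2 - (γ * q2.1 + δ) * n2)
    (by linear_combination (γ' * q3.1 + δ') * m3 - (γ * q3.1 + δ) * n3)
  set k := α * δ' - β' * γ with hk
  have k1 : α' = k * α := by rw [hk]; linear_combination -α' * hM - α * a2 + β * a1
  have k2 : β' = k * β := by rw [hk]; linear_combination -β' * hM - α * a3
  have k3 : γ' = k * γ := by rw [hk]; linear_combination -γ' * hM - γ * a2 + δ * a1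
  have k4 : δ' = k * δ := by rw [hk]; linear_combination -δ' * hM - γ * a3
  have kk : k = 1 ∨ k = -1 := by
    apply mul_self_eq_one_iff.mp
    clear_value k
    rw [k1, k2, k3, k4] at hN
    linear_combination hN - k ^ 2 * hM
  rcases kk with h | h
  · left
    ext i j
    fin_cases i <;> fin_cases j
    · show N 0 0 = M 0 0
      rw [hα, hα', k1, h, one_mul]
    · show N 0 1 = M 0 1
      rw [hβ, hβ', k2, h, one_mul]
    · show N 1 0 = M 1 0
      rw [hγ, hγ', k3, h, one_mul]
    · show N 1 1 = M 1 1
      rw [hδ, hδ', k4, h, one_mul]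
  · right
    ext i j
    fin_cases i <;> fin_cases j
    · show N 0 0 = - M 0 0
      rw [hα, hα', k1, h, neg_one_mul]
    · show N 0 1 = - M 0 1
      rw [hβ, hβ', k2, h, neg_one_mul]
    · show N 1 0 = - M 1 0
      rw [hγ, hγ', k3, h, neg_one_mul]
    · show N 1 1 = - M 1 1
      rw [hδ, hδ', k4, h, neg_one_mul]

/-- number of pairs -/
noncomputable def sA (A : Finset F) (M : Matrix (Fin 2) (Fin 2) F) : ℝ := ∑ q ∈ A ×ˢ A, ind (passes M q)

/-- distinct triple -/
def dist3 (q1 q2 q3 : F × F) : Prop := q1 ≠ q2 ∧ q1 ≠ q3 ∧ q2 ≠ q3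

lemma sA_nonneg (A : Finset F) (M : Matrix (Fin 2) (Fin 2) F) : 0 ≤ sA A M :=
  Finset.sum_nonneg fun _ _ => ind_nonneg _

lemma sA_triple (A : Finset F) (M : Matrix (Fin 2) (Fin 2) F) :
    sA A M ^ 3 - 3 * sA A M ^ 2 ≤ ∑ q1 ∈ A ×ˢ A, ∑ q2 ∈ A ×ˢ A, ∑ q3 ∈ A ×ˢ A,
      ind (dist3 q1 q2 q3 ∧ passes M q1 ∧ passes M q2 ∧ passes M q3) := by
  have h0 := ind_nonneg
  set P : F × F → ℝ := fun q => ind (passes M q) with hP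
  have pt : ∀ q1 q2 q3 : F × F, P q1 * P q2 * P q3 ≤ ind (dist3 q1 q2 q3 ∧ passes M q1 ∧ passes M q2 ∧ passes M q3)
      + P q1 * P q3 * ind (q1 = q2) + P q1 * P q2 * ind (q1 = q3) + P q1 * P q2 * ind (q2 = q3) := by
    intro q1 q2 q3
    simp only [hP]
    by_cases c1 : passes M q1
    swap
    · rw [ind_false c1]; simp only [zero_mul, add_zero]; exact h0 _
    by_cases c2 : passes M q2
    swap
    · rw [ind_false c2]; simp only [zero_mul, mul_zero, add_zero]
      have := mul_nonneg (mul_nonneg (h0 (passes M q1)) (h0 (passes M q3))) (h0 (q1 = q2))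
      have := h0 (dist3 q1 q2 q3 ∧ passes M q1 ∧ passes M q2 ∧ passes M q3)
      linarith
    by_cases c3 : passes M q3
    swap
    · rw [ind_false c3]; simp only [zero_mul, mul_zero, add_zero]
      have := mul_nonneg (mul_nonneg (h0 (passes M q1)) (h0 (passes M q2))) (h0 (q1 = q3))
      have := mul_nonneg (mul_nonneg (h0 (passes M q1)) (h0 (passes M q2))) (h0 (q2 = q3))
      have := h0 (dist3 q1 q2 q3 ∧ passes M q1 ∧ passes M q2 ∧ passes M q3)
      linarith
    rw [ind_true c1, ind_true c2, ind_true c3]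
    have w1 := h0 (q1 = q2)
    have w2 := h0 (q1 = q3)
    have w3 := h0 (q2 = q3)
    have w4 := h0 (dist3 q1 q2 q3 ∧ passes M q1 ∧ passes M q2 ∧ passes M q3)
    by_cases d1 : q1 = q2
    · rw [ind_true d1]; linarith
    by_cases d2 : q1 = q3
    · rw [ind_true d2]; linarith
    by_cases d3 : q2 = q3
    · rw [ind_true d3]; linarith
    rw [ind_true (show dist3 q1 q2 q3 ∧ passes M q1 ∧ passes M q2 ∧ passes M q3 from ⟨⟨d1, d2, d3⟩, c1, c2, c3⟩)]
    linarith
  have hs1 : sA A M = ∑ q ∈ A ×ˢ A, P q := rfl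
  have one : ∀ q1 ∈ A ×ˢ A, ∑ q ∈ A ×ˢ A, ind (q1 = q) = 1 := by
    intro q1 h1
    rw [sum_ind, Finset.filter_eq]; simp [h1]
  have S := Finset.sum_le_sum (s := A ×ˢ A) fun q1 _ => Finset.sum_le_sum (s := A ×ˢ A) fun q2 _ =>
    Finset.sum_le_sum (s := A ×ˢ A) fun q3 _ => pt q1 q2 q3
  simp only [Finset.sum_add_distrib, ← Finset.mul_sum, ← Finset.sum_mul, ← hs1] at S
  have t1 : ∑ q1 ∈ A ×ˢ A, ∑ q2 ∈ A ×ˢ A, P q1 * sA A M * ind (q1 = q2) = sA A M ^ 2 := by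
    rw [sq]; nth_rewrite 2 [hs1]; rw [Finset.sum_mul]
    refine Finset.sum_congr rfl fun q1 h1 => ?_
    rw [← Finset.mul_sum, one q1 h1, mul_one]
  have t3 : ∑ q1 ∈ A ×ˢ A, ∑ q2 ∈ A ×ˢ A, P q1 * P q2 * ∑ q3 ∈ A ×ˢ A, ind (q2 = q3) = sA A M ^ 2 := by
    rw [sq, hs1, Finset.sum_mul_sum]
    refine Finset.sum_congr rfl fun q1 h1 => Finset.sum_congr rfl fun q2 h2 => ?_
    rw [one q2 h2, mul_one]
  have t4 : sA A M ^ 3 = sA A M * sA A M * sA A M := by ring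
  simp only [← Finset.mul_sum] at t1
  linarith

lemma sA_cube (A : Finset F) (𝒢 : Finset (Matrix (Fin 2) (Fin 2) F))
    (hdet : ∀ M ∈ 𝒢, M 0 0 * M 1 1 - M 0 1 * M 1 0 = 1) :
    ∑ M ∈ 𝒢, (if 6 ≤ sA A M then sA A M else 0) ^ 3 ≤ 4 * (A.card : ℝ) ^ 6 := by
  have h0 := ind_nonneg
  calc _ ≤ ∑ M ∈ 𝒢, 2 * ∑ q1 ∈ A ×ˢ A, ∑ q2 ∈ A ×ˢ A, ∑ q3 ∈ A ×ˢ A,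
      ind (dist3 q1 q2 q3 ∧ passes M q1 ∧ passes M q2 ∧ passes M q3) := by
        refine Finset.sum_le_sum fun M _ => ?_
        have h := sA_triple A M
        have hs := sA_nonneg A M
        split_ifs with h6
        · nlinarith [mul_nonneg (sq_nonneg (sA A M)) (sub_nonneg.mpr h6)]
        · have : 0 ≤ ∑ q1 ∈ A ×ˢ A, ∑ q2 ∈ A ×ˢ A, ∑ q3 ∈ A ×ˢ A,
            ind (dist3 q1 q2 q3 ∧ passes M q1 ∧ passes M q2 ∧ passes M q3) :=
            Finset.sum_nonneg fun _ _ => Finset.sum_nonneg fun _ _ => Finset.sum_nonneg fun _ _ => h0 _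
          simpa using this
    _ = 2 * ∑ q1 ∈ A ×ˢ A, ∑ q2 ∈ A ×ˢ A, ∑ q3 ∈ A ×ˢ A, ∑ M ∈ 𝒢,
      ind (dist3 q1 q2 q3 ∧ passes M q1 ∧ passes M q2 ∧ passes M q3) := by
        rw [← Finset.mul_sum, Finset.sum_comm]
        congr 1
        refine Finset.sum_congr rfl fun q1 _ => ?_
        rw [Finset.sum_comm]
        refine Finset.sum_congr rfl fun q2 _ => ?_
        rw [Finset.sum_comm]
    _ ≤ 2 * (((A.card : ℝ) ^ 2) * (((A.card : ℝ) ^ 2) * (((A.card : ℝ) ^ 2) * 2))) := by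
        refine mul_le_mul_of_nonneg_left ?_ (by norm_num)
        rw [← card_sq]
        refine sum_le_const _ _ _ fun q1 _ => sum_le_const _ _ _ fun q2 _ => sum_le_const _ _ _ fun q3 _ => ?_
        classical
        rw [sum_ind]
        rcases Finset.eq_empty_or_nonempty (𝒢.filter fun M => dist3 q1 q2 q3 ∧ passes M q1 ∧ passes M q2 ∧ passes M q3) with he | ⟨M, hM⟩
        · rw [he]; norm_num
        · obtain ⟨hM1, ⟨d1, d2, d3⟩, m1, m2, m3⟩ := Finset.mem_filter.mp hM
          have : (𝒢.filter fun M => dist3 q1 q2 q3 ∧ passes M q1 ∧ passes M q2 ∧ passes M q3) ⊆ {M, -M} := by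
            intro N hN
            obtain ⟨hN1, -, n1, n2, n3⟩ := Finset.mem_filter.mp hN
            rcases passes_unique (hdet M hM1) (hdet N hN1) q1 q2 q3 d1 d2 d3 m1 m2 m3 n1 n2 n3 with h | h
            · simp [h]
            · simp [h]
          have := (Finset.card_le_card this).trans Finset.card_le_two
          exact_mod_cast this
    _ = _ := by ring
end Reg1

section Reg1b
variable {F : Type*} [Field F] [DecidableEq F]

abbrev Word (F : Type*) := F × (F × F) × (F × F) × (F × F) × F

def Gw (w : Word F) : Matrix (Fin 2) (Fin 2) F :=
  Um (-w.2.2.2.2) * Vm (dd w.2.2.2.1) * Um (dd w.2.2.1) * Vm (-dd w.2.1) * Um w.1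

def Ws (B C : Finset F) : Finset (Word F) := B ×ˢ (C ×ˢ C) ×ˢ (B ×ˢ B) ×ˢ (C ×ˢ C) ×ˢ B

lemma Ws_card (B C : Finset F) : ((Ws B C).card : ℝ) = ((B.card : ℝ) * C.card) ^ 4 := by
  unfold Ws; simp only [Finset.card_product]; push_cast; ring

lemma Gw_det (w : Word F) : Gw w 0 0 * Gw w 1 1 - Gw w 0 1 * Gw w 1 0 = 1 := by
  have h : (Gw w).det = 1 := by
    unfold Gw
    simp only [Matrix.det_mul]
    have u : ∀ y : F, (Um y).det = 1 := fun y => by simp [Um, Matrix.det_fin_two]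
    have v : ∀ y : F, (Vm y).det = 1 := fun y => by simp [Vm, Matrix.det_fin_two]
    simp [u, v]
  rwa [Matrix.det_fin_two] at h

lemma Gw_passes (b1 b2 a1 a2 u p q x y x' : F) (i j i' : F × F) (hi : dd i = x) (hj : dd j = y) (hi' : dd i' = x')
    (hu : u = a1 + b1) (hq : q = 1 - x * u) (hp : p = u + y * q)
    (h : p = (a2 + b2) * (q + x' * p)) : passes (Gw (b1, i, j, i', b2)) (a1, a2) := by
  unfold passes Gw
  simp only [hi, hj, hi']
  simp [Um, Vm, Matrix.mul_apply, Fin.sum_univ_two]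
  subst hp hq hu
  linear_combination h

lemma word_pairs (B C : Finset F) :
    ∑ w ∈ Ws B C, ∑ w' ∈ Ws B C, ind (Gw w = Gw w') ≤ Tq B C := by
  classical
  unfold Tq
  rw [sum8 (C ×ˢ C) (B ×ˢ B) (C ×ˢ C) (B ×ˢ B) (B ×ˢ B) (B ×ˢ B) (C ×ˢ C) (C ×ˢ C)
    (fun i1 j2 i2 j1 j3 j4 i3 i4 => ind (Wd (dd j1) (dd i1) (dd j2) (dd i2) (dd j3) (dd i3) (dd j4) (dd i4))),
    ← Finset.sum_product' (Ws B C) (Ws B C) (fun w w' => ind (Gw w = Gw w')), sum_ind, sum_ind]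
  norm_cast
  refine Finset.card_le_card_of_injOn (fun q => (q.1.2.2.2.1, q.1.2.2.1, q.1.2.1.swap, (q.2.2.2.2.2, q.1.2.2.2.2),
    (q.1.1, q.2.1), q.2.2.2.1.swap, q.2.2.1, q.2.2.2.2.1.swap)) ?_ ?_
  · rintro ⟨⟨b1, i, j, i', b2⟩, ⟨c1, k, l, k', c2⟩⟩ h
    have h := Finset.mem_filter.mp h
    obtain ⟨h1, h2⟩ := h
    refine Finset.mem_coe.mpr (Finset.mem_filter.mpr ⟨?_, ?_⟩)
    · simp only [Ws, Finset.mem_product, Prod.fst_swap, Prod.snd_swap] at h1 ⊢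
      tauto
    · simp only [Gw] at h2
      have sw : ∀ i : F × F, dd i.swap = - dd i := fun i => by simp [dd]
      simp only [sw]
      unfold Wd
      have e1 : Um (dd (c2, b2)) = Um c2 * Um (-b2) := by rw [Um_mul]; simp [dd, sub_eq_add_neg]
      have e2 : Um (dd (b1, c1)) = Um b1 * Um (-c1) := by rw [Um_mul]; simp [dd, sub_eq_add_neg]
      rw [e1, e2]
      calc _ = Um c2 * (Um (-b2) * Vm (dd i') * Um (dd j) * Vm (-dd i) * Um b1) * Um (-c1) * Vm (dd k) * Um (- dd l) * Vm (- dd k') := by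
            simp only [mul_assoc]
        _ = Um c2 * (Um (-c2) * Vm (dd k') * Um (dd l) * Vm (-dd k) * Um c1) * Um (-c1) * Vm (dd k) * Um (- dd l) * Vm (- dd k') := by rw [h2]
        _ = (Um c2 * Um (-c2)) * (Vm (dd k') * (Um (dd l) * (Vm (-dd k) * (Um c1 * Um (-c1)) * Vm (dd k)) * Um (- dd l)) * Vm (- dd k')) := by
            simp only [mul_assoc]
        _ = 1 := by
            simp only [Um_mul, Vm_mul, add_neg_cancel, neg_add_cancel, Um_zero, Vm_zero, mul_one]
  · rintro ⟨⟨b1, i, j, i', b2⟩, ⟨c1, k, l, k', c2⟩⟩ - ⟨⟨b1', ⟨i1, i2⟩, j', i'', b2'⟩, ⟨c1', ⟨k1, k2⟩, ⟨l1, l2⟩, ⟨k3, k4⟩, c2'⟩⟩ - h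
    obtain ⟨i3, i4⟩ := i
    obtain ⟨l3, l4⟩ := l
    obtain ⟨k5, k6⟩ := k'
    simp only [Prod.mk.injEq, Prod.swap_prod_mk] at h ⊢
    tauto

lemma sum_sA (A B C : Finset F) :
    ∑ w ∈ Ws B C, sA A (Gw w) ≤ 6 * ((B.card : ℝ) * C.card) ^ 4
      + (4 * (A.card : ℝ) ^ 6 * ((B.card : ℝ) * C.card) ^ 4 * Tq B C) ^ ((1 : ℝ) / 3) := by
  classical
  set s : Matrix (Fin 2) (Fin 2) F → ℝ := fun M => if 6 ≤ sA A M then sA A M else 0 with hs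
  have hs0 : ∀ M, 0 ≤ s M := by
    intro M; simp only [hs]; split_ifs
    · exact sA_nonneg A M
    · exact le_rfl
  have h1 : ∀ w ∈ Ws B C, sA A (Gw w) ≤ 6 + s (Gw w) := by
    intro w _
    simp only [hs]; split_ifs with h
    · linarith
    · linarith [not_le.mp h]
  have h2 := holder_fib (Ws B C) Gw s hs0
  have h3 := sA_cube A ((Ws B C).image Gw) (by
    intro M hM
    obtain ⟨w, _, rfl⟩ := Finset.mem_image.mp hM
    exact Gw_det w)
  have hT0 : 0 ≤ Tq B C := le_trans (Finset.sum_nonneg fun _ _ => Finset.sum_nonneg fun _ _ => ind_nonneg _) (word_pairs B C)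
  have h4 : (∑ w ∈ Ws B C, s (Gw w)) ^ 3 ≤ 4 * (A.card : ℝ) ^ 6 * ((B.card : ℝ) * C.card) ^ 4 * Tq B C := by
    refine h2.trans ?_
    rw [Ws_card]
    calc _ ≤ ((B.card : ℝ) * C.card) ^ 4 * Tq B C * (4 * (A.card : ℝ) ^ 6) := by
          refine mul_le_mul (mul_le_mul_of_nonneg_left (word_pairs B C) (by positivity)) h3 ?_ (by positivity)
          exact Finset.sum_nonneg fun _ _ => pow_nonneg (hs0 _) 3
      _ = _ := by ring
  have hS0 : 0 ≤ ∑ w ∈ Ws B C, s (Gw w) := Finset.sum_nonneg fun _ _ => hs0 _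
  have h5 : ∑ w ∈ Ws B C, s (Gw w) ≤ (4 * (A.card : ℝ) ^ 6 * ((B.card : ℝ) * C.card) ^ 4 * Tq B C) ^ ((1 : ℝ) / 3) := by
    calc _ = ((∑ w ∈ Ws B C, s (Gw w)) ^ 3) ^ ((1 : ℝ) / 3) := by
          rw [← Real.rpow_natCast, ← Real.rpow_mul hS0]; norm_num
      _ ≤ _ := Real.rpow_le_rpow (by positivity) h4 (by norm_num)
  calc _ ≤ ∑ w ∈ Ws B C, (6 + s (Gw w)) := Finset.sum_le_sum h1
    _ = 6 * ((B.card : ℝ) * C.card) ^ 4 + ∑ w ∈ Ws B C, s (Gw w) := by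
        rw [Finset.sum_add_distrib, Finset.sum_const, nsmul_eq_mul, Ws_card]; ring
    _ ≤ _ := by linarith

/-- the incidence count -/
noncomputable def Ic (A B C D : Finset F) : ℝ :=
  ∑ y ∈ D, ∑ t ∈ A ×ˢ B ×ˢ C, ind ((t.1 + t.2.1) * (t.2.2 + y) = 1)

/-- relation between two points -/
def rel (u v x : F) : Prop := u ≠ 0 ∧ v ≠ 0 ∧ v * (1 - x * u) = u

noncomputable def E6 (A B C : Finset F) : ℝ :=
  ∑ a' ∈ A, ∑ τ ∈ A ×ˢ B ×ˢ (C ×ˢ C) ×ˢ B, ind (rel (τ.1 + τ.2.1) (a' + τ.2.2.2) (dd τ.2.2.1))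

lemma Ic_sq (A B C D : Finset F) : Ic A B C D ^ 2 ≤ D.card * E6 A B C := by
  classical
  unfold Ic
  refine (sq_sum_le_card_mul_sum_sq (s := D)).trans (mul_le_mul_of_nonneg_left ?_ (Nat.cast_nonneg _))
  calc ∑ y ∈ D, (∑ t ∈ A ×ˢ B ×ˢ C, ind ((t.1 + t.2.1) * (t.2.2 + y) = 1)) ^ 2
      = ∑ y ∈ D, ∑ t ∈ A ×ˢ B ×ˢ C, ∑ t' ∈ A ×ˢ B ×ˢ C,
        ind ((t.1 + t.2.1) * (t.2.2 + y) = 1) * ind ((t'.1 + t'.2.1) * (t'.2.2 + y) = 1) := by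
        refine Finset.sum_congr rfl fun y _ => ?_
        rw [sq, Finset.sum_mul_sum]
    _ = ∑ t ∈ A ×ˢ B ×ˢ C, ∑ t' ∈ A ×ˢ B ×ˢ C, ∑ y ∈ D,
        ind ((t.1 + t.2.1) * (t.2.2 + y) = 1) * ind ((t'.1 + t'.2.1) * (t'.2.2 + y) = 1) := by
        rw [Finset.sum_comm]
        refine Finset.sum_congr rfl fun t _ => ?_
        rw [Finset.sum_comm]
    _ ≤ ∑ t ∈ A ×ˢ B ×ˢ C, ∑ t' ∈ A ×ˢ B ×ˢ C, ind (rel (t.1 + t.2.1) (t'.1 + t'.2.1) (t.2.2 - t'.2.2)) := by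
        refine Finset.sum_le_sum fun t _ => Finset.sum_le_sum fun t' _ => ?_
        by_cases hr : rel (t.1 + t.2.1) (t'.1 + t'.2.1) (t.2.2 - t'.2.2)
        · rw [ind_true hr]
          have : ∑ y ∈ D, ind (y = 1 / (t.1 + t.2.1) - t.2.2) ≤ 1 := by
            rw [sum_ind, Finset.filter_eq']; split_ifs <;> simp
          refine le_trans (Finset.sum_le_sum fun y _ => ?_) this
          refine le_trans (mul_le_of_le_one_right (ind_nonneg _) (ind_le_one _)) (ind_mono ?_)
          intro h
          have h1 := hr.1
          field_simp
          linear_combination h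
        · rw [ind_false hr]
          refine (Finset.sum_eq_zero fun y _ => ?_).le
          by_contra hne
          apply hr
          have c1 : (t.1 + t.2.1) * (t.2.2 + y) = 1 := by
            by_contra h; apply hne; rw [ind_false h, zero_mul]
          have c2 : (t'.1 + t'.2.1) * (t'.2.2 + y) = 1 := by
            by_contra h; apply hne; rw [ind_false h, mul_zero]
          refine ⟨left_ne_zero_of_mul_eq_one c1, left_ne_zero_of_mul_eq_one c2, ?_⟩
          linear_combination (t.1 + t.2.1) * c2 - (t'.1 + t'.2.1) * c1
    _ = E6 A B C := by
        unfold E6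
        rw [← Finset.sum_product' (A ×ˢ B ×ˢ C) (A ×ˢ B ×ˢ C) (fun t t' => ind (rel (t.1 + t.2.1) (t'.1 + t'.2.1) (t.2.2 - t'.2.2))),
          ← Finset.sum_product' A (A ×ˢ B ×ˢ (C ×ˢ C) ×ˢ B) (fun a' τ => ind (rel (τ.1 + τ.2.1) (a' + τ.2.2.2) (dd τ.2.2.1)))]
        refine Finset.sum_nbij' (fun q => (q.2.1, q.1.1, q.1.2.1, (q.1.2.2, q.2.2.2), q.2.2.1))
          (fun q => ((q.2.1, q.2.2.1, q.2.2.2.1.1), (q.1, q.2.2.2.2, q.2.2.2.1.2))) ?_ ?_ ?_ ?_ ?_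
        · rintro ⟨⟨a, b, c⟩, ⟨a', b', c'⟩⟩ h
          simp only [Finset.mem_product] at h ⊢
          tauto
        · rintro ⟨a', a, b, ⟨c, c'⟩, b'⟩ h
          simp only [Finset.mem_product] at h ⊢
          tauto
        · intro _ _; rfl
        · intro _ _; rfl
        · intro _ _; rfl

lemma E6_sq (A B C : Finset F) : E6 A B C ^ 2 ≤ A.card * ∑ w ∈ Ws B C, sA A (Gw w) := by
  classical
  unfold E6
  refine (sq_sum_le_card_mul_sum_sq (s := A)).trans (mul_le_mul_of_nonneg_left ?_ (Nat.cast_nonneg _))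
  set Θ := A ×ˢ B ×ˢ (C ×ˢ C) ×ˢ B with hΘ
  calc ∑ a' ∈ A, (∑ τ ∈ Θ, ind (rel (τ.1 + τ.2.1) (a' + τ.2.2.2) (dd τ.2.2.1))) ^ 2
      = ∑ a' ∈ A, ∑ τ ∈ Θ, ∑ τ' ∈ Θ,
        ind (rel (τ.1 + τ.2.1) (a' + τ.2.2.2) (dd τ.2.2.1)) * ind (rel (τ'.1 + τ'.2.1) (a' + τ'.2.2.2) (dd τ'.2.2.1)) := by
        refine Finset.sum_congr rfl fun y _ => ?_
        rw [sq, Finset.sum_mul_sum]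
    _ = ∑ τ ∈ Θ, ∑ τ' ∈ Θ, ∑ a' ∈ A,
        ind (rel (τ.1 + τ.2.1) (a' + τ.2.2.2) (dd τ.2.2.1)) * ind (rel (τ'.1 + τ'.2.1) (a' + τ'.2.2.2) (dd τ'.2.2.1)) := by
        rw [Finset.sum_comm]
        refine Finset.sum_congr rfl fun t _ => ?_
        rw [Finset.sum_comm]
    _ ≤ ∑ τ ∈ Θ, ∑ τ' ∈ Θ, ind (passes (Gw (τ.2.1, τ.2.2.1, (τ'.2.2.2, τ.2.2.2), τ'.2.2.1, τ'.2.1)) (τ.1, τ'.1)) := by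
        refine Finset.sum_le_sum fun t _ => Finset.sum_le_sum fun t' _ => ?_
        obtain ⟨a1, b1, i, b'⟩ := t
        obtain ⟨a2, b2, i', b''⟩ := t'
        simp only
        by_cases hr : passes (Gw (b1, i, (b'', b'), i', b2)) (a1, a2)
        · rw [ind_true hr]
          have : ∑ y ∈ A, ind (y = (a1 + b1) / (1 - dd i * (a1 + b1)) - b') ≤ 1 := by
            rw [sum_ind, Finset.filter_eq']; split_ifs <;> simp
          refine le_trans (Finset.sum_le_sum fun y _ => ?_) this
          refine le_trans (mul_le_of_le_one_right (ind_nonneg _) (ind_le_one _)) (ind_mono ?_)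
          rintro ⟨h1, h2, h3⟩
          have hne : 1 - dd i * (a1 + b1) ≠ 0 := by
            intro h; rw [h, mul_zero] at h3; exact h1 h3.symm
          rw [eq_sub_iff_add_eq, eq_div_iff hne]
          exact h3
        · rw [ind_false hr]
          refine (Finset.sum_eq_zero fun y _ => ?_).le
          by_contra hne
          apply hr
          have c1 : rel (a1 + b1) (y + b') (dd i) := by
            by_contra h; apply hne; rw [ind_false h, zero_mul]
          have c2 : rel (a2 + b2) (y + b'') (dd i') := by
            by_contra h; apply hne; rw [ind_false h, mul_zero]
          obtain ⟨_, _, h1⟩ := c1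
          obtain ⟨_, _, h2⟩ := c2
          refine Gw_passes b1 b2 a1 a2 _ _ _ _ _ _ i (b'', b') i' rfl rfl rfl rfl rfl rfl ?_
          have e : dd (b'', b') = b'' - b' := rfl
          rw [e]
          generalize dd i = x at *
          generalize dd i' = x' at *
          -- u + y q = q v2
          have e1 : (a1 + b1) + (b'' - b') * (1 - x * (a1 + b1)) = (1 - x * (a1 + b1)) * (y + b'') := by
            linear_combination -h1
          rw [e1]
          linear_combination (1 - x * (a1 + b1)) * h2
    _ = ∑ w ∈ Ws B C, sA A (Gw w) := by
        unfold sA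
        rw [← Finset.sum_product' Θ Θ (fun τ τ' => ind (passes (Gw (τ.2.1, τ.2.2.1, (τ'.2.2.2, τ.2.2.2), τ'.2.2.1, τ'.2.1)) (τ.1, τ'.1))),
          ← Finset.sum_product' (Ws B C) (A ×ˢ A) (fun w q => ind (passes (Gw w) q))]
        refine Finset.sum_nbij' (fun q => ((q.1.2.1, q.1.2.2.1, (q.2.2.2.2, q.1.2.2.2), q.2.2.2.1, q.2.2.1), (q.1.1, q.2.1)))
          (fun q => ((q.2.1, q.1.1, q.1.2.1, q.1.2.2.1.2), (q.2.2, q.1.2.2.2.2, q.1.2.2.2.1, q.1.2.2.1.1))) ?_ ?_ ?_ ?_ ?_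
        · rintro ⟨⟨a, b, i, b'⟩, ⟨a', b1, i', b1'⟩⟩ h
          simp only [hΘ, Ws, Finset.mem_product] at h ⊢
          tauto
        · rintro ⟨⟨b1, i, ⟨j1, j2⟩, i', b2⟩, ⟨a, a'⟩⟩ h
          simp only [hΘ, Ws, Finset.mem_product] at h ⊢
          tauto
        · intro _ _; rfl
        · intro _ _; rfl
        · intro _ _; rfl

lemma Ic_four (A B C D : Finset F) : Ic A B C D ^ 4 ≤ (D.card : ℝ) ^ 2 * A.card *
    (6 * ((B.card : ℝ) * C.card) ^ 4
      + (4 * (A.card : ℝ) ^ 6 * ((B.card : ℝ) * C.card) ^ 4 * Tq B C) ^ ((1 : ℝ) / 3)) := by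
  have h1 := Ic_sq A B C D
  have h2 := E6_sq A B C
  have h3 := sum_sA A B C
  calc Ic A B C D ^ 4 = (Ic A B C D ^ 2) ^ 2 := by ring
    _ ≤ (D.card * E6 A B C) ^ 2 := pow_le_pow_left₀ (sq_nonneg _) h1 2
    _ = (D.card : ℝ) ^ 2 * E6 A B C ^ 2 := by ring
    _ ≤ (D.card : ℝ) ^ 2 * (A.card * ∑ w ∈ Ws B C, sA A (Gw w)) := by gcongr
    _ ≤ (D.card : ℝ) ^ 2 * (A.card * (6 * ((B.card : ℝ) * C.card) ^ 4
      + (4 * (A.card : ℝ) ^ 6 * ((B.card : ℝ) * C.card) ^ 4 * Tq B C) ^ ((1 : ℝ) / 3))) := by gcongr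
    _ = _ := by ring
end Reg1b

section Reg1c

lemma Jbound' (p : ℕ) [Fact p.Prime] (B : Finset (ZMod p)) (hb : B.card ^ 3 ≤ p ^ 2)
    (d b g k : ZMod p) (hd : d ≠ 0) :
    ∑ j1 ∈ B ×ˢ B, ∑ j3 ∈ B ×ˢ B, ∑ j4 ∈ B ×ˢ B,
      ind (d * dd j1 * dd j3 + b * dd j1 + g * dd j3 + dd j4 + k = 0) ≤ 2 * Qc * (B.card : ℝ) ^ ((9 : ℝ) / 2) := by
  have h := Jbound p B hb d b g k hd
  rw [← sum_ind, Finset.sum_product] at h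
  simp only [Finset.sum_product (B ×ˢ B) (B ×ˢ B)] at h
  exact h

lemma T_half (p : ℕ) [Fact p.Prime] (B C : Finset (ZMod p)) (hb : B.card ^ 3 ≤ p ^ 2)
    (h1 : 1 ≤ B.card) (hbc : B.card ≤ C.card) (hcb : C.card ≤ B.card ^ 3) :
    Tq B C ≤ (2 * Qc + 4) * ((B.card : ℝ) * C.card) ^ ((25 : ℝ) / 4) := by
  have h := T_bound B C _ (Jbound' p B hb)
  have hQ : 0 ≤ Qc := by unfold Qc; positivity
  have hb1 : (1 : ℝ) ≤ B.card := by exact_mod_cast h1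
  have hbc' : (B.card : ℝ) ≤ C.card := by exact_mod_cast hbc
  have hcb' : (C.card : ℝ) ≤ (B.card : ℝ) ^ 3 := by exact_mod_cast hcb
  generalize (B.card : ℝ) = b at *
  generalize (C.card : ℝ) = c at *
  have hb0 : 0 < b := by linarith
  have hc0 : 0 < c := by linarith
  set x := Real.log b with hx
  set y := Real.log c with hy
  have x0 : 0 ≤ x := Real.log_nonneg hb1
  have xy : x ≤ y := Real.log_le_log hb0 hbc'
  have yx : y ≤ 3 * x := by
    have := Real.log_le_log hc0 hcb'
    rw [Real.log_pow] at this; exact_mod_cast this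
  have eb : b = Real.exp x := (Real.exp_log hb0).symm
  have ec : c = Real.exp y := (Real.exp_log hc0).symm
  have pw : ∀ (n : ℕ) (z : ℝ), Real.exp z ^ n = Real.exp (n * z) := fun n z => (Real.exp_nat_mul z n).symm
  have rp : ∀ (r z : ℝ), Real.exp z ^ r = Real.exp (z * r) := fun r z => (Real.exp_mul z r).symm
  have T : (b * c) ^ ((25 : ℝ) / 4) = Real.exp ((x + y) * (25 / 4)) := by
    rw [eb, ec, ← Real.exp_add, rp]
  have t1 : c ^ 6 * b ^ 2 * b ^ ((9 : ℝ) / 2) ≤ (b * c) ^ ((25 : ℝ) / 4) := by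
    rw [T, eb, ec, pw, pw, rp, ← Real.exp_add, ← Real.exp_add]
    apply Real.exp_le_exp.mpr; push_cast; linarith
  have t2 : c ^ 5 * b ^ 7 ≤ (b * c) ^ ((25 : ℝ) / 4) := by
    rw [T, eb, ec, pw, pw, ← Real.exp_add]
    apply Real.exp_le_exp.mpr; push_cast; linarith
  have t3 : c ^ 6 * b ^ 6 ≤ (b * c) ^ ((25 : ℝ) / 4) := by
    rw [T, eb, ec, pw, pw, ← Real.exp_add]
    apply Real.exp_le_exp.mpr; push_cast; linarith
  have t4 : c ^ 7 * b ^ 4 ≤ (b * c) ^ ((25 : ℝ) / 4) := by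
    rw [T, eb, ec, pw, pw, ← Real.exp_add]
    apply Real.exp_le_exp.mpr; push_cast; linarith
  have t5 : c ^ 6 * b ^ 5 ≤ (b * c) ^ ((25 : ℝ) / 4) := by
    rw [T, eb, ec, pw, pw, ← Real.exp_add]
    apply Real.exp_le_exp.mpr; push_cast; linarith
  have t1' : c ^ 6 * b ^ 2 * (2 * Qc * b ^ ((9 : ℝ) / 2)) ≤ 2 * Qc * (b * c) ^ ((25 : ℝ) / 4) := by
    have := mul_le_mul_of_nonneg_left t1 (show 0 ≤ 2 * Qc by positivity)
    linarith
  linarith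

lemma reg1 (p : ℕ) [Fact p.Prime] (A B C D : Finset (ZMod p))
    (hb1 : 1 ≤ B.card) (hc1 : 1 ≤ C.card)
    (hm : (min B.card C.card) ^ 3 ≤ p ^ 2) (hbc : B.card ≤ C.card ^ 3) (hcb : C.card ≤ B.card ^ 3) :
    Ic A B C D ≤ (8 * Qc + 22) * ((A.card : ℝ) ^ ((1 : ℝ) / 4) * B.card * C.card * (D.card : ℝ) ^ ((1 : ℝ) / 2) + (A.card : ℝ) ^ ((3 : ℝ) / 4) * ((B.card : ℝ) * C.card) ^ ((41 : ℝ) / 48) * (D.card : ℝ) ^ ((1 : ℝ) / 2)) := by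
  have hQ : 0 ≤ Qc := by unfold Qc; positivity
  have hT : Tq B C ≤ (2 * Qc + 4) * ((B.card : ℝ) * C.card) ^ ((25 : ℝ) / 4) := by
    rcases le_total B.card C.card with h | h
    · rw [min_eq_left h] at hm
      exact T_half p B C hm hb1 h hcb
    · rw [min_eq_right h] at hm
      rw [Tq_symm, mul_comm (B.card : ℝ)]
      exact T_half p C B hm hc1 h hbc
  have h4 := Ic_four A B C D
  have hT0 : 0 ≤ Tq B C := le_trans (Finset.sum_nonneg fun _ _ => Finset.sum_nonneg fun _ _ => ind_nonneg _) (word_pairs B C)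
  generalize Ic A B C D = I at *
  generalize Tq B C = T at *
  have ha : (0 : ℝ) ≤ A.card := Nat.cast_nonneg _
  have hd : (0 : ℝ) ≤ D.card := Nat.cast_nonneg _
  have hN : (0 : ℝ) ≤ (B.card : ℝ) * C.card := by positivity
  rw [mul_assoc ((A.card : ℝ) ^ ((1 : ℝ) / 4))]
  generalize (B.card : ℝ) * C.card = N at *
  generalize (A.card : ℝ) = a at *
  generalize (D.card : ℝ) = d at *
  set K := 8 * Qc + 16 with hK
  have pp : ∀ (x r : ℝ) (n : ℕ), 0 ≤ x → (x ^ r) ^ n = x ^ (r * n) := fun x r n hx => by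
    rw [← Real.rpow_natCast, ← Real.rpow_mul hx]
  have e1 : (4 * a ^ 6 * N ^ 4 * T) ^ ((1 : ℝ) / 3) ≤ K * (a ^ 2 * N ^ ((41 : ℝ) / 12)) := by
    have : 4 * a ^ 6 * N ^ 4 * T ≤ (K * (a ^ 2 * N ^ ((41 : ℝ) / 12))) ^ 3 := by
      have e : (K * (a ^ 2 * N ^ ((41 : ℝ) / 12))) ^ 3 = K ^ 3 * (a ^ 6 * (N ^ 4 * N ^ ((25 : ℝ) / 4))) := by
        rw [mul_pow, mul_pow, pp _ _ _ hN, ← Real.rpow_natCast N 4, ← Real.rpow_add_of_nonneg hN (by norm_num) (by norm_num), ← pow_mul]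
        norm_num
      rw [e]
      have hK1 : K ≤ K ^ 3 := by
        have : 1 ≤ K := by rw [hK]; linarith
        calc K = K ^ 1 := (pow_one K).symm
          _ ≤ K ^ 3 := pow_le_pow_right₀ this (by norm_num)
      calc 4 * a ^ 6 * N ^ 4 * T ≤ 4 * a ^ 6 * N ^ 4 * ((2 * Qc + 4) * N ^ ((25 : ℝ) / 4)) := by gcongr
        _ = K * (a ^ 6 * (N ^ 4 * N ^ ((25 : ℝ) / 4))) := by rw [hK]; ring
        _ ≤ _ := mul_le_mul_of_nonneg_right hK1 (by positivity)
    calc _ ≤ ((K * (a ^ 2 * N ^ ((41 : ℝ) / 12))) ^ 3) ^ ((1 : ℝ) / 3) :=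
          Real.rpow_le_rpow (by positivity) this (by norm_num)
      _ = _ := by
          rw [← Real.rpow_natCast, ← Real.rpow_mul (by positivity)]; norm_num
  set X := a ^ ((1 : ℝ) / 4) * N * d ^ ((1 : ℝ) / 2) with hX
  set Y := a ^ ((3 : ℝ) / 4) * N ^ ((41 : ℝ) / 48) * d ^ ((1 : ℝ) / 2) with hY
  have X0 : 0 ≤ X := by positivity
  have Y0 : 0 ≤ Y := by positivity
  have X4 : X ^ 4 = a * N ^ 4 * d ^ 2 := by
    rw [hX, mul_pow, mul_pow, pp _ _ _ ha, pp _ _ _ hd, ← Real.rpow_natCast d 2]; norm_num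
  have Y4 : Y ^ 4 = a ^ 3 * N ^ ((41 : ℝ) / 12) * d ^ 2 := by
    rw [hY, mul_pow, mul_pow, pp _ _ _ ha, pp _ _ _ hd, pp _ _ _ hN, ← Real.rpow_natCast d 2, ← Real.rpow_natCast a 3]; norm_num
  have fin : I ^ 4 ≤ ((8 * Qc + 22) * (X + Y)) ^ 4 := by
    calc I ^ 4 ≤ d ^ 2 * a * (6 * N ^ 4 + (4 * a ^ 6 * N ^ 4 * T) ^ ((1 : ℝ) / 3)) := h4
      _ ≤ d ^ 2 * a * (6 * N ^ 4 + K * (a ^ 2 * N ^ ((41 : ℝ) / 12))) := by gcongr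
      _ = 6 * X ^ 4 + K * Y ^ 4 := by rw [X4, Y4]; ring
      _ ≤ (8 * Qc + 22) * (X ^ 4 + Y ^ 4) := by
          have := pow_nonneg X0 4
          have := pow_nonneg Y0 4
          rw [hK]
          nlinarith [mul_nonneg hQ (pow_nonneg X0 4), mul_nonneg hQ (pow_nonneg Y0 4)]
      _ ≤ (8 * Qc + 22) ^ 4 * (X + Y) ^ 4 := by
          have q1 : (8 * Qc + 22) ≤ (8 * Qc + 22) ^ 4 := by
            calc (8 * Qc + 22) = (8 * Qc + 22) ^ 1 := (pow_one _).symm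
              _ ≤ _ := pow_le_pow_right₀ (by linarith) (by norm_num)
          have q2 : X ^ 4 + Y ^ 4 ≤ (X + Y) ^ 4 := by
            have : (X + Y) ^ 4 = X ^ 4 + Y ^ 4 + (4 * X ^ 3 * Y + 6 * X ^ 2 * Y ^ 2 + 4 * X * Y ^ 3) := by ring
            rw [this]
            have : 0 ≤ 4 * X ^ 3 * Y + 6 * X ^ 2 * Y ^ 2 + 4 * X * Y ^ 3 := by positivity
            linarith
          gcongr
      _ = _ := by rw [mul_pow]
  exact le_of_pow_le_pow_left₀ (by norm_num) (by positivity) fin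
end Reg1c

section Reg2a
variable {F : Type*} [Field F] [Fintype F] [DecidableEq F]

lemma sum_sq_swap {ι κ : Type*} (M : Finset κ) (S : Finset ι) (w : ι → ℝ) (g : κ → ι → ℝ) :
    ∑ m ∈ M, (∑ Q ∈ S, w Q * g m Q) ^ 2 = ∑ Q ∈ S, ∑ Q' ∈ S, w Q * w Q' * ∑ m ∈ M, g m Q * g m Q' := by
  have : ∀ m ∈ M, (∑ Q ∈ S, w Q * g m Q) ^ 2 = ∑ Q ∈ S, ∑ Q' ∈ S, w Q * w Q' * (g m Q * g m Q') := by
    intro m _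
    rw [sq, Finset.sum_mul_sum]
    refine Finset.sum_congr rfl fun _ _ => Finset.sum_congr rfl fun _ _ => ?_
    ring
  rw [Finset.sum_congr rfl this, Finset.sum_comm]
  refine Finset.sum_congr rfl fun _ _ => ?_
  rw [Finset.sum_comm]
  refine Finset.sum_congr rfl fun _ _ => ?_
  rw [Finset.mul_sum]

lemma psd_ker {ι : Type*} (S : Finset ι) (w : ι → ℝ) (h : ι → F) :
    0 ≤ ∑ Q ∈ S, ∑ Q' ∈ S, w Q * w Q' * ind (h Q = h Q') := by
  have e : ∀ x y : F, ind (x = y) = ∑ m : F, ind (x = m) * ind (y = m) := by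
    intro x y
    rw [Finset.sum_eq_single x]
    · rw [ind_true rfl, one_mul]; exact ind_congr eq_comm
    · intro b _ hb
      rw [ind_false (fun h => hb h.symm), zero_mul]
    · intro h; exact absurd (Finset.mem_univ _) h
  have : ∑ Q ∈ S, ∑ Q' ∈ S, w Q * w Q' * ind (h Q = h Q') = ∑ m : F, (∑ Q ∈ S, w Q * ind (h Q = m)) ^ 2 := by
    rw [sum_sq_swap Finset.univ S w (fun m Q => ind (h Q = m))]
    refine Finset.sum_congr rfl fun _ _ => Finset.sum_congr rfl fun _ _ => ?_
    rw [e]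
  rw [this]
  exact Finset.sum_nonneg fun _ _ => sq_nonneg _

/-- nonzero pairs -/
def nzp (F : Type*) [Field F] [Fintype F] [DecidableEq F] : Finset (F × F) :=
  Finset.univ.filter fun Q => Q.1 ≠ 0 ∧ Q.2 ≠ 0

lemma line_ct (Q Q' : F × F) (hQ : Q ∈ nzp F) (hQ' : Q' ∈ nzp F) :
    ∑ σ : F, ∑ τ : F, ind (τ = -Q.2 - Q.2 / Q.1 * σ) * ind (τ = -Q'.2 - Q'.2 / Q'.1 * σ)
      = 1 - ind (Q.2 / Q.1 = Q'.2 / Q'.1) + Fintype.card F * ind (Q = Q') := by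
  obtain ⟨s, t⟩ := Q
  obtain ⟨s', t'⟩ := Q'
  simp only [nzp, Finset.mem_filter, Finset.mem_univ, true_and] at hQ hQ' ⊢
  obtain ⟨hs, ht⟩ := hQ
  obtain ⟨hs', ht'⟩ := hQ'
  have e1 : ∀ σ : F, ∑ τ : F, ind (τ = -t - t / s * σ) * ind (τ = -t' - t' / s' * σ)
      = ind (-t - t / s * σ = -t' - t' / s' * σ) := by
    intro σ
    rw [Finset.sum_eq_single (-t - t / s * σ)]
    · rw [ind_true rfl, one_mul]
    · intro b _ hb; rw [ind_false hb, zero_mul]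
    · intro h; exact absurd (Finset.mem_univ _) h
  simp only [e1]
  by_cases hm : t / s = t' / s'
  · rw [ind_true hm, hm]
    by_cases hq : t = t'
    · have : s = s' := by
        rw [hq] at hm
        field_simp at hm
        exact hm.symm
      rw [ind_true (by rw [hq, this])]
      have : ∀ σ : F, ind (-t - t' / s' * σ = -t' - t' / s' * σ) = 1 := fun σ => ind_true (by rw [hq])
      rw [Finset.sum_congr rfl fun σ _ => this σ]; simp
    · rw [ind_false (fun h => hq (Prod.mk.inj h).2)]
      have : ∀ σ : F, ind (-t - t' / s' * σ = -t' - t' / s' * σ) = 0 := fun σ => ind_false (by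
        intro h; apply hq; linear_combination -h)
      rw [Finset.sum_congr rfl fun σ _ => this σ]; simp
  · rw [ind_false hm, ind_false (fun h => hm (by rw [(Prod.mk.inj h).1, (Prod.mk.inj h).2]))]
    have hm' : t / s - t' / s' ≠ 0 := sub_ne_zero.mpr hm
    rw [Finset.sum_eq_single ((t' - t) / (t / s - t' / s'))]
    · rw [ind_true]; simp
      have : (t' - t) / (t / s - t' / s') * (t / s - t' / s') = t' - t := div_mul_cancel₀ _ hm'
      linear_combination -this
    · intro σ _ hb
      apply ind_false
      intro h; apply hb
      rw [eq_div_iff hm']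
      linear_combination -h
    · intro h; exact absurd (Finset.mem_univ _) h

lemma line_sum (w : F × F → ℝ) :
    ∑ σ : F, ∑ τ : F, (∑ Q ∈ nzp F, w Q * ind (τ = -Q.2 - Q.2 / Q.1 * σ)) ^ 2
      ≤ (∑ Q ∈ nzp F, w Q) ^ 2 + Fintype.card F * ∑ Q ∈ nzp F, w Q ^ 2 := by
  have h1 : ∑ σ : F, ∑ τ : F, (∑ Q ∈ nzp F, w Q * ind (τ = -Q.2 - Q.2 / Q.1 * σ)) ^ 2
      = ∑ Q ∈ nzp F, ∑ Q' ∈ nzp F, w Q * w Q' * ∑ σ : F, ∑ τ : F, ind (τ = -Q.2 - Q.2 / Q.1 * σ) * ind (τ = -Q'.2 - Q'.2 / Q'.1 * σ) := by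
    have := sum_sq_swap (Finset.univ ×ˢ Finset.univ) (nzp F) w (fun (m : F × F) Q => ind (m.2 = -Q.2 - Q.2 / Q.1 * m.1))
    simp only [Finset.sum_product] at this
    exact this
  have h2 := psd_ker (nzp F) w (fun Q => Q.2 / Q.1)
  have h3 : ∑ Q ∈ nzp F, ∑ Q' ∈ nzp F, w Q * w Q' * ind (Q = Q') = ∑ Q ∈ nzp F, w Q ^ 2 := by
    refine Finset.sum_congr rfl fun Q hQ => ?_
    rw [Finset.sum_eq_single Q]
    · rw [ind_true rfl]; ring
    · intro b _ hb; rw [ind_false (fun h => hb h.symm), mul_zero]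
    · intro h; exact absurd hQ h
  have h4 : ∑ Q ∈ nzp F, ∑ Q' ∈ nzp F, w Q * w Q' * ∑ σ : F, ∑ τ : F, ind (τ = -Q.2 - Q.2 / Q.1 * σ) * ind (τ = -Q'.2 - Q'.2 / Q'.1 * σ)
      = (∑ Q ∈ nzp F, w Q) ^ 2 - ∑ Q ∈ nzp F, ∑ Q' ∈ nzp F, w Q * w Q' * ind (Q.2 / Q.1 = Q'.2 / Q'.1)
        + Fintype.card F * ∑ Q ∈ nzp F, ∑ Q' ∈ nzp F, w Q * w Q' * ind (Q = Q') := by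
    rw [sq, Finset.sum_mul_sum, Finset.mul_sum, ← Finset.sum_sub_distrib, ← Finset.sum_add_distrib]
    refine Finset.sum_congr rfl fun Q hQ => ?_
    rw [Finset.mul_sum, ← Finset.sum_sub_distrib, ← Finset.sum_add_distrib]
    refine Finset.sum_congr rfl fun Q' hQ' => ?_
    rw [line_ct Q Q' hQ hQ']; ring
  rw [h1, h4, h3]
  linarith
end Reg2a

section Reg2b
variable {F : Type*} [Field F] [Fintype F] [DecidableEq F]

/-- balanced function -/
noncomputable def fA (A : Finset F) (u : F) : ℝ := ind (u ∈ A) - (A.card : ℝ) / Fintype.card F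

/-- weighted hyperbola sum -/
noncomputable def Sf (f : F → ℝ) (α β μ : F) : ℝ := ∑ u : F, ∑ v : F, f u * f v * ind ((u + α) * (v + β) = μ)

/-- hyperbola count -/
noncomputable def SA (A : Finset F) (α β μ : F) : ℝ := ∑ P ∈ A ×ˢ A, ind ((P.1 + α) * (P.2 + β) = μ)

lemma sum_memA (A : Finset F) (h : F → ℝ) : ∑ u : F, ind (u ∈ A) * h u = ∑ u ∈ A, h u := by
  rw [← Finset.sum_filter_add_sum_filter_not Finset.univ (fun u => u ∈ A)]
  have e1 : ∑ u ∈ Finset.univ.filter (fun u => u ∈ A), ind (u ∈ A) * h u = ∑ u ∈ A, h u := by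
    have : Finset.univ.filter (fun u => u ∈ A) = A := by ext; simp
    rw [this]
    exact Finset.sum_congr rfl fun u hu => by rw [ind_true hu, one_mul]
  have e2 : ∑ u ∈ Finset.univ.filter (fun u => ¬ u ∈ A), ind (u ∈ A) * h u = 0 :=
    Finset.sum_eq_zero fun u hu => by rw [ind_false (Finset.mem_filter.mp hu).2, zero_mul]
  rw [e1, e2, add_zero]

lemma qpos : (0 : ℝ) < Fintype.card F := by exact_mod_cast Fintype.card_pos

lemma cardA_le (A : Finset F) : (A.card : ℝ) ≤ Fintype.card F := by exact_mod_cast Finset.card_le_univ A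

lemma sum_one_A (A : Finset F) : ∑ u : F, ind (u ∈ A) = A.card := by
  have := sum_memA A (fun _ => 1)
  simpa using this

lemma fA_sum (A : Finset F) : ∑ u : F, fA A u = 0 := by
  unfold fA
  have := qpos (F := F)
  rw [Finset.sum_sub_distrib, sum_one_A]
  simp
  field_simp; simp

lemma fA_abs (A : Finset F) (u : F) : fA A u ^ 2 ≤ 1 := by
  have h := qpos (F := F)
  have h1 := cardA_le A
  have h2 : (A.card : ℝ) / Fintype.card F ≤ 1 := by rw [div_le_one h]; exact h1
  have h3 : 0 ≤ (A.card : ℝ) / Fintype.card F := by positivity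
  have h4 := ind_nonneg (u ∈ A)
  have h5 := ind_le_one (u ∈ A)
  unfold fA
  rw [sq_le_one_iff_abs_le_one, abs_le]
  constructor <;> linarith

lemma fA_sq (A : Finset F) : ∑ u : F, fA A u ^ 2 ≤ A.card := by
  have h := qpos (F := F)
  have e : ∀ u, fA A u ^ 2 = fA A u * (-((A.card : ℝ) / Fintype.card F)) + ind (u ∈ A) * fA A u := by
    intro u
    have : fA A u = ind (u ∈ A) - (A.card : ℝ) / Fintype.card F := rfl
    rw [sq]; nth_rewrite 1 [this]; ring
  rw [Finset.sum_congr rfl fun u _ => e u, Finset.sum_add_distrib, ← Finset.sum_mul, fA_sum, zero_mul, zero_add, sum_memA]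
  have : ∑ u ∈ A, fA A u ≤ A.card * 1 := by
    refine sum_le_const _ _ _ fun u _ => ?_
    exact (abs_le_one_iff_mul_self_le_one.mpr (by rw [← sq]; exact fA_abs A u) |> abs_le.mp).2
  linarith

lemma sum_nz_shift (f : F → ℝ) (hf : ∑ u, f u = 0) (u3 : F) :
    ∑ s ∈ Finset.univ.filter (fun s : F => s ≠ 0), f (u3 + s) = - f u3 := by
  have h1 : ∑ s : F, f (u3 + s) = 0 := by
    rw [← hf]; exact Fintype.sum_equiv (Equiv.addLeft u3) _ _ (fun _ => rfl)
  rw [← Finset.sum_filter_add_sum_filter_not Finset.univ (fun s : F => s ≠ 0)] at h1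
  have : Finset.univ.filter (fun s : F => ¬ s ≠ 0) = {0} := by ext; simp
  rw [this, Finset.sum_singleton, add_zero] at h1
  linarith

lemma nzp_eq : nzp F = (Finset.univ.filter (fun s : F => s ≠ 0)) ×ˢ (Finset.univ.filter (fun s : F => s ≠ 0)) := by
  ext ⟨a, b⟩; simp [nzp]

lemma Sf_split (f : F → ℝ) (u3 v3 σ τ : F) (hσ : σ ≠ 0) (hτ : τ ≠ 0) :
    Sf f (σ - u3) (τ - v3) (σ * τ) = f u3 * f v3 +
      ∑ Q ∈ nzp F, f (u3 + Q.1) * f (v3 + Q.2) * ind (τ = -Q.2 - Q.2 / Q.1 * σ) := by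
  have e1 : Sf f (σ - u3) (τ - v3) (σ * τ) = ∑ Q : F × F, f (u3 + Q.1) * f (v3 + Q.2) * ind ((Q.1 + σ) * (Q.2 + τ) = σ * τ) := by
    unfold Sf
    rw [Fintype.sum_prod_type]
    refine (Fintype.sum_equiv (Equiv.addLeft u3) _ _ (fun s => ?_)).symm
    refine (Fintype.sum_equiv (Equiv.addLeft v3) _ _ (fun t => ?_))
    simp only [Equiv.coe_addLeft]
    congr 2
    ring_nf
  rw [e1, ← Finset.sum_filter_add_sum_filter_not Finset.univ (fun Q : F × F => Q.1 ≠ 0 ∧ Q.2 ≠ 0), add_comm]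
  congr 1
  · rw [Finset.sum_eq_single ((0, 0) : F × F)]
    · simp only [add_zero, zero_add]; rw [ind_true trivial, mul_one]
    · rintro ⟨s, t⟩ h hne
      rw [ind_false, mul_zero]
      intro h2
      simp only [Finset.mem_filter, Finset.mem_univ, true_and, not_and_or, not_not] at h h2
      rcases h with h | h
      · subst h
        have : t = 0 := by
          apply mul_left_cancel₀ hσ; linear_combination h2
        exact hne (by rw [this])
      · subst h
        have : s = 0 := by
          apply mul_left_cancel₀ hτ; linear_combination h2
        exact hne (by rw [this])
    · intro h; simp at h
  · unfold nzp
    refine Finset.sum_congr rfl fun Q hQ => ?_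
    obtain ⟨-, hs, ht⟩ := Finset.mem_filter.mp hQ
    congr 1
    apply ind_congr
    constructor
    · intro h
      apply mul_left_cancel₀ hs
      have : Q.1 * (-Q.2 - Q.2 / Q.1 * σ) = - Q.1 * Q.2 - Q.2 * σ := by field_simp
      rw [this]; linear_combination h
    · intro h
      have : Q.1 * (-Q.2 - Q.2 / Q.1 * σ) = - Q.1 * Q.2 - Q.2 * σ := by field_simp
      rw [← h] at this
      linear_combination this

lemma Sf_pt (A : Finset F) (u3 v3 : F) :
    ∑ Q ∈ nzp F, Sf (fA A) (Q.1 - u3) (Q.2 - v3) (Q.1 * Q.2) ^ 2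
      ≤ 2 * (Fintype.card F : ℝ) ^ 2 + 2 * (1 + Fintype.card F * (A.card : ℝ) ^ 2) := by
  set f := fA A with hf
  set w : F × F → ℝ := fun Q => f (u3 + Q.1) * f (v3 + Q.2) with hw
  have hL := line_sum w
  have hu := fA_abs A u3
  have hv := fA_abs A v3
  have hu0 := sq_nonneg (fA A u3)
  have hv0 := sq_nonneg (fA A v3)
  have huv : (f u3 * f v3) ^ 2 ≤ 1 := by
    rw [mul_pow]; nlinarith
  have w1 : ∑ Q ∈ nzp F, w Q = f u3 * f v3 := by
    rw [nzp_eq, Finset.sum_product]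
    simp only [hw]
    rw [← Finset.sum_mul_sum, sum_nz_shift f (fA_sum A), sum_nz_shift f (fA_sum A)]; ring
  have w2 : ∑ Q ∈ nzp F, w Q ^ 2 ≤ (A.card : ℝ) ^ 2 := by
    calc ∑ Q ∈ nzp F, w Q ^ 2 ≤ ∑ Q : F × F, w Q ^ 2 :=
          Finset.sum_le_sum_of_subset_of_nonneg (Finset.subset_univ _) fun _ _ _ => sq_nonneg _
      _ = (∑ u, f u ^ 2) * ∑ v, f v ^ 2 := by
          rw [Finset.sum_mul_sum, Fintype.sum_prod_type]
          refine (Fintype.sum_equiv (Equiv.addLeft u3) _ _ (fun s => ?_))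
          refine (Fintype.sum_equiv (Equiv.addLeft v3) _ _ (fun t => ?_))
          simp only [Equiv.coe_addLeft, hw]; ring
      _ ≤ (A.card : ℝ) * A.card := mul_le_mul (fA_sq A) (fA_sq A) (Finset.sum_nonneg fun _ _ => sq_nonneg _) (Nat.cast_nonneg _)
      _ = _ := by ring
  calc ∑ Q ∈ nzp F, Sf f (Q.1 - u3) (Q.2 - v3) (Q.1 * Q.2) ^ 2
      ≤ ∑ Q ∈ nzp F, (2 + 2 * (∑ Q' ∈ nzp F, w Q' * ind (Q.2 = -Q'.2 - Q'.2 / Q'.1 * Q.1)) ^ 2) := by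
        refine Finset.sum_le_sum fun Q hQ => ?_
        obtain ⟨-, hs, ht⟩ := Finset.mem_filter.mp hQ
        rw [Sf_split f u3 v3 Q.1 Q.2 hs ht]
        simp only [hw]
        generalize ∑ Q' ∈ nzp F, f (u3 + Q'.1) * f (v3 + Q'.2) * ind (Q.2 = -Q'.2 - Q'.2 / Q'.1 * Q.1) = X
        nlinarith [sq_nonneg (f u3 * f v3 - X)]
    _ ≤ ∑ Q : F × F, (2 + 2 * (∑ Q' ∈ nzp F, w Q' * ind (Q.2 = -Q'.2 - Q'.2 / Q'.1 * Q.1)) ^ 2) :=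
        Finset.sum_le_sum_of_subset_of_nonneg (Finset.subset_univ _) fun _ _ _ => by positivity
    _ = 2 * (Fintype.card F : ℝ) ^ 2 + 2 * ∑ σ : F, ∑ τ : F, (∑ Q ∈ nzp F, w Q * ind (τ = -Q.2 - Q.2 / Q.1 * σ)) ^ 2 := by
        rw [Finset.sum_add_distrib, ← Finset.mul_sum]
        congr 1
        · simp; ring
        · congr 1
          exact Fintype.sum_prod_type _
    _ ≤ 2 * (Fintype.card F : ℝ) ^ 2 + 2 * ((∑ Q ∈ nzp F, w Q) ^ 2 + Fintype.card F * ∑ Q ∈ nzp F, w Q ^ 2) := by linarith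
    _ ≤ _ := by
        rw [w1]
        have := mul_le_mul_of_nonneg_left w2 (qpos (F := F)).le
        linarith

lemma Sf_cubeish (A : Finset F) :
    ∑ α : F, ∑ β : F, ∑ μ ∈ Finset.univ.filter (fun μ : F => μ ≠ 0), Sf (fA A) α β μ ^ 2 * SA A α β μ
      ≤ (A.card : ℝ) ^ 2 * (2 * (Fintype.card F : ℝ) ^ 2 + 2 * (1 + Fintype.card F * (A.card : ℝ) ^ 2)) := by
  have key : ∀ P : F × F, ∑ α : F, ∑ β : F, ∑ μ ∈ Finset.univ.filter (fun μ : F => μ ≠ 0), Sf (fA A) α β μ ^ 2 * ind ((P.1 + α) * (P.2 + β) = μ)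
      ≤ ∑ Q ∈ nzp F, Sf (fA A) (Q.1 - P.1) (Q.2 - P.2) (Q.1 * Q.2) ^ 2 := by
    intro P
    have e : ∀ α β : F, ∑ μ ∈ Finset.univ.filter (fun μ : F => μ ≠ 0), Sf (fA A) α β μ ^ 2 * ind ((P.1 + α) * (P.2 + β) = μ)
        = if (P.1 + α ≠ 0 ∧ P.2 + β ≠ 0) then Sf (fA A) α β ((P.1 + α) * (P.2 + β)) ^ 2 else 0 := by
      intro α β
      split_ifs with h
      · rw [Finset.sum_eq_single ((P.1 + α) * (P.2 + β))]
        · rw [ind_true rfl, mul_one]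
        · intro b _ hb; rw [ind_false (fun h => hb h.symm), mul_zero]
        · intro h'; exfalso; apply h'; simp [h.1, h.2]
      · refine Finset.sum_eq_zero fun μ hμ => ?_
        rw [ind_false, mul_zero]
        intro h'
        apply (Finset.mem_filter.mp hμ).2
        rw [← h', mul_eq_zero]
        tauto
    simp only [e]
    unfold nzp
    rw [Finset.sum_filter, Fintype.sum_prod_type]
    refine le_of_eq ?_
    refine (Fintype.sum_equiv (Equiv.addLeft P.1) _ _ (fun s => ?_))
    refine (Fintype.sum_equiv (Equiv.addLeft P.2) _ _ (fun t => ?_))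
    simp
  have e : ∑ α : F, ∑ β : F, ∑ μ ∈ Finset.univ.filter (fun μ : F => μ ≠ 0), Sf (fA A) α β μ ^ 2 * SA A α β μ
      = ∑ P ∈ A ×ˢ A, ∑ α : F, ∑ β : F, ∑ μ ∈ Finset.univ.filter (fun μ : F => μ ≠ 0), Sf (fA A) α β μ ^ 2 * ind ((P.1 + α) * (P.2 + β) = μ) := by
    unfold SA
    simp only [Finset.mul_sum]
    rw [Finset.sum_comm (s := A ×ˢ A)]
    refine Finset.sum_congr rfl fun _ _ => ?_
    rw [Finset.sum_comm (s := A ×ˢ A)]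
    refine Finset.sum_congr rfl fun _ _ => ?_
    rw [Finset.sum_comm (s := A ×ˢ A)]
  rw [e]
  refine (sum_le_const _ _ _ fun P _ => (key P).trans (Sf_pt A P.1 P.2)).trans (le_of_eq ?_)
  rw [card_sq]

lemma hyp_sum (α β μ : F) (hμ : μ ≠ 0) (u : F) : ∑ v : F, ind ((u + α) * (v + β) = μ) = ind (u + α ≠ 0) := by
  by_cases h : u + α = 0
  · rw [ind_false (by simpa using h)]
    refine Finset.sum_eq_zero fun v _ => ind_false ?_
    rw [h, zero_mul]; exact fun h => hμ h.symm
  · rw [ind_true h, Finset.sum_eq_single (μ / (u + α) - β)]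
    · apply ind_true; field_simp; ring
    · intro v _ hv
      apply ind_false; intro h'; apply hv
      rw [eq_sub_iff_add_eq, eq_div_iff h, mul_comm]; exact h'
    · intro h; exact absurd (Finset.mem_univ _) h

lemma nz_A (A : Finset F) (α : F) : (A.card : ℝ) - 1 ≤ ∑ u : F, ind (u ∈ A) * ind (u + α ≠ 0) := by
  rw [sum_memA]
  have : ∑ u ∈ A, (1 - ind (u = -α)) ≤ ∑ u ∈ A, ind (u + α ≠ 0) := by
    refine Finset.sum_le_sum fun u _ => ?_
    by_cases h : u = -α
    · rw [ind_true h]; have := ind_nonneg (u + α ≠ 0); linarith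
    · rw [ind_false h, ind_true]; norm_num
      exact fun h' => h (eq_neg_of_add_eq_zero_left h')
  have h2 : ∑ u ∈ A, ind (u = -α) ≤ 1 := by
    rw [sum_ind, Finset.filter_eq']; split_ifs <;> simp
  rw [Finset.sum_sub_distrib] at this
  simp at this
  linarith

lemma Sf_le_SA (A : Finset F) (hA : 2 ≤ A.card) (α β μ : F) (hμ : μ ≠ 0) : Sf (fA A) α β μ ≤ SA A α β μ := by
  set κ := (A.card : ℝ) / Fintype.card F with hκ
  have κ0 : 0 ≤ κ := by positivity
  have hq := qpos (F := F)
  have hA' : (2 : ℝ) ≤ A.card := by exact_mod_cast hA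
  have e : Sf (fA A) α β μ = SA A α β μ - κ * (∑ u : F, ind (u ∈ A) * ind (u + α ≠ 0))
      - κ * (∑ v : F, ind (v ∈ A) * ind (v + β ≠ 0)) + κ ^ 2 * ∑ u : F, ind (u + α ≠ 0) := by
    have s1 : SA A α β μ = ∑ u : F, ∑ v : F, ind (u ∈ A) * ind (v ∈ A) * ind ((u + α) * (v + β) = μ) := by
      unfold SA
      rw [Finset.sum_product, ← sum_memA]
      refine Finset.sum_congr rfl fun u _ => ?_
      rw [← sum_memA, Finset.mul_sum]
      exact Finset.sum_congr rfl fun v _ => by ring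
    have s2 : ∑ u : F, ind (u ∈ A) * ind (u + α ≠ 0) = ∑ u : F, ∑ v : F, ind (u ∈ A) * ind ((u + α) * (v + β) = μ) := by
      refine Finset.sum_congr rfl fun u _ => ?_
      rw [← Finset.mul_sum, hyp_sum α β μ hμ]
    have s3 : ∑ v : F, ind (v ∈ A) * ind (v + β ≠ 0) = ∑ u : F, ∑ v : F, ind (v ∈ A) * ind ((u + α) * (v + β) = μ) := by
      rw [Finset.sum_comm]
      refine Finset.sum_congr rfl fun v _ => ?_
      rw [← Finset.mul_sum, ← hyp_sum β α μ hμ]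
      congr 1
      exact Finset.sum_congr rfl fun u _ => by rw [mul_comm]
    have s4 : ∑ u : F, ind (u + α ≠ 0) = ∑ u : F, ∑ v : F, ind ((u + α) * (v + β) = μ) :=
      Finset.sum_congr rfl fun u _ => (hyp_sum α β μ hμ u).symm
    rw [s1, s2, s3, s4]
    unfold Sf fA
    rw [← hκ]
    simp only [Finset.mul_sum, ← Finset.sum_sub_distrib, ← Finset.sum_add_distrib]
    exact Finset.sum_congr rfl fun u _ => Finset.sum_congr rfl fun v _ => by ring
  have h1 := mul_le_mul_of_nonneg_left (nz_A A α) κ0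
  have h2 := mul_le_mul_of_nonneg_left (nz_A A β) κ0
  have h3 : ∑ u : F, ind (u + α ≠ 0) ≤ Fintype.card F := by
    have := sum_le_const (Finset.univ : Finset F) (fun u => ind (u + α ≠ 0)) 1 fun _ _ => ind_le_one _
    simpa using this
  have h4 := mul_le_mul_of_nonneg_left h3 (sq_nonneg κ)
  have h5 : κ ^ 2 * Fintype.card F = κ * A.card := by rw [hκ]; field_simp
  rw [h5] at h4
  rw [e]
  nlinarith
end Reg2b

section Reg2c
variable {F : Type*} [Field F] [Fintype F] [DecidableEq F]

/-- value on a word -/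
noncomputable def Sg (A : Finset F) (g : (F × F) × F) : ℝ :=
  Sf (fA A) (g.1.1 - g.2⁻¹) (g.1.2 + g.2⁻¹) (-(g.2⁻¹ ^ 2))

lemma Sg_cube (A : Finset F) (hA : 2 ≤ A.card) (𝒢 : Finset ((F × F) × F)) (h𝒢 : ∀ g ∈ 𝒢, g.2 ≠ 0) :
    ∑ g ∈ 𝒢, max (Sg A g) 0 ^ 3 ≤
      2 * ((A.card : ℝ) ^ 2 * (2 * (Fintype.card F : ℝ) ^ 2 + 2 * (1 + Fintype.card F * (A.card : ℝ) ^ 2))) := by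
  set H : F × F × F → ℝ := fun t => Sf (fA A) t.1 t.2.1 t.2.2 ^ 2 * SA A t.1 t.2.1 t.2.2 with hH
  have SA0 : ∀ α β μ, 0 ≤ SA A α β μ := fun _ _ _ => Finset.sum_nonneg fun _ _ => ind_nonneg _
  have H0 : ∀ t, 0 ≤ H t := fun t => mul_nonneg (sq_nonneg _) (SA0 _ _ _)
  set ψ : (F × F) × F → F × F × F := fun g => (g.1.1 - g.2⁻¹, g.1.2 + g.2⁻¹, -(g.2⁻¹ ^ 2)) with hψ
  set T : Finset (F × F × F) := Finset.univ ×ˢ Finset.univ ×ˢ Finset.univ.filter (fun μ : F => μ ≠ 0) with hT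
  have maps : ∀ g ∈ 𝒢, ψ g ∈ T := by
    intro g hg
    have := h𝒢 g hg
    simp [hT, hψ, this]
  calc ∑ g ∈ 𝒢, max (Sg A g) 0 ^ 3 ≤ ∑ g ∈ 𝒢, H (ψ g) := by
        refine Finset.sum_le_sum fun g hg => ?_
        have h1 : Sg A g ≤ SA A (g.1.1 - g.2⁻¹) (g.1.2 + g.2⁻¹) (-(g.2⁻¹ ^ 2)) := by
          apply Sf_le_SA A hA
          have := h𝒢 g hg
          simp [this]
        rcases le_total (Sg A g) 0 with h | h
        · rw [max_eq_right h]; simpa using H0 (ψ g)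
        · rw [max_eq_left h]
          show _ ≤ Sg A g ^ 2 * _
          rw [pow_succ]
          exact mul_le_mul_of_nonneg_left h1 (sq_nonneg _)
    _ = ∑ t ∈ T, ∑ g ∈ 𝒢 with ψ g = t, H (ψ g) := (Finset.sum_fiberwise_of_maps_to maps _).symm
    _ ≤ ∑ t ∈ T, 2 * H t := by
        refine Finset.sum_le_sum fun t _ => ?_
        have : ∑ g ∈ 𝒢 with ψ g = t, H (ψ g) = ((𝒢.filter fun g => ψ g = t).card : ℝ) * H t := by
          rw [Finset.sum_congr rfl fun g hg => by rw [(Finset.mem_filter.mp hg).2]]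
          simp
        rw [this]
        refine mul_le_mul_of_nonneg_right ?_ (H0 t)
        rcases Finset.eq_empty_or_nonempty (𝒢.filter fun g => ψ g = t) with he | ⟨g, hg⟩
        · rw [he]; norm_num
        · obtain ⟨hg1, hg2⟩ := Finset.mem_filter.mp hg
          have : (𝒢.filter fun g => ψ g = t) ⊆ {g, ((g.1.1 - g.2⁻¹ - g.2⁻¹, g.1.2 + g.2⁻¹ + g.2⁻¹), -g.2)} := by
            intro k hk
            obtain ⟨hk1, hk2⟩ := Finset.mem_filter.mp hk
            rw [← hg2] at hk2
            simp only [hψ, Prod.mk.injEq, neg_inj] at hk2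
            obtain ⟨e1, e2, e3⟩ := hk2
            rcases sq_eq_sq_iff_eq_or_eq_neg.mp e3 with e | e
            · have e' : k.2 = g.2 := inv_inj.mp e
              rw [e'] at e1 e2
              have : k = g := by
                refine Prod.ext (Prod.ext ?_ ?_) e'
                · linear_combination e1
                · linear_combination e2
              simp [this]
            · have e' : k.2 = -g.2 := by rw [← inv_inj, e, inv_neg]
              rw [e] at e1 e2
              have : k = ((g.1.1 - g.2⁻¹ - g.2⁻¹, g.1.2 + g.2⁻¹ + g.2⁻¹), -g.2) := by
                refine Prod.ext (Prod.ext ?_ ?_) e'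
                · show k.1.1 = g.1.1 - g.2⁻¹ - g.2⁻¹
                  linear_combination e1
                · show k.1.2 = g.1.2 + g.2⁻¹ + g.2⁻¹
                  linear_combination e2
              simp [this]
          have := (Finset.card_le_card this).trans Finset.card_le_two
          exact_mod_cast this
    _ = 2 * ∑ α : F, ∑ β : F, ∑ μ ∈ Finset.univ.filter (fun μ : F => μ ≠ 0), Sf (fA A) α β μ ^ 2 * SA A α β μ := by
        rw [← Finset.mul_sum, hT, Finset.sum_product]
        simp only [Finset.sum_product, hH]
    _ ≤ _ := mul_le_mul_of_nonneg_left (Sf_cubeish A) (by norm_num)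

/-- words -/
def W4 (B C : Finset F) : Finset ((F × F) × (F × F)) := ((B ×ˢ B) ×ˢ (C ×ˢ C)).filter fun w => w.2.1 ≠ w.2.2

lemma W4_card (B C : Finset F) : ((W4 B C).card : ℝ) ≤ ((B.card : ℝ) * C.card) ^ 2 := by
  have : (W4 B C).card ≤ ((B ×ˢ B) ×ˢ (C ×ˢ C)).card := Finset.card_filter_le _ _
  rw [Finset.card_product, Finset.card_product, Finset.card_product] at this
  have h : ((W4 B C).card : ℝ) ≤ ((B.card * B.card * (C.card * C.card) : ℕ) : ℝ) := by exact_mod_cast this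
  push_cast at h
  linarith

lemma W4_pairs (B C : Finset F) :
    ∑ w ∈ W4 B C, ∑ w' ∈ W4 B C, ind ((w.1, w.2.1 - w.2.2) = (w'.1, w'.2.1 - w'.2.2)) ≤
      ((B.card : ℝ) * C.card) ^ 2 * C.card := by
  refine (sum_le_const _ _ (C.card : ℝ) fun w _ => ?_).trans (mul_le_mul_of_nonneg_right (W4_card B C) (Nat.cast_nonneg _))
  rw [sum_ind]
  norm_cast
  refine Finset.card_le_card_of_injOn (fun i => i.2.1) ?_ ?_
  · intro i hi
    exact (Finset.mem_product.mp (Finset.mem_product.mp (Finset.mem_filter.mp (Finset.mem_filter.mp hi).1).1).2).1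
  · intro i hi j hj h
    have h1 := (Finset.mem_filter.mp hi).2
    have h2 := (Finset.mem_filter.mp hj).2
    rw [h1] at h2
    simp only [Prod.mk.injEq] at h h2
    refine Prod.ext h2.1 (Prod.ext h ?_)
    linear_combination h - h2.2

lemma W4_sum (A B C : Finset F) (hA : 2 ≤ A.card) (haq : (Fintype.card F : ℝ) ≤ (A.card : ℝ) ^ 2) :
    (∑ w ∈ W4 B C, max (Sg A (w.1, w.2.1 - w.2.2)) 0) ^ 3 ≤
      ((B.card : ℝ) * C.card) ^ 4 * C.card * (12 * Fintype.card F * (A.card : ℝ) ^ 4) := by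
  have h := holder_fib (W4 B C) (fun w => (w.1, w.2.1 - w.2.2)) (fun g => max (Sg A g) 0) (fun _ => le_max_right _ _)
  have h3 := Sg_cube A hA ((W4 B C).image (fun w => (w.1, w.2.1 - w.2.2))) (by
    intro g hg
    obtain ⟨w, hw, rfl⟩ := Finset.mem_image.mp hg
    exact sub_ne_zero.mpr (Finset.mem_filter.mp hw).2)
  have hq1 : (1 : ℝ) ≤ Fintype.card F := by exact_mod_cast Fintype.card_pos (α := F)
  have h4 : 2 * ((A.card : ℝ) ^ 2 * (2 * (Fintype.card F : ℝ) ^ 2 + 2 * (1 + Fintype.card F * (A.card : ℝ) ^ 2)))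
      ≤ 12 * Fintype.card F * (A.card : ℝ) ^ 4 := by
    generalize (Fintype.card F : ℝ) = q at *
    have ha : (0 : ℝ) ≤ (A.card : ℝ) ^ 2 := sq_nonneg _
    have e4 : (A.card : ℝ) ^ 4 = ((A.card : ℝ) ^ 2) ^ 2 := by ring
    rw [e4]
    generalize (A.card : ℝ) ^ 2 = s at *
    have : q ^ 2 ≤ q * s := by nlinarith
    have : 1 ≤ q * s := by nlinarith
    have : s * (q ^ 2 + 1) ≤ s * (2 * (q * s)) := mul_le_mul_of_nonneg_left (by linarith) ha
    linarith
  refine h.trans ?_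
  have p0 : 0 ≤ ∑ g ∈ (W4 B C).image (fun w => (w.1, w.2.1 - w.2.2)), max (Sg A g) 0 ^ 3 :=
    Finset.sum_nonneg fun _ _ => pow_nonneg (le_max_right _ _) 3
  have p1 := mul_le_mul (W4_card B C) (W4_pairs B C) (Finset.sum_nonneg fun _ _ => Finset.sum_nonneg fun _ _ => ind_nonneg _) (by positivity)
  refine (mul_le_mul p1 (h3.trans h4) p0 (by positivity)).trans (le_of_eq ?_)
  ring
end Reg2c

section Reg2d
variable {F : Type*} [Field F] [Fintype F] [DecidableEq F]

lemma y_sum (U V c c' : F) :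
    ∑ y : F, ind (U * (c + y) = 1) * ind (V * (c' + y) = 1) = ind (rel U V (c - c')) := by
  by_cases hr : rel U V (c - c')
  · obtain ⟨hU, hV, h⟩ := hr
    rw [ind_true ⟨hU, hV, h⟩, Finset.sum_eq_single (U⁻¹ - c)]
    · rw [ind_true (by field_simp; ring), ind_true, one_mul]
      have : V * (c' + (U⁻¹ - c)) = U⁻¹ * (V * (1 - (c - c') * U)) := by field_simp; ring
      rw [this, h, inv_mul_cancel₀ hU]
    · intro y _ hy
      rw [ind_false, zero_mul]
      intro h'; apply hy
      rw [eq_sub_iff_add_eq, add_comm]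
      exact eq_inv_of_mul_eq_one_right h'
    · intro h; exact absurd (Finset.mem_univ _) h
  · rw [ind_false hr]
    refine Finset.sum_eq_zero fun y _ => ?_
    by_contra hne
    apply hr
    have c1 : U * (c + y) = 1 := by
      by_contra h; apply hne; rw [ind_false h, zero_mul]
    have c2 : V * (c' + y) = 1 := by
      by_contra h; apply hne; rw [ind_false h, mul_zero]
    refine ⟨left_ne_zero_of_mul_eq_one c1, left_ne_zero_of_mul_eq_one c2, ?_⟩
    linear_combination U * c2 - V * c1

/-- relation sum -/
noncomputable def Rf (f : F → ℝ) (b b' x : F) : ℝ := ∑ u : F, ∑ v : F, f u * f v * ind (rel (u + b) (v + b') x)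

/-- fibre sum -/
noncomputable def phi (f : F → ℝ) (B C : Finset F) (y : F) : ℝ :=
  ∑ t ∈ (Finset.univ : Finset F) ×ˢ B ×ˢ C, f t.1 * ind ((t.1 + t.2.1) * (t.2.2 + y) = 1)

lemma phi_sq (f : F → ℝ) (B C : Finset F) :
    ∑ y : F, phi f B C y ^ 2 = ∑ w ∈ (B ×ˢ B) ×ˢ (C ×ˢ C), Rf f w.1.1 w.1.2 (w.2.1 - w.2.2) := by
  unfold phi Rf
  rw [sum_sq_swap Finset.univ ((Finset.univ : Finset F) ×ˢ B ×ˢ C) (fun t => f t.1) (fun y t => ind ((t.1 + t.2.1) * (t.2.2 + y) = 1))]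
  simp only [y_sum]
  rw [← Finset.sum_product' ((Finset.univ : Finset F) ×ˢ B ×ˢ C) ((Finset.univ : Finset F) ×ˢ B ×ˢ C)
    (fun t t' => f t.1 * f t'.1 * ind (rel (t.1 + t.2.1) (t'.1 + t'.2.1) (t.2.2 - t'.2.2)))]
  have e : ∀ w : (F × F) × (F × F), ∑ u : F, ∑ v : F, f u * f v * ind (rel (u + w.1.1) (v + w.1.2) (w.2.1 - w.2.2))
    = ∑ P ∈ (Finset.univ : Finset (F × F)), f P.1 * f P.2 * ind (rel (P.1 + w.1.1) (P.2 + w.1.2) (w.2.1 - w.2.2)) := by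
    intro w; rw [Fintype.sum_prod_type]
  rw [Finset.sum_congr rfl fun w _ => e w]
  rw [← Finset.sum_product' ((B ×ˢ B) ×ˢ (C ×ˢ C)) (Finset.univ : Finset (F × F))
    (fun w P => f P.1 * f P.2 * ind (rel (P.1 + w.1.1) (P.2 + w.1.2) (w.2.1 - w.2.2)))]
  refine Finset.sum_nbij' (fun q => (((q.1.2.1, q.2.2.1), (q.1.2.2, q.2.2.2)), (q.1.1, q.2.1)))
    (fun q => ((q.2.1, q.1.1.1, q.1.2.1), (q.2.2, q.1.1.2, q.1.2.2))) ?_ ?_ ?_ ?_ ?_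
  · rintro ⟨⟨a, b, c⟩, ⟨a', b', c'⟩⟩ h
    simp only [Finset.mem_product, Finset.mem_univ] at h ⊢
    tauto
  · rintro ⟨⟨⟨b, b'⟩, ⟨c, c'⟩⟩, ⟨a, a'⟩⟩ h
    simp only [Finset.mem_product, Finset.mem_univ] at h ⊢
    tauto
  · intro _ _; rfl
  · intro _ _; rfl
  · intro _ _; rfl

lemma Rf_zero (A : Finset F) (b b' : F) : Rf (fA A) b b' 0 ≤ A.card := by
  unfold Rf
  have hf := fA_sq A
  set f := fA A
  have e : ∀ x y : F, ∑ v : F, ind (v = x) * f v ^ 2 = f x ^ 2 := by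
    intro x _
    rw [Finset.sum_eq_single x]
    · rw [ind_true rfl, one_mul]
    · intro v _ hv; rw [ind_false hv, zero_mul]
    · intro h; exact absurd (Finset.mem_univ _) h
  calc ∑ u : F, ∑ v : F, f u * f v * ind (rel (u + b) (v + b') 0)
      ≤ ∑ u : F, ∑ v : F, (ind (v = u + (b - b')) * (f u ^ 2 / 2) + ind (v = u + (b - b')) * f v ^ 2 * (1 / 2)) := by
        refine Finset.sum_le_sum fun u _ => Finset.sum_le_sum fun v _ => ?_
        by_cases h : v = u + (b - b')
        · rw [ind_true h]
          have h1 := ind_nonneg (rel (u + b) (v + b') 0)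
          have h2 := ind_le_one (rel (u + b) (v + b') 0)
          generalize ind (rel (u + b) (v + b') 0) = i at *
          nlinarith [mul_nonneg h1 (sq_nonneg (f u - f v)), mul_nonneg (sub_nonneg.mpr h2) (add_nonneg (sq_nonneg (f u)) (sq_nonneg (f v)))]
        · rw [ind_false h, ind_false]; simp
          rintro ⟨_, _, h3⟩
          apply h; linear_combination h3
    _ = ∑ u : F, f u ^ 2 / 2 + ∑ u : F, f (u + (b - b')) ^ 2 * (1 / 2) := by
        rw [← Finset.sum_add_distrib]
        refine Finset.sum_congr rfl fun u _ => ?_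
        rw [Finset.sum_add_distrib, ← Finset.sum_mul, ← Finset.sum_mul, e _ 0]
        congr 1
        rw [Finset.sum_eq_single (u + (b - b'))]
        · rw [ind_true rfl, one_mul]
        · intro v _ hv; rw [ind_false hv]
        · intro h; exact absurd (Finset.mem_univ _) h
    _ = ∑ u : F, f u ^ 2 := by
        have : ∑ u : F, f (u + (b - b')) ^ 2 = ∑ u : F, f u ^ 2 :=
          Fintype.sum_equiv (Equiv.addRight (b - b')) _ _ (fun _ => rfl)
        rw [← Finset.sum_mul, this, ← Finset.sum_div]; ring
    _ ≤ _ := hf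

lemma Rf_ne (A : Finset F) (b b' x : F) (hx : x ≠ 0) :
    Rf (fA A) b b' x = Sg A ((b, b'), x) - fA A (-b) * fA A (-b') := by
  unfold Rf Sg Sf
  set f := fA A
  have e0 : f (-b) * f (-b') = ∑ u : F, ∑ v : F, f u * f v * ind ((u, v) = (-b, -b')) := by
    rw [Finset.sum_eq_single (-b)]
    · rw [Finset.sum_eq_single (-b')]
      · rw [ind_true rfl, mul_one]
      · intro v _ hv; rw [ind_false (fun h => hv (Prod.mk.inj h).2), mul_zero]
      · intro h; exact absurd (Finset.mem_univ _) h
    · intro v _ hv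
      exact Finset.sum_eq_zero fun _ _ => by rw [ind_false (fun h => hv (Prod.mk.inj h).1), mul_zero]
    · intro h; exact absurd (Finset.mem_univ _) h
  rw [e0, ← Finset.sum_sub_distrib]
  refine Finset.sum_congr rfl fun u _ => ?_
  rw [← Finset.sum_sub_distrib]
  refine Finset.sum_congr rfl fun v _ => ?_
  rw [← mul_sub]
  congr 1
  have k : (u + (b - x⁻¹)) * (v + (b' + x⁻¹)) = -(x⁻¹ ^ 2) ↔ (v + b') * (1 - x * (u + b)) = u + b := by
    have : (u + (b - x⁻¹)) * (v + (b' + x⁻¹)) + (x⁻¹ ^ 2) = x⁻¹ * (u + b - (v + b') * (1 - x * (u + b))) := by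
      field_simp; ring
    rw [← add_eq_zero_iff_eq_neg, this, mul_eq_zero, or_iff_right (inv_ne_zero hx), sub_eq_zero, eq_comm]
  simp only
  rw [ind_congr k]
  by_cases h : u + b = 0
  · have hu : u = -b := eq_neg_of_add_eq_zero_left h
    rw [ind_false (fun hr => hr.1 h)]
    by_cases h' : v + b' = 0
    · have hv : v = -b' := eq_neg_of_add_eq_zero_left h'
      rw [ind_true (by rw [h, h']; ring), ind_true (by rw [hu, hv])]; ring
    · rw [ind_false, ind_false]; ring
      · intro e; apply h'; rw [(Prod.mk.inj e).2]; ring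
      · rw [h]; intro e; apply h'; linear_combination e
  · rw [ind_false (P := (u, v) = (-b, -b')), sub_zero]
    · apply ind_congr
      constructor
      · exact fun hr => hr.2.2
      · intro e
        refine ⟨h, ?_, e⟩
        intro hv; apply h; rw [← e, hv, zero_mul]
    · intro e; apply h; rw [(Prod.mk.inj e).1]; ring

lemma phi_bound (A B C : Finset F) :
    ∑ y : F, phi (fA A) B C y ^ 2 ≤ (B.card : ℝ) ^ 2 * C.card * A.card +
      ∑ w ∈ W4 B C, max (Sg A (w.1, w.2.1 - w.2.2)) 0 := by
  rw [phi_sq, ← Finset.sum_filter_not_add_sum_filter _ (fun w : (F × F) × (F × F) => w.2.1 ≠ w.2.2)]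
  refine add_le_add ?_ ?_
  · refine (sum_le_const _ _ (A.card : ℝ) fun w hw => ?_).trans (mul_le_mul_of_nonneg_right ?_ (Nat.cast_nonneg _))
    · have h := (Finset.mem_filter.mp hw).2
      rw [not_not] at h
      rw [h, sub_self]; exact Rf_zero A _ _
    · have : (((B ×ˢ B) ×ˢ (C ×ˢ C)).filter (fun w : (F × F) × (F × F) => ¬ w.2.1 ≠ w.2.2)).card ≤ ((B ×ˢ B) ×ˢ C).card := by
        refine Finset.card_le_card_of_injOn (fun i => (i.1, i.2.1)) ?_ ?_
        · intro i hi
          have h1 := Finset.mem_product.mp (Finset.mem_filter.mp hi).1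
          have h2 := Finset.mem_product.mp h1.2
          exact Finset.mem_coe.mpr (Finset.mem_product.mpr ⟨h1.1, h2.1⟩)
        · intro i hi j hj h
          have h1 := (Finset.mem_filter.mp hi).2
          have h2 := (Finset.mem_filter.mp hj).2
          rw [not_not] at h1 h2
          simp only [Prod.mk.injEq] at h
          exact Prod.ext h.1 (Prod.ext h.2 (by rw [← h1, ← h2, h.2]))
      rw [Finset.card_product, Finset.card_product] at this
      rw [sq]; exact_mod_cast this
  · show ∑ w ∈ W4 B C, _ ≤ _
    have e : ∀ w ∈ W4 B C, Rf (fA A) w.1.1 w.1.2 (w.2.1 - w.2.2) = Sg A (w.1, w.2.1 - w.2.2) - fA A (-w.1.1) * fA A (-w.1.2) := by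
      intro w hw
      exact Rf_ne A _ _ _ (sub_ne_zero.mpr (Finset.mem_filter.mp hw).2)
    rw [Finset.sum_congr rfl e, Finset.sum_sub_distrib]
    have h1 : ∑ w ∈ W4 B C, Sg A (w.1, w.2.1 - w.2.2) ≤ ∑ w ∈ W4 B C, max (Sg A (w.1, w.2.1 - w.2.2)) 0 :=
      Finset.sum_le_sum fun _ _ => le_max_left _ _
    have h2 : 0 ≤ ∑ w ∈ W4 B C, fA A (-w.1.1) * fA A (-w.1.2) := by
      have : W4 B C = (B ×ˢ B) ×ˢ (C ×ˢ C).filter (fun i => i.1 ≠ i.2) := by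
        ext w; simp only [W4, Finset.mem_filter, Finset.mem_product]; tauto
      rw [this, Finset.sum_product_right]
      refine Finset.sum_nonneg fun i _ => ?_
      rw [Finset.sum_product]
      simp only
      rw [← Finset.sum_mul_sum]
      exact mul_self_nonneg _
    linarith

lemma Ic_phi (A B C D : Finset F) :
    Ic A B C D - (A.card : ℝ) * B.card * C.card * D.card / Fintype.card F ≤ ∑ y ∈ D, phi (fA A) B C y := by
  have h : ∀ y : F, ∑ t ∈ A ×ˢ B ×ˢ C, ind ((t.1 + t.2.1) * (t.2.2 + y) = 1) - (A.card : ℝ) / Fintype.card F * (B.card * C.card)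
      ≤ phi (fA A) B C y := by
    intro y
    unfold phi fA
    rw [Finset.sum_product_right A (B ×ˢ C), Finset.sum_product_right (Finset.univ : Finset F) (B ×ˢ C)]
    have : (A.card : ℝ) / Fintype.card F * (B.card * C.card) = ∑ i ∈ B ×ˢ C, (A.card : ℝ) / Fintype.card F := by
      rw [Finset.sum_const, Finset.card_product]; simp; ring
    rw [this, ← Finset.sum_sub_distrib]
    refine Finset.sum_le_sum fun i _ => ?_
    simp only [sub_mul]
    rw [Finset.sum_sub_distrib, sum_memA A (fun u => ind ((u + i.1) * (i.2 + y) = 1)), ← Finset.mul_sum]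
    have h1 : ∑ u : F, ind ((u + i.1) * (i.2 + y) = 1) ≤ 1 := by
      have := hyp_sum i.2 i.1 (1 : F) one_ne_zero y
      have e : ∑ u : F, ind ((u + i.1) * (i.2 + y) = 1) = ind (y + i.2 ≠ 0) := by
        rw [← this]
        exact Finset.sum_congr rfl fun u _ => by rw [mul_comm, add_comm i.2]
      rw [e]; exact ind_le_one _
    have h2 : (A.card : ℝ) / Fintype.card F * ∑ u : F, ind ((u + i.1) * (i.2 + y) = 1) ≤ (A.card : ℝ) / Fintype.card F :=
      mul_le_of_le_one_right (by positivity) h1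
    linarith
  have := Finset.sum_le_sum (s := D) fun y _ => h y
  rw [Finset.sum_sub_distrib, Finset.sum_const, nsmul_eq_mul] at this
  unfold Ic
  refine le_trans (le_of_eq ?_) this
  ring

lemma Ic_reg2 (A B C D : Finset F) (hA : 2 ≤ A.card) (haq : (Fintype.card F : ℝ) ≤ (A.card : ℝ) ^ 2) :
    ∃ X Y : ℝ, 0 ≤ Y ∧ Ic A B C D - (A.card : ℝ) * B.card * C.card * D.card / Fintype.card F ≤ X ∧
      X ^ 2 ≤ D.card * ((B.card : ℝ) ^ 2 * C.card * A.card + Y) ∧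
      Y ^ 3 ≤ ((B.card : ℝ) * C.card) ^ 4 * C.card * (12 * Fintype.card F * (A.card : ℝ) ^ 4) := by
  refine ⟨_, _, Finset.sum_nonneg fun _ _ => le_max_right _ _, Ic_phi A B C D, ?_, W4_sum A B C hA haq⟩
  refine (sq_sum_le_card_mul_sum_sq (s := D)).trans (mul_le_mul_of_nonneg_left ?_ (Nat.cast_nonneg _))
  refine le_trans ?_ (phi_bound A B C)
  exact Finset.sum_le_sum_of_subset_of_nonneg (Finset.subset_univ _) fun _ _ _ => sq_nonneg _
end Reg2d

section Fin1

lemma sum_uniq {ι : Type*} (s : Finset ι) (P : ι → Prop) (h : ∀ i ∈ s, ∀ j ∈ s, P i → P j → i = j) :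
    ∑ i ∈ s, ind (P i) ≤ 1 := by
  classical
  rw [sum_ind]
  have : (s.filter P).card ≤ 1 := by
    rw [Finset.card_le_one]
    intro i hi j hj
    rw [Finset.mem_filter] at hi hj
    exact h i hi.1 j hj.1 hi.2 hj.2
  exact_mod_cast this

variable {F : Type*} [Field F] [DecidableEq F]

lemma Ic_triv (A B C D : Finset F) : Ic A B C D ≤ (A.card : ℝ) * B.card * C.card ∧
    Ic A B C D ≤ (B.card : ℝ) * C.card * D.card ∧ Ic A B C D ≤ (A.card : ℝ) * B.card * D.card ∧
    Ic A B C D ≤ (A.card : ℝ) * C.card * D.card := by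
  have e : Ic A B C D = ∑ y ∈ D, ∑ a ∈ A, ∑ b ∈ B, ∑ c ∈ C, ind ((a + b) * (c + y) = 1) := by
    unfold Ic
    simp only [Finset.sum_product]
  rw [e]
  have l1 : ∀ a b x y : F, (a + b) * x = 1 → (a + b) * y = 1 → x = y := by
    intro a b x y h1 h2
    exact mul_left_cancel₀ (left_ne_zero_of_mul_eq_one h1) (h1.trans h2.symm)
  have l2 : ∀ x y z : F, x * z = 1 → y * z = 1 → x = y := by
    intro x y z h1 h2
    exact mul_right_cancel₀ (right_ne_zero_of_mul_eq_one h1) (h1.trans h2.symm)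
  refine ⟨?_, ?_, ?_, ?_⟩
  · rw [Finset.sum_comm]
    refine (sum_le_const _ _ ((B.card : ℝ) * (C.card * 1)) fun a _ => ?_).trans (le_of_eq (by ring))
    rw [Finset.sum_comm]
    refine sum_le_const _ _ _ fun b _ => ?_
    rw [Finset.sum_comm]
    refine sum_le_const _ _ _ fun c _ => ?_
    refine sum_uniq _ _ fun i _ j _ h1 h2 => ?_
    exact add_left_cancel (l1 _ _ _ _ h1 h2)
  · refine (sum_le_const _ _ ((B.card : ℝ) * (C.card * 1)) fun y _ => ?_).trans (le_of_eq (by ring))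
    rw [Finset.sum_comm]
    refine sum_le_const _ _ _ fun b _ => ?_
    rw [Finset.sum_comm]
    refine sum_le_const _ _ _ fun c _ => ?_
    refine sum_uniq _ _ fun i _ j _ h1 h2 => ?_
    exact add_right_cancel (l2 _ _ _ h1 h2)
  · refine (sum_le_const _ _ ((A.card : ℝ) * (B.card * 1)) fun y _ => ?_).trans (le_of_eq (by ring))
    refine sum_le_const _ _ _ fun a _ => sum_le_const _ _ _ fun b _ => ?_
    refine sum_uniq _ _ fun i _ j _ h1 h2 => ?_
    exact add_right_cancel (l1 _ _ _ _ h1 h2)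
  · refine (sum_le_const _ _ ((A.card : ℝ) * (C.card * 1)) fun y _ => ?_).trans (le_of_eq (by ring))
    refine sum_le_const _ _ _ fun a _ => ?_
    rw [Finset.sum_comm]
    refine sum_le_const _ _ _ fun c _ => ?_
    refine sum_uniq _ _ fun i _ j _ h1 h2 => ?_
    exact add_left_cancel (l2 _ _ _ h1 h2)

lemma exp_log_nat {n : ℕ} (h : n ≠ 0) : (n : ℝ) = Real.exp (Real.log n) :=
  (Real.exp_log (by exact_mod_cast Nat.pos_of_ne_zero h)).symm

lemma nat_of_log {m n k l : ℕ} (hm : m ≠ 0) (hn : n ≠ 0) (h : (k : ℝ) * Real.log m ≤ l * Real.log n) : m ^ k ≤ n ^ l := by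
  have h1 : (0 : ℝ) < m := by exact_mod_cast Nat.pos_of_ne_zero hm
  have h2 : (0 : ℝ) < n := by exact_mod_cast Nat.pos_of_ne_zero hn
  rw [← Real.log_pow, ← Real.log_pow, Real.log_le_log_iff (by positivity) (by positivity)] at h
  exact_mod_cast h

lemma core (p : ℕ) [Fact p.Prime] (A B C D : Finset (ZMod p)) :
    Ic A B C D - (A.card : ℝ) * B.card * C.card * D.card / p ≤
      (8 * Qc + 22) * ((A.card : ℝ) ^ ((1 : ℝ) / 4) * B.card * C.card * (D.card : ℝ) ^ ((1 : ℝ) / 2) + (A.card : ℝ) ^ ((3 : ℝ) / 4) * ((B.card : ℝ) * C.card) ^ ((41 : ℝ) / 48) * (D.card : ℝ) ^ ((1 : ℝ) / 2)) := by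
  have hQ : 0 ≤ Qc := by unfold Qc; positivity
  obtain ⟨tr1, tr2, tr3, tr4⟩ := Ic_triv A B C D
  have main0 : 0 ≤ (A.card : ℝ) * B.card * C.card * D.card / p := by positivity
  have rhs0 : 0 ≤ ((A.card : ℝ) ^ ((1 : ℝ) / 4) * B.card * C.card * (D.card : ℝ) ^ ((1 : ℝ) / 2) + (A.card : ℝ) ^ ((3 : ℝ) / 4) * ((B.card : ℝ) * C.card) ^ ((41 : ℝ) / 48) * (D.card : ℝ) ^ ((1 : ℝ) / 2)) := by positivity
  have T1nn : 0 ≤ (A.card : ℝ) ^ ((1 : ℝ) / 4) * B.card * C.card * (D.card : ℝ) ^ ((1 : ℝ) / 2) := by positivity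
  have triv0 : Ic A B C D ≤ 0 → Ic A B C D - (A.card : ℝ) * B.card * C.card * D.card / p ≤
      (8 * Qc + 22) * ((A.card : ℝ) ^ ((1 : ℝ) / 4) * B.card * C.card * (D.card : ℝ) ^ ((1 : ℝ) / 2) + (A.card : ℝ) ^ ((3 : ℝ) / 4) * ((B.card : ℝ) * C.card) ^ ((41 : ℝ) / 48) * (D.card : ℝ) ^ ((1 : ℝ) / 2)) := by
    intro h
    have := mul_nonneg (show 0 ≤ 8 * Qc + 22 by linarith) rhs0
    linarith
  by_cases hA : A.card = 0
  · apply triv0; simpa [hA] using tr1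
  by_cases hB : B.card = 0
  · apply triv0; simpa [hB] using tr1
  by_cases hC : C.card = 0
  · apply triv0; simpa [hC] using tr1
  by_cases hD : D.card = 0
  · apply triv0; simpa [hD] using tr2
  have hp : p ≠ 0 := (Fact.out : p.Prime).ne_zero
  have reg := reg1 p A B C D (Nat.one_le_iff_ne_zero.mpr hB) (Nat.one_le_iff_ne_zero.mpr hC)
  have reg' := Ic_reg2 A B C D
  rw [ZMod.card] at reg'
  have ea := exp_log_nat hA
  have eb := exp_log_nat hB
  have ec := exp_log_nat hC
  have ed := exp_log_nat hD
  have ep := exp_log_nat hp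
  set α := Real.log (A.card : ℝ) with hα
  set β := Real.log (B.card : ℝ) with hβ
  set γ := Real.log (C.card : ℝ) with hγ
  set δ := Real.log (D.card : ℝ) with hδ
  set π := Real.log (p : ℝ) with hπ
  have α0 : 0 ≤ α := Real.log_natCast_nonneg _
  have β0 : 0 ≤ β := Real.log_natCast_nonneg _
  have γ0 : 0 ≤ γ := Real.log_natCast_nonneg _
  have δ0 : 0 ≤ δ := Real.log_natCast_nonneg _
  have π0 : 0 < π := Real.log_pos (by exact_mod_cast (Fact.out : p.Prime).one_lt)
  have rp : ∀ (r z : ℝ), Real.exp z ^ r = Real.exp (z * r) := fun r z => (Real.exp_mul z r).symm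
  have T2e : (A.card : ℝ) ^ ((3 : ℝ) / 4) * ((B.card : ℝ) * C.card) ^ ((41 : ℝ) / 48) * (D.card : ℝ) ^ ((1 : ℝ) / 2)
      = Real.exp (α * (3 / 4) + (β + γ) * (41 / 48) + δ * (1 / 2)) := by
    rw [ea, eb, ec, ed, ← Real.exp_add, rp, rp, rp, ← Real.exp_add, ← Real.exp_add]
  set T1 := (A.card : ℝ) ^ ((1 : ℝ) / 4) * B.card * C.card * (D.card : ℝ) ^ ((1 : ℝ) / 2) with hT1
  set T2 := (A.card : ℝ) ^ ((3 : ℝ) / 4) * ((B.card : ℝ) * C.card) ^ ((41 : ℝ) / 48) * (D.card : ℝ) ^ ((1 : ℝ) / 2) with hT2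
  have T2nn : 0 ≤ T2 := by rw [T2e]; positivity
  by_cases hs : Ic A B C D ≤ T2
  · nlinarith [mul_nonneg hQ (add_nonneg T1nn T2nn)]
  push Not at hs
  have h1 : α * (3 / 4) + (β + γ) * (41 / 48) + δ * (1 / 2) < α + β + γ := by
    rw [← Real.exp_lt_exp, ← T2e, Real.exp_add, Real.exp_add, ← ea, ← eb, ← ec]; linarith
  have h2 : α * (3 / 4) + (β + γ) * (41 / 48) + δ * (1 / 2) < β + γ + δ := by
    rw [← Real.exp_lt_exp, ← T2e, Real.exp_add, Real.exp_add, ← ed, ← eb, ← ec]; linarith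
  have h3 : α * (3 / 4) + (β + γ) * (41 / 48) + δ * (1 / 2) < α + β + δ := by
    rw [← Real.exp_lt_exp, ← T2e, Real.exp_add, Real.exp_add, ← ea, ← eb, ← ed]; linarith
  have h4 : α * (3 / 4) + (β + γ) * (41 / 48) + δ * (1 / 2) < α + γ + δ := by
    rw [← Real.exp_lt_exp, ← T2e, Real.exp_add, Real.exp_add, ← ea, ← ec, ← ed]; linarith
  by_cases hN : 4 * (β + γ) ≤ 5 * π
  · have r := reg ?_ ?_ ?_
    · linarith
    · rcases le_total β γ with h | h
      · have : B.card ^ 3 ≤ p ^ 2 := nat_of_log hB hp (by push_cast; rw [← hβ, ← hπ]; linarith)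
        exact (Nat.pow_le_pow_left (min_le_left _ _) 3).trans this
      · have : C.card ^ 3 ≤ p ^ 2 := nat_of_log hC hp (by push_cast; rw [← hγ, ← hπ]; linarith)
        exact (Nat.pow_le_pow_left (min_le_right _ _) 3).trans this
    · have : B.card ^ 1 ≤ C.card ^ 3 := nat_of_log hB hC (by push_cast; rw [← hβ, ← hγ]; linarith)
      simpa using this
    · have : C.card ^ 1 ≤ B.card ^ 3 := nat_of_log hC hB (by push_cast; rw [← hβ, ← hγ]; linarith)
      simpa using this
  · push Not at hN
    have hpa : p ≤ A.card ^ 2 := by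
      have : p ^ 1 ≤ A.card ^ 2 := nat_of_log hp hA (by push_cast; rw [← hα, ← hπ]; linarith)
      simpa using this
    have hA2 : 2 ≤ A.card := by
      have := (Fact.out : p.Prime).two_le
      nlinarith
    obtain ⟨X, Y, hY0, hX, hX2, hY3⟩ := reg' hA2 (by exact_mod_cast hpa)
    set E := Real.exp (α * (3 / 2) + (β + γ) * (41 / 24)) with hE
    have E0 : 0 < E := Real.exp_pos _
    have pw : ∀ (n : ℕ) (z : ℝ), Real.exp z ^ n = Real.exp (n * z) := fun n z => (Real.exp_nat_mul z n).symm
    have b1 : (B.card : ℝ) ^ 2 * C.card * A.card ≤ E := by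
      rw [ea, eb, ec, pw, ← Real.exp_add, ← Real.exp_add, hE]
      apply Real.exp_le_exp.mpr; push_cast; linarith
    have b2 : Y ≤ 3 * E := by
      have : Y ^ 3 ≤ (3 * E) ^ 3 := by
        refine hY3.trans ?_
        have : ((B.card : ℝ) * C.card) ^ 4 * C.card * (p * (A.card : ℝ) ^ 4) ≤ E ^ 3 := by
          rw [ea, eb, ec, ep, hE, ← Real.exp_add, pw, pw, pw, ← Real.exp_add, ← Real.exp_add, ← Real.exp_add]
          apply Real.exp_le_exp.mpr; push_cast; linarith
        have : 0 ≤ E ^ 3 := by positivity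
        rw [mul_pow]
        linarith
      exact le_of_pow_le_pow_left₀ (by norm_num) (by positivity) this
    have b3 : (D.card : ℝ) * E = T2 ^ 2 := by
      rw [T2e, ed, hE, pw, ← Real.exp_add]
      congr 1; push_cast; ring
    have b4 : X ^ 2 ≤ (2 * T2) ^ 2 := by
      have : (D.card : ℝ) * ((B.card : ℝ) ^ 2 * C.card * A.card + Y) ≤ D.card * (4 * E) :=
        mul_le_mul_of_nonneg_left (by linarith) (Nat.cast_nonneg _)
      have e : (2 * T2) ^ 2 = D.card * (4 * E) := by rw [mul_pow, ← b3]; ring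
      rw [e]; linarith
    have b5 : X ≤ 2 * T2 := le_trans (le_abs_self X) (abs_le_of_sq_le_sq b4 (by linarith))
    have := mul_nonneg hQ (add_nonneg T1nn T2nn)
    linarith
end Fin1

lemma hyp_Ic (p : ℕ) [Fact p.Prime] (lam : ZMod p) (hl : lam ≠ 0) (A B C D : Finset (ZMod p)) :
    (hypCount p lam A B C D : ℝ) = Ic A B (C.image fun x => x / lam) (D.image fun x => x / lam) := by
  unfold hypCount Ic
  have inj : ∀ x y : ZMod p, x / lam = y / lam → x = y := fun x y h => by
    rwa [div_left_inj' hl] at h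
  rw [← sum_ind]
  simp only [Finset.sum_product]
  rw [Finset.sum_image (fun x _ y _ h => inj x y h)]
  simp only [Finset.sum_image (fun x _ y _ h => inj x y h)]
  have e : ∀ a b c d : ZMod p, ind ((a + b) * (c / lam + d / lam) = 1) = ind ((a + b) * (c + d) = lam) := by
    intro a b c d
    apply ind_congr
    rw [← add_div, ← mul_div_assoc, div_eq_one_iff_eq hl]
  simp only [e]
  symm
  rw [Finset.sum_comm]
  refine Finset.sum_congr rfl fun a _ => ?_
  rw [Finset.sum_comm]
  refine Finset.sum_congr rfl fun b _ => ?_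
  rw [Finset.sum_comm]

theorem stmt0 :
    ∃ C c : ℝ, 1 ≤ C ∧ 1 ≤ c ∧
      ∀ (p : ℕ), p.Prime → Odd p →
        ∀ (lam : ZMod p), lam ≠ 0 →
          ∀ A B Cs D : Finset (ZMod p),
            (hypCount p lam A B Cs D : ℝ) -
                (A.card : ℝ) * B.card * Cs.card * D.card / p ≤
              C * Real.log p ^ c *
                ((A.card : ℝ) ^ ((1 : ℝ) / 4) * B.card * Cs.card *
                    (D.card : ℝ) ^ ((1 : ℝ) / 2) +
                  (A.card : ℝ) ^ ((3 : ℝ) / 4) *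
                    ((B.card : ℝ) * Cs.card) ^ ((41 : ℝ) / 48) *
                    (D.card : ℝ) ^ ((1 : ℝ) / 2)) := by
  have hQ : 0 ≤ Qc := by unfold Qc; positivity
  refine ⟨8 * Qc + 22, 1, by linarith, le_refl _, ?_⟩
  intro p hp hodd lam hl A B Cs D
  haveI : Fact p.Prime := ⟨hp⟩
  have inj : Function.Injective fun x : ZMod p => x / lam := fun x y h => by
    simp only at h
    rwa [div_left_inj' hl] at h
  have h := core p A B (Cs.image fun x => x / lam) (D.image fun x => x / lam)
  rw [← hyp_Ic p lam hl, Finset.card_image_of_injective _ inj, Finset.card_image_of_injective _ inj] at h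
  refine h.trans ?_
  have hp3 : 3 ≤ p := by
    have := hp.two_le
    rcases hodd with ⟨k, hk⟩
    omega
  have hlog : 1 ≤ Real.log p := by
    rw [Real.le_log_iff_exp_le (by positivity)]
    have h3 : (3 : ℝ) ≤ p := by exact_mod_cast hp3
    have := Real.exp_one_lt_d9
    linarith
  rw [Real.rpow_one]
  refine mul_le_mul_of_nonneg_right ?_ (by positivity)
  nlinarith
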